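/- For every g ≥ 12, there exists an infinite family F_g of planar digraphs such that each H ∈ F_g has digirth g and, with n denoting its number of vertices, fvs(H) = (n − 2g/(g+2)) / (g − 2g/(g+2)). Consequently, with τ_g the supremum over infinite families of planar digraphs of digirth g of the limit superior of fvs(H)/n, one has τ_g ≥ (g+2)/g² for all g ≥ 6 with g ≠ 7, and τ_7 ≥ 2/11. -/

import Mathlib

/-- A finite directed graph. -/
structure Digr where
  V : Type
  [fintypeV : Fintype V]
  [decEqV : DecidableEq V]
  Adj : V → V → Prop

attribute [instance] Digr.fintypeV Digr.decEqV

/-- `l` is (the list of vertices of) a directed cycle in the digraph `H`. -/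
def Digr.IsDicycle (H : Digr) (l : List H.V) : Prop :=
  l ≠ [] ∧ l.Nodup ∧
    ∀ i : Fin l.length,
      H.Adj (l.get i)
        (l.get ⟨(i.1 + 1) % l.length, Nat.mod_lt _ (Nat.lt_of_le_of_lt (Nat.zero_le _) i.isLt)⟩)

/-- A feedback vertex set: a set of vertices meeting every directed cycle. -/
def Digr.IsFVS (H : Digr) (S : Finset H.V) : Prop :=
  ∀ l : List H.V, H.IsDicycle l → ∃ x ∈ S, x ∈ l

/-- The minimum size of a feedback vertex set of `H`. -/
noncomputable def Digr.fvs (H : Digr) : ℕ :=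
  sInf {n | ∃ S : Finset H.V, H.IsFVS S ∧ S.card = n}

/-- `H` has digirth `g`: the minimum length of a directed cycle of `H` is `g`. -/
def Digr.HasDigirth (H : Digr) (g : ℕ) : Prop :=
  (∃ l, H.IsDicycle l ∧ l.length = g) ∧ ∀ l, H.IsDicycle l → g ≤ l.length
/-- A digraph is planar if it can be drawn in the plane: vertices are mapped to
distinct points and every arc to a simple continuous curve between the points of
its endpoints, such that the interiors of the curves avoid the vertex points and
the curves of distinct arcs have disjoint interiors. -/
def Digr.IsPlanar (H : Digr) : Prop :=
  ∃ (p : H.V → ℝ × ℝ) (arc : ∀ u v : H.V, H.Adj u v → ℝ → ℝ × ℝ),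
    Function.Injective p ∧
    (∀ (u v : H.V) (h : H.Adj u v), arc u v h 0 = p u ∧ arc u v h 1 = p v) ∧
    (∀ (u v : H.V) (h : H.Adj u v), ContinuousOn (arc u v h) (Set.Icc 0 1)) ∧
    (∀ (u v : H.V) (h : H.Adj u v), Set.InjOn (arc u v h) (Set.Icc 0 1)) ∧
    (∀ (u v : H.V) (h : H.Adj u v) (w : H.V),
      ∀ t ∈ Set.Ioo (0 : ℝ) 1, arc u v h t ≠ p w) ∧
    (∀ (u v : H.V) (h : H.Adj u v) (u' v' : H.V) (h' : H.Adj u' v'),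
      (u, v) ≠ (u', v') →
      ∀ s ∈ Set.Ioo (0 : ℝ) 1, ∀ t ∈ Set.Ioo (0 : ℝ) 1,
        arc u v h s ≠ arc u' v' h' t)
/-- `τ_g`: the supremum, over infinite families `(H_i)` of planar digraphs of
digirth `g`, of `limsup_i fvs(H_i)/n(H_i)`. -/
noncomputable def tauPlanar (g : ℕ) : ℝ :=
  sSup {x : ℝ | ∃ Hs : ℕ → Digr,
    (∀ i, (Hs i).IsPlanar ∧ (Hs i).HasDigirth g) ∧
    (∀ N : ℕ, ∃ i, N ≤ Nat.card (Hs i).V) ∧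
    x = Filter.limsup
          (fun i => ((Hs i).fvs : ℝ) / (Nat.card (Hs i).V : ℝ)) Filter.atTop}

section Basics

/-- Directed walks of prescribed length. -/
inductive Wk {V : Type} (A : V → V → Prop) : ℕ → V → V → Prop
  | nil (a : V) : Wk A 0 a a
  | snoc {n : ℕ} {a b c : V} : Wk A n a b → A b c → Wk A (n + 1) a c

variable {V : Type} {A : V → V → Prop}

theorem Wk.trans {n m : ℕ} {a b c : V} (h : Wk A n a b) (h' : Wk A m b c) :
    Wk A (n + m) a c := by
  induction h' with
  | nil => simpa using h
  | snoc _ h2 ih => exact Wk.snoc (ih h) h2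

theorem Wk.map {W : Type} {B : W → W → Prop} (f : V → W) (hf : ∀ a b, A a b → B (f a) (f b))
    {n : ℕ} {a b : V} (h : Wk A n a b) : Wk B n (f a) (f b) := by
  induction h with
  | nil => exact Wk.nil _
  | snoc _ h2 ih => exact Wk.snoc ih (hf _ _ h2)

theorem Wk.single {a b : V} (h : A a b) : Wk A 1 a b := Wk.snoc (Wk.nil a) h

theorem Wk.eq_of_zero {a b : V} (h : Wk A 0 a b) : a = b := by
  cases h; rfl

theorem Wk.pot (f : V → ℕ) (hf : ∀ a b, A a b → f b ≤ f a + 1) {n : ℕ} {a b : V}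
    (h : Wk A n a b) : f b ≤ f a + n := by
  induction h with
  | nil => simp
  | snoc _ h2 ih => have := hf _ _ h2; omega

theorem Wk.of_seq (f : ℕ → V) (m : ℕ) (hf : ∀ t < m, A (f t) (f (t + 1))) (i j : ℕ)
    (hij : i ≤ j) (hj : j ≤ m) : Wk A (j - i) (f i) (f j) := by
  induction j, hij using Nat.le_induction with
  | base => simpa using Wk.nil (f i)
  | succ j hij ih =>
    have := Wk.snoc (ih (by omega)) (hf j (by omega))
    rwa [show j - i + 1 = j + 1 - i by omega] at this

theorem Wk.to_seq {n : ℕ} {a b : V} (h : Wk A n a b) :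
    ∃ f : ℕ → V, f 0 = a ∧ f n = b ∧ ∀ t < n, A (f t) (f (t + 1)) := by
  induction h with
  | nil a => exact ⟨fun _ => a, rfl, rfl, by simp⟩
  | @snoc n a b c h1 h2 ih =>
    obtain ⟨f, f0, fn, hf⟩ := ih
    refine ⟨fun t => if t ≤ n then f t else c, by simp [f0], by simp, ?_⟩
    intro t ht
    by_cases h : t + 1 ≤ n
    · simp [h, show t ≤ n by omega]; exact hf t (by omega)
    · have : t = n := by omega
      subst this
      simp [fn, h2]

/-- All closed walks of positive length have length at least `g`. -/
def GirthGE (A : V → V → Prop) (g : ℕ) : Prop := ∀ n a, 1 ≤ n → Wk A n a a → g ≤ n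

theorem GirthGE.of_pot {g : ℕ} (f1 f2 f3 : V → ℕ)
    (h : ∀ a b, A a b →
      (f1 b ≤ f1 a + 1 ∧ f2 b ≤ f2 a + 1 ∧ f3 a + 1 ≤ f3 b) ∨
      (f1 b ≤ f1 a + 1 ∧ f2 b + g ≤ f2 a + 1) ∨ (f1 b + g ≤ f1 a + 1)) : GirthGE A g := by
  have key : ∀ n a b, Wk A n a b → f1 b ≤ f1 a + n ∧
      (f1 b + g ≤ f1 a + n ∨ (f2 b ≤ f2 a + n ∧ (f2 b + g ≤ f2 a + n ∨ f3 a + n ≤ f3 b))) := by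
    intro n a b w
    induction w with
    | nil => simp
    | snoc _ h2 ih => have := h _ _ h2; omega
  intro n a hn w
  have := key n a a w
  omega

theorem isDicycle_of_seq (H : Digr) (f : ℕ → H.V) (m : ℕ) (hm : 1 ≤ m)
    (hf : ∀ t < m, H.Adj (f t) (f (t + 1))) (hc : f m = f 0)
    (hi : ∀ i j, i < j → j < m → f i ≠ f j) :
    H.IsDicycle (List.ofFn (fun t : Fin m => f t)) := by
  refine ⟨?_, ?_, ?_⟩
  · intro h
    have := congrArg List.length h
    simp at this; omega
  · rw [List.nodup_ofFn]
    intro i j hij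
    by_contra hne
    rcases lt_or_gt_of_ne (fun h => hne (Fin.ext h)) with h | h
    · exact hi i j h j.2 hij
    · exact hi j i h i.2 hij.symm
  · intro i
    have hi2 : i.1 < m := by simpa using i.2
    simp only [List.get_eq_getElem, List.getElem_ofFn, List.length_ofFn]
    by_cases h : i.1 + 1 = m
    · have := hf i.1 hi2
      rw [h, hc] at this
      simpa [h] using this
    · rw [Nat.mod_eq_of_lt (by omega)]
      exact hf i.1 hi2

theorem wk_of_list (B : V → V → Prop) (l : List V) (h0 : l ≠ [])
    (h : ∀ i : Fin l.length, B (l.get i)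
        (l.get ⟨(i.1 + 1) % l.length, Nat.mod_lt _ (Nat.lt_of_le_of_lt (Nat.zero_le _) i.isLt)⟩)) :
    ∃ a, Wk B l.length a a := by
  have hl : 0 < l.length := List.length_pos_of_ne_nil h0
  refine ⟨l.get ⟨0, hl⟩, ?_⟩
  have key : ∀ i (hi : i < l.length), Wk B i (l.get ⟨0, hl⟩) (l.get ⟨i, hi⟩) := by
    intro i
    induction i with
    | zero => intro hi; exact Wk.nil _
    | succ i ih =>
      intro hi
      have h1 := ih (by omega)
      have h2 := h ⟨i, by omega⟩
      simp only [Nat.mod_eq_of_lt hi] at h2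
      exact Wk.snoc h1 h2
  obtain ⟨m, hm⟩ : ∃ m, l.length = m + 1 := ⟨l.length - 1, by omega⟩
  have h1 := key m (by omega)
  have h2 := h ⟨m, by omega⟩
  have h3 : (m + 1) % l.length = 0 := by rw [hm]; simp
  simp only [h3] at h2
  have h5 : Wk B (m + 1) (l.get ⟨0, hl⟩) (l.get ⟨0, hl⟩) := Wk.snoc h1 h2
  generalize l.get ⟨0, hl⟩ = x at h5 ⊢
  rw [hm]; exact h5

theorem hasDigirth_of (H : Digr) (g : ℕ) (hg : 1 ≤ g) (h : GirthGE H.Adj g) (v : H.V)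
    (hv : Wk H.Adj g v v) : H.HasDigirth g := by
  constructor
  · obtain ⟨f, f0, fn, hf⟩ := hv.to_seq
    refine ⟨_, isDicycle_of_seq H f g hg hf (by rw [f0, fn]) ?_, by simp⟩
    intro i j hij hj he
    have := Wk.of_seq f g hf i j hij.le hj.le
    rw [he] at this
    have := h _ _ (by omega) this
    omega
  · intro l hl
    obtain ⟨a, ha⟩ := wk_of_list H.Adj l hl.1 hl.2.2
    exact h _ _ (List.length_pos_of_ne_nil hl.1) ha

theorem exists_dicycle_of_infinite (H : Digr) (f : ℕ → H.V)
    (hf : ∀ t, H.Adj (f t) (f (t + 1))) :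
    ∃ l, H.IsDicycle l ∧ ∀ x ∈ l, ∃ t, x = f t := by
  classical
  have hex : ∃ j, ∃ i, i < j ∧ f i = f j := by
    obtain ⟨x, y, hne, he⟩ := Finite.exists_ne_map_eq_of_infinite f
    rcases lt_or_gt_of_ne hne with h | h
    · exact ⟨y, x, h, he⟩
    · exact ⟨x, y, h, he.symm⟩
  obtain ⟨i, hij, he⟩ := Nat.find_spec hex
  set j := Nat.find hex with hj
  refine ⟨_, isDicycle_of_seq H (fun t => f (i + t)) (j - i) (by omega) ?_ ?_ ?_, ?_⟩
  · intro t _; exact hf (i + t)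
  · simp [show i + (j - i) = j by omega, he]
  · intro a b hab hb heq
    exact Nat.find_min hex (m := i + b) (by omega) ⟨i + a, by omega, heq⟩
  · intro x hx
    rw [List.mem_ofFn] at hx
    obtain ⟨t, rfl⟩ := hx
    exact ⟨_, rfl⟩

/-- A linear space of functions certifying a lower bound on feedback vertex sets. -/
structure Wit (A : V → V → Prop) (E : Type) [AddCommGroup E] [Module ℝ E] where
  T : E →ₗ[ℝ] (V → ℝ)
  inj : ∀ e, T e = 0 → e = 0
  step : ∀ e v, T e v ≠ 0 → ∃ w, A v w ∧ T e w ≠ 0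

theorem Wit.le_card (H : Digr) {E : Type} [AddCommGroup E] [Module ℝ E] [FiniteDimensional ℝ E]
    (w : Wit H.Adj E) (S : Finset H.V) (hS : H.IsFVS S) : Module.finrank ℝ E ≤ S.card := by
  classical
  by_contra hlt
  push Not at hlt
  let P : E →ₗ[ℝ] (S → ℝ) := (LinearMap.funLeft ℝ ℝ (fun s : S => s.1)).comp w.T
  have hk : LinearMap.ker P ≠ ⊥ := by
    apply LinearMap.ker_ne_bot_of_finrank_lt
    simpa using hlt
  obtain ⟨e, he, hne⟩ := (Submodule.ne_bot_iff _).1 hk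
  have hz : ∀ s ∈ S, w.T e s = 0 := by
    intro s hs
    have := congrFun (LinearMap.mem_ker.1 he) ⟨s, hs⟩
    simpa [P, LinearMap.funLeft_apply] using this
  have hT : ∃ v, w.T e v ≠ 0 := by
    by_contra hcon
    push Not at hcon
    exact hne (w.inj e (funext hcon))
  obtain ⟨v0, hv0⟩ := hT
  let nx : {v : H.V // w.T e v ≠ 0} → {v : H.V // w.T e v ≠ 0} :=
    fun v => ⟨(w.step e v.1 v.2).choose, (w.step e v.1 v.2).choose_spec.2⟩
  have hnx : ∀ v, H.Adj v.1 (nx v).1 := fun v => (w.step e v.1 v.2).choose_spec.1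
  let f : ℕ → {v : H.V // w.T e v ≠ 0} := fun n => nx^[n] ⟨v0, hv0⟩
  obtain ⟨l, hl, hm⟩ := exists_dicycle_of_infinite H (fun n => (f n).1) (by
    intro t
    have : f (t + 1) = nx (f t) := Function.iterate_succ_apply' nx t _
    simp only [this]
    exact hnx _)
  obtain ⟨x, hxS, hxl⟩ := hS l hl
  obtain ⟨t, rfl⟩ := hm x hxl
  exact (f t).2 (hz _ hxS)

/-- A feedback vertex set together with a ranking certifying acyclicity of the rest. -/
structure Fv (A : V → V → Prop) (k : ℕ) where
  S : Finset V
  card : S.card = k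
  rk : V → ℕ
  dec : ∀ u v, A u v → u ∉ S → v ∉ S → rk v < rk u

theorem Fv.isFVS (H : Digr) {k : ℕ} (F : Fv H.Adj k) : H.IsFVS F.S := by
  intro l hl
  by_contra hcon
  push Not at hcon
  have hn : ∀ i : Fin l.length, l.get i ∉ F.S := fun i h => hcon _ h (List.get_mem l i)
  obtain ⟨a, ha⟩ := wk_of_list (fun u v => F.rk v < F.rk u) l hl.1
    (fun i => F.dec _ _ (hl.2.2 i) (hn _) (hn _))
  have key : ∀ n a b, Wk (fun u v => F.rk v < F.rk u) n a b → F.rk b + n ≤ F.rk a := by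
    intro n a b w
    induction w with
    | nil => simp
    | snoc _ h2 ih => omega
  have := key _ _ _ ha
  have := List.length_pos_of_ne_nil hl.1
  omega

theorem fvs_eq (H : Digr) {k : ℕ} (F : Fv H.Adj k) {E : Type} [AddCommGroup E] [Module ℝ E]
    [FiniteDimensional ℝ E] (w : Wit H.Adj E) (hE : Module.finrank ℝ E = k) : H.fvs = k := by
  apply le_antisymm
  · exact Nat.sInf_le (s := {n | ∃ S : Finset H.V, H.IsFVS S ∧ S.card = n}) ⟨F.S, F.isFVS H, F.card⟩
  · refine le_csInf (s := {n | ∃ S : Finset H.V, H.IsFVS S ∧ S.card = n}) ⟨k, F.S, F.isFVS H, F.card⟩ ?_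
    rintro n ⟨S, hS, rfl⟩
    rw [← hE]
    exact w.le_card H S hS

theorem fvs_le_card (H : Digr) : H.fvs ≤ Nat.card H.V := by
  rw [Nat.card_eq_fintype_card]
  apply Nat.sInf_le
  refine ⟨Finset.univ, ?_, rfl⟩
  intro l hl
  obtain ⟨x, hx⟩ := List.exists_mem_of_ne_nil l hl.1
  exact ⟨x, Finset.mem_univ _, hx⟩

/-- Two-page book embeddings. -/
structure Book (A : V → V → Prop) where
  key : V → ℕ
  L : V → V → Prop
  R : V → V → Prop
  inj : ∀ a b, key a = key b → a = b
  Llt : ∀ a b, L a b → key a < key b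
  Rlt : ∀ a b, R a b → key a < key b
  cover : ∀ u v, A u v → L u v ∨ L v u ∨ R u v ∨ R v u
  Lx : ∀ a b c d, L a b → L c d → ¬ (key a < key c ∧ key c < key b ∧ key b < key d)
  Rx : ∀ a b c d, R a b → R c d → ¬ (key a < key c ∧ key c < key b ∧ key b < key d)

theorem parab_ne {a b c d x : ℝ} (h1 : a < x) (h2 : x < b) (h3 : c < x) (h4 : x < d)
    (hx1 : ¬ (a < c ∧ c < b ∧ b < d)) (hx2 : ¬ (c < a ∧ a < d ∧ d < b))
    (he : (x - a) * (b - x) = (x - c) * (d - x)) : a = c ∧ b = d := by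
  rcases lt_trichotomy a c with h | h | h
  · exfalso
    have : d ≤ b := by
      by_contra hc; push Not at hc
      exact hx1 ⟨h, by linarith, hc⟩
    nlinarith [mul_pos (sub_pos.2 h) (sub_pos.2 h2), mul_nonneg (sub_nonneg.2 this) (sub_pos.2 h3).le]
  · subst h
    refine ⟨rfl, ?_⟩
    have := mul_left_cancel₀ (sub_pos.2 h1).ne' he
    linarith
  · exfalso
    have : b ≤ d := by
      by_contra hc; push Not at hc
      exact hx2 ⟨h, by linarith, hc⟩
    nlinarith [mul_pos (sub_pos.2 h) (sub_pos.2 h4), mul_nonneg (sub_nonneg.2 this) (sub_pos.2 h1).le]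

open Classical in
/-- The side of the spine on which an arc is drawn. -/
noncomputable def Book.sg (B : Book A) (u v : V) : ℝ := if B.L u v ∨ B.L v u then 1 else -1

theorem Book.sg_ne (B : Book A) (u v : V) : B.sg u v ≠ 0 := by
  unfold Book.sg; split_ifs <;> norm_num

/-- Ordered version of the noncrossing statement for chords on one side. -/
theorem Book.same_side (B : Book A) (Q : V → V → Prop)
    (Qlt : ∀ a b, Q a b → B.key a < B.key b)
    (Qx : ∀ a b c d, Q a b → Q c d → ¬ (B.key a < B.key c ∧ B.key c < B.key b ∧ B.key b < B.key d))
    {u v u' v' : V} (h : Q u v ∨ Q v u) (h' : Q u' v' ∨ Q v' u') {s t : ℝ}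
    (hs : s ∈ Set.Ioo (0 : ℝ) 1) (ht : t ∈ Set.Ioo (0 : ℝ) 1)
    (hx : (B.key u : ℝ) + s * (B.key v - B.key u) = (B.key u' : ℝ) + t * (B.key v' - B.key u'))
    (hy : s * (1 - s) * ((B.key v : ℝ) - B.key u) ^ 2 = t * (1 - t) * ((B.key v' : ℝ) - B.key u') ^ 2) :
    (u = u' ∧ v = v') ∨ (u = v' ∧ v = u') := by
  have main : ∀ (a b c d : V) (s t : ℝ), Q a b → Q c d → s ∈ Set.Ioo (0 : ℝ) 1 →
      t ∈ Set.Ioo (0 : ℝ) 1 →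
      (B.key a : ℝ) + s * (B.key b - B.key a) = (B.key c : ℝ) + t * (B.key d - B.key c) →
      s * (1 - s) * ((B.key b : ℝ) - B.key a) ^ 2 = t * (1 - t) * ((B.key d : ℝ) - B.key c) ^ 2 →
      a = c ∧ b = d := by
    intro a b c d s t hab hcd hs ht hx hy
    have l1 : (B.key a : ℝ) < B.key b := by exact_mod_cast Qlt _ _ hab
    have l2 : (B.key c : ℝ) < B.key d := by exact_mod_cast Qlt _ _ hcd
    obtain ⟨s0, s1⟩ := hs
    obtain ⟨t0, t1⟩ := ht
    have := parab_ne (a := B.key a) (b := B.key b) (c := B.key c) (d := B.key d)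
      (x := (B.key a : ℝ) + s * (B.key b - B.key a)) (by nlinarith) (by nlinarith)
      (by rw [hx]; nlinarith) (by rw [hx]; nlinarith)
      (by exact_mod_cast Qx _ _ _ _ hab hcd) (by exact_mod_cast Qx _ _ _ _ hcd hab)
      (by
        have e1 : ((B.key a : ℝ) + s * (B.key b - B.key a) - B.key a) *
          (B.key b - ((B.key a : ℝ) + s * (B.key b - B.key a)))
          = s * (1 - s) * ((B.key b : ℝ) - B.key a) ^ 2 := by ring
        rw [e1, hy, hx]; ring)
    exact ⟨B.inj _ _ (by exact_mod_cast this.1), B.inj _ _ (by exact_mod_cast this.2)⟩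
  have fl : ∀ s : ℝ, s ∈ Set.Ioo (0 : ℝ) 1 → 1 - s ∈ Set.Ioo (0 : ℝ) 1 :=
    fun s hs => ⟨by linarith [hs.2], by linarith [hs.1]⟩
  rcases h with h | h <;> rcases h' with h' | h'
  · exact Or.inl (main _ _ _ _ s t h h' hs ht hx hy)
  · exact Or.inr (main _ _ _ _ s (1 - t) h h' hs (fl t ht) (by linarith) (by rw [hy]; ring))
  · have := main _ _ _ _ (1 - s) t h h' (fl s hs) ht (by linarith) (by rw [← hy]; ring)
    exact Or.inr ⟨this.2, this.1⟩
  · have := main _ _ _ _ (1 - s) (1 - t) h h' (fl s hs) (fl t ht) (by linarith)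
      (by linear_combination hy)
    exact Or.inl ⟨this.2, this.1⟩

theorem Book.isPlanar (H : Digr) (B : Book H.Adj) {g : ℕ} (hg : 3 ≤ g) (hG : GirthGE H.Adj g) :
    H.IsPlanar := by
  have kne : ∀ u v, H.Adj u v → (B.key v : ℝ) - B.key u ≠ 0 := by
    intro u v h h0
    have h1 : (B.key v : ℝ) = B.key u := by linarith
    have h2 : v = u := B.inj _ _ (by exact_mod_cast h1)
    subst h2
    have := hG 1 _ le_rfl (Wk.single h)
    omega
  refine ⟨fun v => ((B.key v : ℝ), 0), fun u v _ t => ((B.key u : ℝ) + t * (B.key v - B.key u),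
    B.sg u v * (t * (1 - t) * ((B.key v : ℝ) - B.key u) ^ 2)), ?_, ?_, ?_, ?_, ?_, ?_⟩
  · intro a b h
    simp only [Prod.mk.injEq, Nat.cast_inj, and_true] at h
    exact B.inj _ _ h
  · intro u v h
    simp
  · intro u v h
    apply Continuous.continuousOn
    fun_prop
  · intro u v h s _ t _ he
    simp only [Prod.mk.injEq] at he
    exact mul_right_cancel₀ (kne u v h) (by linarith [he.1])
  · intro u v h w t ht he
    simp only [Prod.mk.injEq] at he
    have h1 : t * (1 - t) * ((B.key v : ℝ) - B.key u) ^ 2 ≠ 0 := by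
      have := kne u v h
      have := ht.1.ne'
      have : 1 - t ≠ 0 := by linarith [ht.2]
      positivity
    exact mul_ne_zero (B.sg_ne u v) h1 he.2
  · intro u v h u' v' h' hne s hs t ht he
    simp only [Prod.mk.injEq] at he
    obtain ⟨hx, hy⟩ := he
    have p1 : 0 < s * (1 - s) * ((B.key v : ℝ) - B.key u) ^ 2 :=
      mul_pos (mul_pos hs.1 (by linarith [hs.2])) (by have := kne u v h; positivity)
    have p2 : 0 < t * (1 - t) * ((B.key v' : ℝ) - B.key u') ^ 2 :=
      mul_pos (mul_pos ht.1 (by linarith [ht.2])) (by have := kne u' v' h'; positivity)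
    have fin : (u = u' ∧ v = v') ∨ (u = v' ∧ v = u') → False := by
      rintro (⟨rfl, rfl⟩ | ⟨rfl, rfl⟩)
      · exact hne rfl
      · have := hG 2 _ (by norm_num) (Wk.snoc (Wk.single h) h')
        omega
    by_cases c1 : B.L u v ∨ B.L v u <;> by_cases c2 : B.L u' v' ∨ B.L v' u'
    · simp only [Book.sg, if_pos c1, if_pos c2, one_mul] at hy
      exact fin (B.same_side B.L B.Llt B.Lx c1 c2 hs ht hx hy)
    · simp only [Book.sg, if_pos c1, if_neg c2] at hy
      linarith
    · simp only [Book.sg, if_neg c1, if_pos c2] at hy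
      linarith
    · simp only [Book.sg, if_neg c1, if_neg c2] at hy
      have r1 : B.R u v ∨ B.R v u := by have := B.cover u v h; tauto
      have r2 : B.R u' v' ∨ B.R v' u' := by have := B.cover u' v' h'; tauto
      exact fin (B.same_side B.R B.Rlt B.Rx r1 r2 hs ht hx (by linarith))

theorem tau_lower (g a b c d : ℕ) (hd : 0 < d)
    (h : ∀ s : ℕ, ∃ H : Digr, H.IsPlanar ∧ H.HasDigirth g ∧ H.fvs = a + b * s ∧
      Nat.card H.V = c + d * s) : (b : ℝ) / d ≤ tauPlanar g := by
  choose Hs h1 h2 h3 h4 using h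
  have bdd : ∀ (K : Digr), (K.fvs : ℝ) / (Nat.card K.V : ℝ) ≤ 1 := by
    intro K
    apply div_le_one_of_le₀ (by exact_mod_cast fvs_le_card K) (by positivity)
  have nn : ∀ (K : Digr), (0 : ℝ) ≤ (K.fvs : ℝ) / (Nat.card K.V : ℝ) := fun K => by positivity
  apply le_csSup
  · refine ⟨1, ?_⟩
    rintro x ⟨Ks, -, -, rfl⟩
    apply Filter.limsup_le_of_le
    · exact Filter.isCoboundedUnder_le_of_le Filter.atTop (x := 0) (fun i => nn _)
    · exact Filter.Eventually.of_forall (fun i => bdd _)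
  · refine ⟨Hs, fun i => ⟨h1 i, h2 i⟩, ?_, ?_⟩
    · intro N
      refine ⟨N, ?_⟩
      rw [h4]; nlinarith
    · symm
      apply Filter.Tendsto.limsup_eq
      have e : (fun i : ℕ => ((Hs i).fvs : ℝ) / (Nat.card (Hs i).V : ℝ)) =
          fun i : ℕ => ((a : ℝ) + b * i) / ((c : ℝ) + d * i) := by
        funext i; rw [h3, h4]; push_cast; ring
      rw [e]
      exact tendsto_add_mul_div_add_mul_atTop_nhds (a : ℝ) c b (by exact_mod_cast hd.ne')

end Basics

section Gluing

/-- A port: two vertices `q`, `r` with designated in- and out-neighbours. -/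
structure Prt (V : Type) where
  qm : V
  q : V
  qp : V
  rm : V
  r : V
  rp : V

/-- The port with the two vertices exchanged. -/
def Prt.swap {V : Type} (P : Prt V) : Prt V := ⟨P.rm, P.r, P.rp, P.qm, P.q, P.qp⟩

/-- Image of a port. -/
def Prt.map {V W : Type} (f : V → W) (P : Prt V) : Prt W :=
  ⟨f P.qm, f P.q, f P.qp, f P.rm, f P.r, f P.rp⟩

/-- The port vertices have in- and out-degree one. -/
structure Deg {V : Type} (A : V → V → Prop) (P : Prt V) : Prop where
  aq : A P.qm P.q
  bq : A P.q P.qp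
  inq : ∀ u, A u P.q → u = P.qm
  outq : ∀ u, A P.q u → u = P.qp
  ar : A P.rm P.r
  br : A P.r P.rp
  inr : ∀ u, A u P.r → u = P.rm
  outr : ∀ u, A P.r u → u = P.rp

theorem Deg.swap {V : Type} {A : V → V → Prop} {P : Prt V} (h : Deg A P) : Deg A P.swap :=
  ⟨h.ar, h.br, h.inr, h.outr, h.aq, h.bq, h.inq, h.outq⟩

/-- `A` on `W` is obtained from `A1` and `A2` by identifying the ports and adding four arcs. -/
structure Glue {V1 V2 W : Type} (A1 : V1 → V1 → Prop) (A2 : V2 → V2 → Prop) (A : W → W → Prop)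
    (i1 : V1 → W) (i2 : V2 → W) (P : Prt V1) (X : Prt V2) : Prop where
  inj1 : ∀ a b, i1 a = i1 b → a = b
  inj2 : ∀ a b, i2 a = i2 b → a = b
  eqq : i1 P.q = i2 X.q
  eqr : i1 P.r = i2 X.r
  eq : ∀ a b, i1 a = i2 b → (a = P.q ∧ b = X.q) ∨ (a = P.r ∧ b = X.r)
  surj : ∀ w, (∃ a, w = i1 a) ∨ ∃ b, w = i2 b
  arc : ∀ u v, A u v → (∃ a b, A1 a b ∧ u = i1 a ∧ v = i1 b) ∨ (∃ a b, A2 a b ∧ u = i2 a ∧ v = i2 b)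
    ∨ (u = i1 P.qm ∧ v = i2 X.qp) ∨ (u = i2 X.qm ∧ v = i1 P.qp)
    ∨ (u = i1 P.rm ∧ v = i2 X.rp) ∨ (u = i2 X.rm ∧ v = i1 P.rp)
  arc1 : ∀ a b, A1 a b → A (i1 a) (i1 b)
  arc2 : ∀ a b, A2 a b → A (i2 a) (i2 b)
  sk1 : A (i1 P.qm) (i2 X.qp)
  sk2 : A (i2 X.qm) (i1 P.qp)
  sk3 : A (i1 P.rm) (i2 X.rp)
  sk4 : A (i2 X.rm) (i1 P.rp)
  deg1 : Deg A1 P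
  deg2 : Deg A2 X

variable {V1 V2 W : Type} {A1 : V1 → V1 → Prop} {A2 : V2 → V2 → Prop} {A : W → W → Prop}
    {i1 : V1 → W} {i2 : V2 → W} {P : Prt V1} {X : Prt V2}

theorem Glue.swap (G : Glue A1 A2 A i1 i2 P X) : Glue A1 A2 A i1 i2 P.swap X.swap :=
  ⟨G.inj1, G.inj2, G.eqr, G.eqq, fun a b h => (G.eq a b h).symm, G.surj, fun u v h => by
    have := G.arc u v h
    simp only [Prt.swap]
    rcases this with h | h | h | h | h | h <;> simp [h], G.arc1, G.arc2, G.sk3, G.sk4, G.sk1, G.sk2, G.deg1.swap,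
    G.deg2.swap⟩

theorem Glue.flip (G : Glue A1 A2 A i1 i2 P X) : Glue A2 A1 A i2 i1 X P :=
  ⟨G.inj2, G.inj1, G.eqq.symm, G.eqr.symm, fun a b h => by have := G.eq b a h.symm; tauto,
    fun w => (G.surj w).symm, fun u v h => by
    have := G.arc u v h
    rcases this with h | h | h | h | h | h <;> simp [h], G.arc2, G.arc1, G.sk2, G.sk1, G.sk4, G.sk3, G.deg2, G.deg1⟩

/-- Lower bounds on the two distances between the port vertices. -/
structure Dst {V : Type} (A : V → V → Prop) (P : Prt V) (h1 h2 : ℕ) : Prop where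
  qr : ∀ l, Wk A l P.q P.r → h1 ≤ l
  rq : ∀ l, Wk A l P.r P.q → h2 ≤ l

theorem Dst.swap {V : Type} {A : V → V → Prop} {P : Prt V} {h1 h2 : ℕ} (h : Dst A P h1 h2) :
    Dst A P.swap h2 h1 := ⟨h.rq, h.qr⟩

/-- The four neighbours in the port are different from the port vertices. -/
theorem port_ne {V : Type} {A : V → V → Prop} {P : Prt V} {g h1 h2 : ℕ} (hg : 2 ≤ g)
    (hG : GirthGE A g) (D : Deg A P) (h : Dst A P h1 h2) (hh1 : 2 ≤ h1) (hh2 : 2 ≤ h2) :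
    P.qm ≠ P.q ∧ P.qm ≠ P.r ∧ P.qp ≠ P.q ∧ P.qp ≠ P.r ∧
    P.rm ≠ P.q ∧ P.rm ≠ P.r ∧ P.rp ≠ P.q ∧ P.rp ≠ P.r := by
  have l1 : ∀ a, ¬ A a a := fun a ha => by
    have := hG 1 a le_rfl (Wk.single ha); omega
  have l2 : ¬ A P.q P.r := fun ha => by
    have := h.qr 1 (Wk.single ha); omega
  have l3 : ¬ A P.r P.q := fun ha => by
    have := h.rq 1 (Wk.single ha); omega
  refine ⟨?_, ?_, ?_, ?_, ?_, ?_, ?_, ?_⟩ <;> intro e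
  · exact l1 P.q (by have := D.aq; rwa [e] at this)
  · exact l3 (by have := D.aq; rwa [e] at this)
  · exact l1 P.q (by have := D.bq; rwa [e] at this)
  · exact l2 (by have := D.bq; rwa [e] at this)
  · exact l2 (by have := D.ar; rwa [e] at this)
  · exact l1 P.r (by have := D.ar; rwa [e] at this)
  · exact l3 (by have := D.br; rwa [e] at this)
  · exact l1 P.r (by have := D.br; rwa [e] at this)

/-- Gluing with the numerical conditions needed to keep the girth. -/
structure GlueN (A1 : V1 → V1 → Prop) (A2 : V2 → V2 → Prop) (A : W → W → Prop)
    (i1 : V1 → W) (i2 : V2 → W) (P : Prt V1) (X : Prt V2) (g h1 h2 x1 x2 : ℕ) : Prop where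
  G : Glue A1 A2 A i1 i2 P X
  g2 : 2 ≤ g
  gir1 : GirthGE A1 g
  gir2 : GirthGE A2 g
  dst1 : Dst A1 P h1 h2
  dst2 : Dst A2 X x1 x2
  h12 : 2 ≤ h1
  h22 : 2 ≤ h2
  x12 : 2 ≤ x1
  x22 : 2 ≤ x2
  e1 : g + 2 ≤ h1 + x2
  e2 : g + 2 ≤ h2 + x1

variable {g h1 h2 x1 x2 : ℕ}

theorem GlueN.swap (N : GlueN A1 A2 A i1 i2 P X g h1 h2 x1 x2) :
    GlueN A1 A2 A i1 i2 P.swap X.swap g h2 h1 x2 x1 :=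
  ⟨N.G.swap, N.g2, N.gir1, N.gir2, N.dst1.swap, N.dst2.swap, N.h22, N.h12, N.x22, N.x12, N.e2, N.e1⟩

theorem GlueN.flip (N : GlueN A1 A2 A i1 i2 P X g h1 h2 x1 x2) :
    GlueN A2 A1 A i2 i1 X P g x1 x2 h1 h2 :=
  ⟨N.G.flip, N.g2, N.gir2, N.gir1, N.dst2, N.dst1, N.x12, N.x22, N.h12, N.h22,
    by have := N.e2; omega, by have := N.e1; omega⟩

/-- Invariant for walks that have used the second part, entering it at `q`. -/
def GSt (A1 : V1 → V1 → Prop) (A2 : V2 → V2 → Prop) (i1 : V1 → W) (i2 : V2 → W) (P : Prt V1)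
    (X : Prt V2) (s : V1) (l : ℕ) (t : W) : Prop :=
  (∃ t' l1 l2, t = i2 t' ∧ Wk A1 l1 s P.q ∧ Wk A2 l2 X.q t' ∧ 1 ≤ l2 ∧
    (l1 + l2 ≤ l ∨ (1 ≤ l1 ∧ l1 + l2 ≤ l + 1))) ∨
  (∃ t' l1 l2 l3, t = i1 t' ∧ Wk A1 l1 s P.q ∧ Wk A2 l2 X.q X.r ∧ Wk A1 l3 P.r t' ∧ 1 ≤ l3 ∧
    l1 + l2 + l3 ≤ l + 2)

theorem GlueN.step (N : GlueN A1 A2 A i1 i2 P X g h1 h2 x1 x2) {s : V1} {l : ℕ} {t v : W}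
    (h : GSt A1 A2 i1 i2 P X s l t) (ha : A t v) :
    g ≤ l + 1 ∨ GSt A1 A2 i1 i2 P X s (l + 1) v := by
  have G := N.G
  obtain ⟨p1, p2, p3, p4, p5, p6, p7, p8⟩ := port_ne N.g2 N.gir1 G.deg1 N.dst1 N.h12 N.h22
  obtain ⟨y1, y2, y3, y4, y5, y6, y7, y8⟩ := port_ne N.g2 N.gir2 G.deg2 N.dst2 N.x12 N.x22
  have := N.e2
  have := N.x12
  rcases h with ⟨t', l1, l2, rfl, w1, w2, h2, hl⟩ | ⟨t', l1, l2, l3, rfl, w1, w2, w3, h3, hl⟩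
  · rcases G.arc _ _ ha with ⟨a, b, hab, e, rfl⟩ | ⟨a, b, hab, e, rfl⟩ | ⟨e, rfl⟩ | ⟨e, rfl⟩ |
      ⟨e, rfl⟩ | ⟨e, rfl⟩
    · rcases G.eq _ _ e.symm with ⟨rfl, rfl⟩ | ⟨rfl, rfl⟩
      · left; have := N.gir2 _ _ h2 w2; omega
      · right; right
        exact ⟨b, l1, l2, 1, rfl, w1, w2, Wk.single hab, le_rfl, by omega⟩
    · obtain rfl := G.inj2 _ _ e
      right; left
      exact ⟨b, l1, l2 + 1, rfl, w1, w2.snoc hab, by omega, by omega⟩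
    · rcases G.eq _ _ e.symm with ⟨e, -⟩ | ⟨e, -⟩
      · exact absurd e p1
      · exact absurd e p2
    · obtain rfl := G.inj2 _ _ e
      left; have := N.gir2 _ _ (by omega) (w2.snoc G.deg2.aq); omega
    · rcases G.eq _ _ e.symm with ⟨e, -⟩ | ⟨e, -⟩
      · exact absurd e p5
      · exact absurd e p6
    · obtain rfl := G.inj2 _ _ e
      right; right
      exact ⟨_, l1, l2 + 1, 1, rfl, w1, w2.snoc G.deg2.ar, Wk.single G.deg1.br, le_rfl, by omega⟩
  · have k2 := N.dst2.qr _ w2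
    rcases G.arc _ _ ha with ⟨a, b, hab, e, rfl⟩ | ⟨a, b, hab, e, rfl⟩ | ⟨e, rfl⟩ | ⟨e, rfl⟩ |
      ⟨e, rfl⟩ | ⟨e, rfl⟩
    · obtain rfl := G.inj1 _ _ e
      right; right
      exact ⟨b, l1, l2, l3 + 1, rfl, w1, w2, w3.snoc hab, by omega, by omega⟩
    · rcases G.eq _ _ e with ⟨rfl, rfl⟩ | ⟨rfl, rfl⟩
      · left; have := N.dst1.rq _ w3; omega
      · left; have := N.gir1 _ _ h3 w3; omega
    · obtain rfl := G.inj1 _ _ e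
      left; have := N.dst1.rq _ (w3.snoc G.deg1.aq); omega
    · rcases G.eq _ _ e with ⟨-, e⟩ | ⟨-, e⟩
      · exact absurd e y1
      · exact absurd e y2
    · obtain rfl := G.inj1 _ _ e
      left; have := N.gir1 _ _ (by omega) (w3.snoc G.deg1.ar); omega
    · rcases G.eq _ _ e with ⟨-, e⟩ | ⟨-, e⟩
      · exact absurd e y5
      · exact absurd e y6

theorem GlueN.walk (N : GlueN A1 A2 A i1 i2 P X g h1 h2 x1 x2) {s : V1} {l : ℕ} {t : W}
    (w : Wk A l (i1 s) t) : g ≤ l ∨ (∃ t', t = i1 t' ∧ Wk A1 l s t') ∨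
      GSt A1 A2 i1 i2 P X s l t ∨ GSt A1 A2 i1 i2 P.swap X.swap s l t := by
  have G := N.G
  obtain ⟨y1, y2, y3, y4, y5, y6, y7, y8⟩ := port_ne N.g2 N.gir2 G.deg2 N.dst2 N.x12 N.x22
  induction l generalizing t with
  | zero =>
    cases w
    exact Or.inr (Or.inl ⟨s, rfl, Wk.nil s⟩)
  | succ l ih =>
    cases w with
    | @snoc _ _ b _ w1 ha =>
    rcases ih w1 with h | ⟨t', rfl, w⟩ | h | h
    · left; omega
    · rcases G.arc _ _ ha with ⟨a, b, hab, e, rfl⟩ | ⟨a, b, hab, e, rfl⟩ | ⟨e, rfl⟩ | ⟨e, rfl⟩ |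
        ⟨e, rfl⟩ | ⟨e, rfl⟩
      · obtain rfl := G.inj1 _ _ e
        exact Or.inr (Or.inl ⟨b, rfl, w.snoc hab⟩)
      · rcases G.eq _ _ e with ⟨rfl, rfl⟩ | ⟨rfl, rfl⟩
        · right; right; left; left
          exact ⟨b, l, 1, rfl, w, Wk.single hab, le_rfl, Or.inl le_rfl⟩
        · right; right; right; left
          exact ⟨b, l, 1, rfl, w, Wk.single hab, le_rfl, Or.inl le_rfl⟩
      · obtain rfl := G.inj1 _ _ e
        right; right; left; left
        exact ⟨_, l + 1, 1, rfl, w.snoc G.deg1.aq, Wk.single G.deg2.bq, le_rfl, by omega⟩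
      · rcases G.eq _ _ e with ⟨-, e⟩ | ⟨-, e⟩
        · exact absurd e y1
        · exact absurd e y2
      · obtain rfl := G.inj1 _ _ e
        right; right; right; left
        exact ⟨_, l + 1, 1, rfl, w.snoc G.deg1.ar, Wk.single G.deg2.br, le_rfl, by omega⟩
      · rcases G.eq _ _ e with ⟨-, e⟩ | ⟨-, e⟩
        · exact absurd e y5
        · exact absurd e y6
    · rcases N.step h ha with h | h
      · exact Or.inl h
      · exact Or.inr (Or.inr (Or.inl h))
    · rcases N.swap.step h ha with h | h
      · exact Or.inl h
      · exact Or.inr (Or.inr (Or.inr h))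

/-- Distances inside one part of a glued graph. -/
theorem GlueN.dist (N : GlueN A1 A2 A i1 i2 P X g h1 h2 x1 x2) {s t : V1} {l : ℕ}
    (w : Wk A l (i1 s) (i1 t)) : g ≤ l ∨ Wk A1 l s t ∨
      (∃ l1 l2 l3, Wk A1 l1 s P.q ∧ Wk A2 l2 X.q X.r ∧ Wk A1 l3 P.r t ∧ l1 + l2 + l3 ≤ l + 2) ∨
      (∃ l1 l2 l3, Wk A1 l1 s P.r ∧ Wk A2 l2 X.r X.q ∧ Wk A1 l3 P.q t ∧ l1 + l2 + l3 ≤ l + 2) := by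
  have G := N.G
  rcases N.walk w with h | ⟨t', e, w⟩ | h | h
  · exact Or.inl h
  · obtain rfl := G.inj1 _ _ e
    exact Or.inr (Or.inl w)
  · rcases h with ⟨t', l1, l2, e, w1, w2, h2, hl⟩ | ⟨t', l1, l2, l3, e, w1, w2, w3, h3, hl⟩
    · rcases G.eq _ _ e with ⟨rfl, rfl⟩ | ⟨rfl, rfl⟩
      · left; have := N.gir2 _ _ h2 w2; omega
      · right; right; left
        exact ⟨l1, l2, 0, w1, w2, Wk.nil _, by omega⟩
    · obtain rfl := G.inj1 _ _ e
      right; right; left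
      exact ⟨l1, l2, l3, w1, w2, w3, hl⟩
  · rcases h with ⟨t', l1, l2, e, w1, w2, h2, hl⟩ | ⟨t', l1, l2, l3, e, w1, w2, w3, h3, hl⟩
    · rcases G.swap.eq _ _ e with ⟨rfl, rfl⟩ | ⟨rfl, rfl⟩
      · left; have := N.gir2 _ _ h2 w2; omega
      · right; right; right
        exact ⟨l1, l2, 0, w1, w2, Wk.nil _, by omega⟩
    · obtain rfl := G.inj1 _ _ e
      right; right; right
      exact ⟨l1, l2, l3, w1, w2, w3, hl⟩

theorem GlueN.girth1 (N : GlueN A1 A2 A i1 i2 P X g h1 h2 x1 x2) {s : V1} {l : ℕ} (hl : 1 ≤ l)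
    (w : Wk A l (i1 s) (i1 s)) : g ≤ l := by
  have := N.e1
  have := N.e2
  rcases N.dist w with h | h | ⟨l1, l2, l3, w1, w2, w3, h⟩ | ⟨l1, l2, l3, w1, w2, w3, h⟩
  · exact h
  · exact N.gir1 _ _ hl h
  · have := N.dst1.rq _ (w3.trans w1)
    have := N.dst2.qr _ w2
    omega
  · have := N.dst1.qr _ (w3.trans w1)
    have := N.dst2.rq _ w2
    omega

theorem GlueN.girth (N : GlueN A1 A2 A i1 i2 P X g h1 h2 x1 x2) : GirthGE A g := by
  intro l w hl hw
  rcases N.G.surj w with ⟨a, rfl⟩ | ⟨b, rfl⟩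
  · exact N.girth1 hl hw
  · exact N.flip.girth1 hl hw

end Gluing

section Gluing2

variable {V1 V2 W : Type} {A1 : V1 → V1 → Prop} {A2 : V2 → V2 → Prop} {A : W → W → Prop}
    {i1 : V1 → W} {i2 : V2 → W} {P : Prt V1} {X : Prt V2}

open Classical in
/-- Glue two functions. -/
noncomputable def gdesc {α : Type} (i1 : V1 → W) (i2 : V2 → W) (F1 : V1 → α) (F2 : V2 → α)
    (d : α) (w : W) : α :=
  if h : ∃ a, w = i1 a then F1 h.choose else if h : ∃ b, w = i2 b then F2 h.choose else d

theorem Glue.desc1 (G : Glue A1 A2 A i1 i2 P X) {α : Type} (F1 : V1 → α) (F2 : V2 → α) (d : α)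
    (a : V1) : gdesc i1 i2 F1 F2 d (i1 a) = F1 a := by
  have h : ∃ a', i1 a = i1 a' := ⟨a, rfl⟩
  rw [gdesc, dif_pos h, ← G.inj1 _ _ h.choose_spec]

theorem Glue.desc2 (G : Glue A1 A2 A i1 i2 P X) {α : Type} (F1 : V1 → α) (F2 : V2 → α) (d : α)
    (hq : F1 P.q = F2 X.q) (hr : F1 P.r = F2 X.r) (b : V2) :
    gdesc i1 i2 F1 F2 d (i2 b) = F2 b := by
  have h : ∃ b', i2 b = i2 b' := ⟨b, rfl⟩
  by_cases h' : ∃ a, i2 b = i1 a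
  · rw [gdesc, dif_pos h']
    rcases G.eq _ _ h'.choose_spec.symm with ⟨e1, e2⟩ | ⟨e1, e2⟩
    · rw [e1, e2, hq]
    · rw [e1, e2, hr]
  · rw [gdesc, dif_neg h', dif_pos h, ← G.inj2 _ _ h.choose_spec]

/-- The neighbours of the port vertices are different from the port vertices. -/
structure PNe {V : Type} (P : Prt V) : Prop where
  qr : P.q ≠ P.r
  a1 : P.qm ≠ P.q
  a2 : P.qm ≠ P.r
  a3 : P.qp ≠ P.q
  a4 : P.qp ≠ P.r
  a5 : P.rm ≠ P.q
  a6 : P.rm ≠ P.r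
  a7 : P.rp ≠ P.q
  a8 : P.rp ≠ P.r

theorem PNe.of_dst {V : Type} {A : V → V → Prop} {P : Prt V} {g h1 h2 : ℕ} (hg : 2 ≤ g)
    (hG : GirthGE A g) (D : Deg A P) (h : Dst A P h1 h2) (hh1 : 2 ≤ h1) (hh2 : 2 ≤ h2) :
    PNe P := by
  obtain ⟨p1, p2, p3, p4, p5, p6, p7, p8⟩ := port_ne hg hG D h hh1 hh2
  refine ⟨?_, p1, p2, p3, p4, p5, p6, p7, p8⟩
  intro e
  have := h.qr 0 (by rw [← e]; exact Wk.nil _)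
  omega

/-- Flatness of the witness at a port. -/
def Flat {V E : Type} {A : V → V → Prop} [AddCommGroup E] [Module ℝ E] (w : Wit A E) (P : Prt V) :
    Prop := ∀ e, w.T e P.q = w.T e P.qp ∧ w.T e P.r = w.T e P.rp

open Classical in
/-- Contribution of one side at the shared vertices. -/
noncomputable def addAt (P : Prt V1) (f : V1 → ℝ) (cq cr : ℝ) (v : V1) : ℝ :=
  f v + (if v = P.q then cq else 0) + (if v = P.r then cr else 0)

theorem addAt_q (hP : P.q ≠ P.r) (f : V1 → ℝ) (cq cr : ℝ) : addAt P f cq cr P.q = f P.q + cq := by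
  simp [addAt, hP]

theorem addAt_r (hP : P.q ≠ P.r) (f : V1 → ℝ) (cq cr : ℝ) : addAt P f cq cr P.r = f P.r + cr := by
  simp [addAt, hP.symm]

theorem addAt_o (f : V1 → ℝ) (cq cr : ℝ) {v : V1} (h1 : v ≠ P.q) (h2 : v ≠ P.r) :
    addAt P f cq cr v = f v := by
  simp [addAt, h1, h2]

variable {E1 E2 : Type} [AddCommGroup E1] [Module ℝ E1] [AddCommGroup E2] [Module ℝ E2]

/-- The glued function. -/
noncomputable def gT (i1 : V1 → W) (i2 : V2 → W) (P : Prt V1) (X : Prt V2)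
    (w1 : Wit A1 E1) (w2 : Wit A2 E2) (e : E1 × E2) : W → ℝ :=
  gdesc i1 i2 (addAt P (w1.T e.1) (w2.T e.2 X.q) (w2.T e.2 X.r))
    (addAt X (w2.T e.2) (w1.T e.1 P.q) (w1.T e.1 P.r)) 0

theorem Glue.gT1 (G : Glue A1 A2 A i1 i2 P X) (w1 : Wit A1 E1) (w2 : Wit A2 E2) (e : E1 × E2)
    (a : V1) : gT i1 i2 P X w1 w2 e (i1 a) =
      addAt P (w1.T e.1) (w2.T e.2 X.q) (w2.T e.2 X.r) a := G.desc1 _ _ _ _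

theorem Glue.gT2 (G : Glue A1 A2 A i1 i2 P X) (hP : P.q ≠ P.r) (hX : X.q ≠ X.r) (w1 : Wit A1 E1)
    (w2 : Wit A2 E2) (e : E1 × E2) (b : V2) : gT i1 i2 P X w1 w2 e (i2 b) =
      addAt X (w2.T e.2) (w1.T e.1 P.q) (w1.T e.1 P.r) b := by
  apply G.desc2
  · rw [addAt_q hP, addAt_q hX, add_comm]
  · rw [addAt_r hP, addAt_r hX, add_comm]

/-- One case of the step condition for the glued witness. -/
theorem Glue.step1 (G : Glue A1 A2 A i1 i2 P X) (w1 : Wit A1 E1) (w2 : Wit A2 E2)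
    (hP : PNe P) (hX : PNe X) (f1 : Flat w1 P) (f2 : Flat w2 X) (e : E1 × E2) (a : V1)
    (h : gT i1 i2 P X w1 w2 e (i1 a) ≠ 0) :
    ∃ v, A (i1 a) v ∧ gT i1 i2 P X w1 w2 e v ≠ 0 := by
  have aux : ∀ x y : ℝ, x ≠ 0 → x + y = 0 → y ≠ 0 := by
    intro x y hx hxy hy; exact hx (by linarith)
  have E1q := G.gT1 w1 w2 e
  have E2q := G.gT2 hP.qr hX.qr w1 w2 e
  by_cases aq : a = P.q
  · subst aq
    by_cases c : w1.T e.1 P.q = 0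
    · refine ⟨i2 X.qp, by rw [G.eqq]; exact G.arc2 _ _ G.deg2.bq, ?_⟩
      rw [E1q, addAt_q hP.qr] at h
      rw [E2q, addAt_o _ _ _ hX.a3 hX.a4, ← (f2 e.2).1]
      intro h0; rw [h0, c] at h; simp at h
    · refine ⟨i1 P.qp, G.arc1 _ _ G.deg1.bq, ?_⟩
      rw [E1q, addAt_o _ _ _ hP.a3 hP.a4, ← (f1 e.1).1]
      exact c
  · by_cases ar : a = P.r
    · subst ar
      by_cases c : w1.T e.1 P.r = 0
      · refine ⟨i2 X.rp, by rw [G.eqr]; exact G.arc2 _ _ G.deg2.br, ?_⟩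
        rw [E1q, addAt_r hP.qr] at h
        rw [E2q, addAt_o _ _ _ hX.a7 hX.a8, ← (f2 e.2).2]
        intro h0; rw [h0, c] at h; simp at h
      · refine ⟨i1 P.rp, G.arc1 _ _ G.deg1.br, ?_⟩
        rw [E1q, addAt_o _ _ _ hP.a7 hP.a8, ← (f1 e.1).2]
        exact c
    · rw [E1q, addAt_o _ _ _ aq ar] at h
      obtain ⟨b, hab, hb⟩ := w1.step _ _ h
      by_cases bq : b = P.q
      · subst bq
        obtain rfl := G.deg1.inq _ hab
        by_cases c : w1.T e.1 P.q + w2.T e.2 X.q = 0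
        · refine ⟨_, G.sk1, ?_⟩
          rw [E2q, addAt_o _ _ _ hX.a3 hX.a4, ← (f2 e.2).1]
          exact aux _ _ hb c
        · refine ⟨_, G.arc1 _ _ hab, ?_⟩
          rw [E1q, addAt_q hP.qr]; exact c
      · by_cases br : b = P.r
        · subst br
          obtain rfl := G.deg1.inr _ hab
          by_cases c : w1.T e.1 P.r + w2.T e.2 X.r = 0
          · refine ⟨_, G.sk3, ?_⟩
            rw [E2q, addAt_o _ _ _ hX.a7 hX.a8, ← (f2 e.2).2]
            exact aux _ _ hb c
          · refine ⟨_, G.arc1 _ _ hab, ?_⟩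
            rw [E1q, addAt_r hP.qr]; exact c
        · refine ⟨_, G.arc1 _ _ hab, ?_⟩
          rw [E1q, addAt_o _ _ _ bq br]; exact hb

theorem Glue.gT_flip (G : Glue A1 A2 A i1 i2 P X) (w1 : Wit A1 E1) (w2 : Wit A2 E2)
    (hP : P.q ≠ P.r) (hX : X.q ≠ X.r) (e : E1 × E2) :
    gT i1 i2 P X w1 w2 e = gT i2 i1 X P w2 w1 (e.2, e.1) := by
  funext w
  rcases G.surj w with ⟨a, rfl⟩ | ⟨b, rfl⟩
  · rw [G.gT1, G.flip.gT2 hX hP]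
  · rw [G.gT2 hP hX, G.flip.gT1]

/-- The glued witness. -/
noncomputable def Glue.wit (G : Glue A1 A2 A i1 i2 P X) (w1 : Wit A1 E1) (w2 : Wit A2 E2)
    (hP : PNe P) (hX : PNe X) (f1 : Flat w1 P) (f2 : Flat w2 X) : Wit A (E1 × E2) where
  T :=
    { toFun := gT i1 i2 P X w1 w2
      map_add' := by
        intro e e'
        funext w
        rcases G.surj w with ⟨a, rfl⟩ | ⟨b, rfl⟩
        · simp only [Pi.add_apply, G.gT1, addAt, Prod.fst_add, Prod.snd_add, map_add]
          split_ifs <;> ring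
        · simp only [Pi.add_apply, G.gT2 hP.qr hX.qr, addAt, Prod.fst_add, Prod.snd_add, map_add]
          split_ifs <;> ring
      map_smul' := by
        intro c e
        funext w
        rcases G.surj w with ⟨a, rfl⟩ | ⟨b, rfl⟩
        · simp only [Pi.smul_apply, G.gT1, addAt, Prod.smul_fst, Prod.smul_snd, map_smul,
            RingHom.id_apply, smul_eq_mul]
          split_ifs <;> ring
        · simp only [Pi.smul_apply, G.gT2 hP.qr hX.qr, addAt, Prod.smul_fst, Prod.smul_snd, map_smul,
            RingHom.id_apply, smul_eq_mul]
          split_ifs <;> ring }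
  inj := by
    intro e he
    have he' : ∀ w, gT i1 i2 P X w1 w2 e w = 0 := fun w => congrFun he w
    have k2 : e.2 = 0 := by
      apply w2.inj
      have o : ∀ v, v ≠ X.q → v ≠ X.r → w2.T e.2 v = 0 := by
        intro v h1 h2
        have := he' (i2 v)
        rwa [G.gT2 hP.qr hX.qr, addAt_o _ _ _ h1 h2] at this
      funext v
      by_cases h1 : v = X.q
      · rw [h1, (f2 e.2).1]; exact o _ hX.a3 hX.a4
      · by_cases h2 : v = X.r
        · rw [h2, (f2 e.2).2]; exact o _ hX.a7 hX.a8
        · exact o v h1 h2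
    have k1 : e.1 = 0 := by
      apply w1.inj
      have o : ∀ v, v ≠ P.q → v ≠ P.r → w1.T e.1 v = 0 := by
        intro v h1 h2
        have := he' (i1 v)
        rwa [G.gT1, addAt_o _ _ _ h1 h2] at this
      funext v
      by_cases h1 : v = P.q
      · rw [h1, (f1 e.1).1]; exact o _ hP.a3 hP.a4
      · by_cases h2 : v = P.r
        · rw [h2, (f1 e.1).2]; exact o _ hP.a7 hP.a8
        · exact o v h1 h2
    exact Prod.ext k1 k2
  step := by
    intro e v hv
    rcases G.surj v with ⟨a, rfl⟩ | ⟨b, rfl⟩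
    · exact G.step1 w1 w2 hP hX f1 f2 e a hv
    · have hf := G.gT_flip w1 w2 hP.qr hX.qr e
      change gT i1 i2 P X w1 w2 e (i2 b) ≠ 0 at hv
      change ∃ w, A (i2 b) w ∧ gT i1 i2 P X w1 w2 e w ≠ 0
      rw [hf] at hv ⊢
      exact G.flip.step1 w2 w1 hX hP f2 f1 (e.2, e.1) b hv

theorem Glue.wit_flat1 (G : Glue A1 A2 A i1 i2 P X) (w1 : Wit A1 E1) (w2 : Wit A2 E2)
    (hP : PNe P) (hX : PNe X) (f1 : Flat w1 P) (f2 : Flat w2 X) (Q : Prt V1) (fQ : Flat w1 Q)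
    (hne : ∀ v ∈ [Q.q, Q.qp, Q.r, Q.rp], v ≠ P.q ∧ v ≠ P.r) :
    Flat (G.wit w1 w2 hP hX f1 f2) (Q.map i1) := by
  simp only [List.mem_cons, List.not_mem_nil, or_false, forall_eq_or_imp, forall_eq] at hne
  intro e
  change gT i1 i2 P X w1 w2 e (i1 _) = gT i1 i2 P X w1 w2 e (i1 _) ∧
    gT i1 i2 P X w1 w2 e (i1 _) = gT i1 i2 P X w1 w2 e (i1 _)
  simp only [G.gT1]
  rw [addAt_o _ _ _ hne.1.1 hne.1.2, addAt_o _ _ _ hne.2.1.1 hne.2.1.2,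
    addAt_o _ _ _ hne.2.2.1.1 hne.2.2.1.2, addAt_o _ _ _ hne.2.2.2.1 hne.2.2.2.2]
  exact fQ e.1

theorem Glue.wit_flat2 (G : Glue A1 A2 A i1 i2 P X) (w1 : Wit A1 E1) (w2 : Wit A2 E2)
    (hP : PNe P) (hX : PNe X) (f1 : Flat w1 P) (f2 : Flat w2 X) (Q : Prt V2) (fQ : Flat w2 Q)
    (hne : ∀ v ∈ [Q.q, Q.qp, Q.r, Q.rp], v ≠ X.q ∧ v ≠ X.r) :
    Flat (G.wit w1 w2 hP hX f1 f2) (Q.map i2) := by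
  intro e
  have := G.flip.wit_flat1 w2 w1 hX hP f2 f1 Q fQ hne (e.2, e.1)
  change gT i2 i1 X P w2 w1 (e.2, e.1) _ = gT i2 i1 X P w2 w1 (e.2, e.1) _ ∧
    gT i2 i1 X P w2 w1 (e.2, e.1) _ = gT i2 i1 X P w2 w1 (e.2, e.1) _ at this
  rw [← G.gT_flip w1 w2 hP.qr hX.qr e] at this
  exact this

/-- Degree conditions survive for ports away from the gluing place. -/
theorem Glue.deg_map1 (G : Glue A1 A2 A i1 i2 P X) (Q : Prt V1) (hQ : Deg A1 Q)
    (hq : Q.q ≠ P.q ∧ Q.q ≠ P.r ∧ Q.q ≠ P.qm ∧ Q.q ≠ P.qp ∧ Q.q ≠ P.rm ∧ Q.q ≠ P.rp)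
    (hr : Q.r ≠ P.q ∧ Q.r ≠ P.r ∧ Q.r ≠ P.qm ∧ Q.r ≠ P.qp ∧ Q.r ≠ P.rm ∧ Q.r ≠ P.rp) :
    Deg A (Q.map i1) := by
  have kin : ∀ v u, v ≠ P.q ∧ v ≠ P.r ∧ v ≠ P.qm ∧ v ≠ P.qp ∧ v ≠ P.rm ∧ v ≠ P.rp →
      A u (i1 v) → ∃ a, A1 a v ∧ u = i1 a := by
    rintro v u ⟨n1, n2, n3, n4, n5, n6⟩ h
    rcases G.arc _ _ h with ⟨a, b, hab, h1, h2⟩ | ⟨a, b, hab, h1, h2⟩ | ⟨h1, h2⟩ | ⟨h1, h2⟩ |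
      ⟨h1, h2⟩ | ⟨h1, h2⟩
    · obtain rfl := G.inj1 _ _ h2
      exact ⟨a, hab, h1⟩
    all_goals
      first
        | (have := G.eq _ _ h2; tauto)
        | (have := G.inj1 _ _ h2; tauto)
  have kout : ∀ v u, v ≠ P.q ∧ v ≠ P.r ∧ v ≠ P.qm ∧ v ≠ P.qp ∧ v ≠ P.rm ∧ v ≠ P.rp →
      A (i1 v) u → ∃ a, A1 v a ∧ u = i1 a := by
    rintro v u ⟨n1, n2, n3, n4, n5, n6⟩ h
    rcases G.arc _ _ h with ⟨a, b, hab, h1, h2⟩ | ⟨a, b, hab, h1, h2⟩ | ⟨h1, h2⟩ | ⟨h1, h2⟩ |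
      ⟨h1, h2⟩ | ⟨h1, h2⟩
    · obtain rfl := G.inj1 _ _ h1
      exact ⟨b, hab, h2⟩
    all_goals
      first
        | (have := G.eq _ _ h1; tauto)
        | (have := G.inj1 _ _ h1; tauto)
  refine ⟨G.arc1 _ _ hQ.aq, G.arc1 _ _ hQ.bq, ?_, ?_, G.arc1 _ _ hQ.ar, G.arc1 _ _ hQ.br, ?_, ?_⟩
  · intro u hu
    obtain ⟨a, h1, rfl⟩ := kin _ _ hq hu
    rw [hQ.inq _ h1]; rfl
  · intro u hu
    obtain ⟨a, h1, rfl⟩ := kout _ _ hq hu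
    rw [hQ.outq _ h1]; rfl
  · intro u hu
    obtain ⟨a, h1, rfl⟩ := kin _ _ hr hu
    rw [hQ.inr _ h1]; rfl
  · intro u hu
    obtain ⟨a, h1, rfl⟩ := kout _ _ hr hu
    rw [hQ.outr _ h1]; rfl

/-- Condition on the feedback vertex set at a host port. -/
structure HFv {V : Type} {A : V → V → Prop} {k : ℕ} (F : Fv A k) (P : Prt V) : Prop where
  q : P.q ∉ F.S
  r : P.r ∉ F.S
  lt : F.rk P.q < F.rk P.r

/-- Condition on the feedback vertex set at a guest port. -/
structure GFv {V : Type} {A : V → V → Prop} {k : ℕ} (F : Fv A k) (X : Prt V) : Prop where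
  q : X.q ∉ F.S
  r : X.r ∉ F.S
  qp : X.qp ∈ F.S

theorem Glue.fv [Finite V1] [Finite V2] (G : Glue A1 A2 A i1 i2 P X) (hX : X.q ≠ X.r) {k1 k2 : ℕ}
    (F1 : Fv A1 k1) (F2 : Fv A2 k2) (H1 : HFv F1 P) (H2 : GFv F2 X) :
    ∃ F : Fv A (k1 + k2), (∀ Q : Prt V1, HFv F1 Q → HFv F (Q.map i1)) ∧
      (∀ Q : Prt V2, HFv F2 Q → Q.q ≠ X.q ∧ Q.q ≠ X.r ∧ Q.r ≠ X.q ∧ Q.r ≠ X.r → HFv F (Q.map i2)) := by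
  classical
  obtain ⟨M1, hM1⟩ : ∃ M, ∀ v, F1.rk v < M := by
    obtain ⟨M, hM⟩ := (Set.finite_range F1.rk).bddAbove
    exact ⟨M + 1, fun v => Nat.lt_succ_of_le (hM ⟨v, rfl⟩)⟩
  obtain ⟨M, hM⟩ : ∃ M, ∀ v, F2.rk v < M := by
    obtain ⟨M, hM⟩ := (Set.finite_range F2.rk).bddAbove
    exact ⟨M + 1, fun v => Nat.lt_succ_of_le (hM ⟨v, rfl⟩)⟩
  let r1 : V1 → ℕ := fun v => M * F1.rk v + M
  let s2 : V2 → ℕ := fun v => if F2.rk X.r < F2.rk v then M * M1 + M + F2.rk v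
    else M * F1.rk P.q + M + F2.rk v
  let r2 : V2 → ℕ := fun v => if v = X.q then r1 P.q else if v = X.r then r1 P.r else s2 v
  let rk := gdesc i1 i2 r1 r2 0
  have e1 : ∀ a, rk (i1 a) = r1 a := G.desc1 _ _ _
  have e2 : ∀ b, rk (i2 b) = r2 b := G.desc2 _ _ _ (by simp [r2]) (by simp [r2, hX.symm])
  have r2q : r2 X.q = r1 P.q := by simp [r2]
  have r2r : r2 X.r = r1 P.r := by simp [r2, hX.symm]
  have r2o : ∀ b, b ≠ X.q → b ≠ X.r → r2 b = s2 b := fun b h1 h2 => by simp [r2, h1, h2]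
  let S : Finset W := F1.S.image i1 ∪ F2.S.image i2
  have m1 : ∀ a, i1 a ∈ S ↔ a ∈ F1.S := by
    intro a
    simp only [S, Finset.mem_union, Finset.mem_image]
    constructor
    · rintro (⟨a', h, e⟩ | ⟨b, h, e⟩)
      · rwa [← G.inj1 _ _ e]
      · rcases G.eq _ _ e.symm with ⟨-, rfl⟩ | ⟨-, rfl⟩
        · exact absurd h H2.q
        · exact absurd h H2.r
    · exact fun h => Or.inl ⟨a, h, rfl⟩
  have m2 : ∀ a, i2 a ∈ S ↔ a ∈ F2.S := by
    intro a
    simp only [S, Finset.mem_union, Finset.mem_image]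
    constructor
    · rintro (⟨a', h, e⟩ | ⟨b, h, e⟩)
      · rcases G.eq _ _ e with ⟨rfl, -⟩ | ⟨rfl, -⟩
        · exact absurd h H1.q
        · exact absurd h H1.r
      · rwa [← G.inj2 _ _ e]
    · exact fun h => Or.inr ⟨a, h, rfl⟩
  have mul_lt : ∀ x y, x < y → M * x + M ≤ M * y := by
    intro x y h
    calc M * x + M = M * (x + 1) := by ring
      _ ≤ M * y := Nat.mul_le_mul_left _ h
  have mono1 : ∀ u v, F1.rk v < F1.rk u → r1 v < r1 u := by
    intro u v h
    have := mul_lt _ _ h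
    have := hM X.q
    simp only [r1]; omega
  have bigq := mul_lt _ _ (hM1 P.q)
  have bigr := mul_lt _ _ (hM1 P.r)
  have qr := mul_lt _ _ H1.lt
  have mono2 : ∀ u v, F2.rk v < F2.rk u → s2 v < s2 u := by
    intro u v h
    have := hM v
    simp only [s2]
    split_ifs <;> omega
  have low : ∀ v, 0 < F2.rk v → r1 P.q < s2 v := by
    intro v h
    simp only [r1, s2]
    split_ifs <;> omega
  have toph : ∀ v a, F2.rk X.r < F2.rk v → r1 a < s2 v := by
    intro v a h
    have := mul_lt _ _ (hM1 a)
    simp only [r1, s2, if_pos h]; omega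
  have mid : ∀ v, F2.rk v < F2.rk X.r → s2 v < r1 P.r := by
    intro v h
    have := hM v
    simp only [r1, s2, if_neg (not_lt.2 h.le)]; omega
  refine ⟨⟨S, ?_, rk, ?_⟩, ?_, ?_⟩
  · rw [Finset.card_union_of_disjoint, Finset.card_image_of_injective _ (fun a b => G.inj1 a b),
      Finset.card_image_of_injective _ (fun a b => G.inj2 a b), F1.card, F2.card]
    rw [Finset.disjoint_left]
    intro w h1 h2
    rw [Finset.mem_image] at h1 h2
    obtain ⟨a, ha, rfl⟩ := h1
    obtain ⟨b, hb, e⟩ := h2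
    rcases G.eq _ _ e.symm with ⟨-, rfl⟩ | ⟨-, rfl⟩
    · exact H2.q hb
    · exact H2.r hb
  · intro u v h hu hv
    rcases G.arc _ _ h with ⟨a, b, hab, rfl, rfl⟩ | ⟨a, b, hab, rfl, rfl⟩ | ⟨rfl, rfl⟩ |
      ⟨rfl, rfl⟩ | ⟨rfl, rfl⟩ | ⟨rfl, rfl⟩
    · rw [e1, e1]
      rw [m1] at hu hv
      exact mono1 _ _ (F1.dec _ _ hab hu hv)
    · rw [e2, e2]
      rw [m2] at hu hv
      have hd := F2.dec _ _ hab hu hv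
      by_cases aq : a = X.q
      · subst aq
        obtain rfl := G.deg2.outq _ hab
        exact absurd H2.qp hv
      by_cases bq : b = X.q
      · subst bq
        rw [r2q]
        by_cases ar : a = X.r
        · subst ar; rw [r2r]; exact mono1 _ _ H1.lt
        · rw [r2o _ aq ar]; exact low _ (by omega)
      by_cases ar : a = X.r
      · subst ar
        by_cases br : b = X.r
        · subst br; omega
        · rw [r2r, r2o _ bq br]; exact mid _ hd
      by_cases br : b = X.r
      · subst br
        rw [r2r, r2o _ aq ar]; exact toph _ _ hd
      rw [r2o _ aq ar, r2o _ bq br]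
      exact mono2 _ _ hd
    · rw [m2] at hv
      exact absurd H2.qp hv
    · rw [m1] at hv
      rw [m2] at hu
      have hd := F2.dec _ _ G.deg2.aq hu H2.q
      have hd1 := mono1 _ _ (F1.dec _ _ G.deg1.bq H1.q hv)
      rw [e1, e2]
      by_cases aq : X.qm = X.q
      · rw [aq] at hd; omega
      by_cases ar : X.qm = X.r
      · rw [ar, r2r]; exact hd1.trans (mono1 _ _ H1.lt)
      · rw [r2o _ aq ar]; exact hd1.trans (low _ (by omega))
    · rw [m1] at hu
      rw [m2] at hv
      have hd := F2.dec _ _ G.deg2.br H2.r hv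
      have hd1 := mono1 _ _ (F1.dec _ _ G.deg1.ar hu H1.r)
      rw [e1, e2]
      by_cases aq : X.rp = X.q
      · rw [aq, r2q]; exact (mono1 _ _ H1.lt).trans hd1
      by_cases ar : X.rp = X.r
      · rw [ar] at hd; omega
      · rw [r2o _ aq ar]; exact (mid _ hd).trans hd1
    · rw [m1] at hv
      rw [m2] at hu
      have hd := F2.dec _ _ G.deg2.ar hu H2.r
      rw [e1, e2]
      by_cases aq : X.rm = X.q
      · have h2 := G.deg2.ar
        rw [aq] at h2
        have := G.deg2.outq _ h2
        exact absurd H2.qp (this ▸ H2.r)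
      by_cases ar : X.rm = X.r
      · rw [ar] at hd; omega
      · rw [r2o _ aq ar]; exact toph _ _ hd
  · intro Q hQ
    refine ⟨?_, ?_, ?_⟩
    · change i1 _ ∉ S; rw [m1]; exact hQ.q
    · change i1 _ ∉ S; rw [m1]; exact hQ.r
    · change rk (i1 _) < rk (i1 _)
      rw [e1, e1]; exact mono1 _ _ hQ.lt
  · rintro Q hQ ⟨n1, n2, n3, n4⟩
    refine ⟨?_, ?_, ?_⟩
    · change i2 _ ∉ S; rw [m2]; exact hQ.q
    · change i2 _ ∉ S; rw [m2]; exact hQ.r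
    · change rk (i2 _) < rk (i2 _)
      rw [e2, e2, r2o _ n1 n2, r2o _ n3 n4]; exact mono2 _ _ hQ.lt

end Gluing2

set_option linter.unusedSimpArgs false

section GluingBook

variable {V1 V2 W : Type} {A1 : V1 → V1 → Prop} {A2 : V2 → V2 → Prop} {A : W → W → Prop}
    {i1 : V1 → W} {i2 : V2 → W} {P : Prt V1} {X : Prt V2}

/-- Position of a host port in a book embedding. -/
structure BHost {V : Type} {A : V → V → Prop} (B : Book A) (P : Prt V) : Prop where
  o1 : B.key P.qm < B.key P.q
  o2 : B.key P.q < B.key P.qp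
  o3 : B.key P.qp ≤ B.key P.rm
  o4 : B.key P.rm < B.key P.r
  o5 : B.key P.r < B.key P.rp
  gap : ∀ v, B.key v ≤ B.key P.qm ∨ v = P.q ∨ (B.key P.qp ≤ B.key v ∧ B.key v ≤ B.key P.rm) ∨
    v = P.r ∨ B.key P.rp ≤ B.key v
  chord : ∀ a b, B.L a b → (B.key a ≤ B.key P.qm ∧ B.key P.rp ≤ B.key b) ∨ B.key b ≤ B.key P.qm ∨
    B.key P.rp ≤ B.key a ∨ (B.key P.qp ≤ B.key a ∧ B.key b ≤ B.key P.rm)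

/-- Position of a guest port in a book embedding. -/
structure BGuest {V : Type} {A : V → V → Prop} (B : Book A) (X : Prt V) : Prop where
  o1 : B.key X.q < B.key X.qp
  o2 : B.key X.qp < B.key X.r
  o3 : B.key X.qm < B.key X.r
  o4 : B.key X.rp < B.key X.r
  o5 : B.key X.rm ≤ B.key X.rp ∨ B.key X.r ≤ B.key X.rm
  lo : ∀ v, B.key v = B.key X.q ∨ B.key X.qp ≤ B.key v
  hi : ∀ v, B.key v ≤ B.key X.qm ∨ B.key X.r ≤ B.key v
  l1 : ∀ c d, B.L c d → B.key c ≠ B.key X.q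
  l2 : ∀ c d, B.L c d → ¬ (B.key c < B.key X.rp ∧ B.key X.rp < B.key d ∧ B.key d < B.key X.r)
  l3 : ∀ c d, B.L c d → ¬ (B.key X.rp < B.key c ∧ B.key c < B.key X.r ∧ B.key X.r ≤ B.key d)
  l4 : ∀ c d, B.L c d → ¬ (B.key c < B.key X.rm ∧ B.key X.rm < B.key d)
  r1 : ∀ c d, B.R c d → B.key d < B.key X.r ∨ B.key X.r ≤ B.key c

/-- The glued order. -/
theorem Glue.order [Finite V2] (G : Glue A1 A2 A i1 i2 P X) (B1 : Book A1) (B2 : Book A2)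
    (hP : B1.key P.q < B1.key P.r) (hX : B2.key X.q < B2.key X.r)
    (hlo : ∀ v, B2.key X.q ≤ B2.key v) :
    ∃ k : W → ℕ,
      (∀ a b, k (i1 a) < k (i1 b) ↔ B1.key a < B1.key b) ∧
      (∀ a b, k (i2 a) < k (i2 b) ↔ B2.key a < B2.key b) ∧
      (∀ a b, k (i1 a) < k (i2 b) ↔ B1.key a < B1.key P.q ∨
        (B1.key a = B1.key P.q ∧ B2.key X.q < B2.key b) ∨
        (B1.key a < B1.key P.r ∧ B2.key X.r ≤ B2.key b) ∨
        (B1.key a = B1.key P.r ∧ B2.key X.r < B2.key b)) ∧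
      (∀ a b, k (i2 b) < k (i1 a) ↔ (B2.key b < B2.key X.r ∧ B1.key P.q < B1.key a) ∨
        (B2.key X.r ≤ B2.key b ∧ B1.key P.r < B1.key a)) := by
  classical
  obtain ⟨M, hM⟩ : ∃ M, ∀ v, B2.key v + 1 < M := by
    obtain ⟨M, hM⟩ := (Set.finite_range B2.key).bddAbove
    exact ⟨M + 2, fun v => by have := hM ⟨v, rfl⟩; omega⟩
  have hM0 : 0 < M := by have := hM X.q; omega
  have lexlt : ∀ x y b c, b < M → c < M → (M * x + b < M * y + c ↔ x < y ∨ (x = y ∧ b < c)) := by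
    intro x y b c hb hc
    rcases lt_trichotomy x y with h | h | h
    · have h1 : M * x + M ≤ M * y := by
        calc M * x + M = M * (x + 1) := by ring
          _ ≤ M * y := Nat.mul_le_mul_left _ h
      simp only [h, true_or, iff_true]; omega
    · subst h; simp
    · have h1 : M * y + M ≤ M * x := by
        calc M * y + M = M * (y + 1) := by ring
          _ ≤ M * x := Nat.mul_le_mul_left _ h
      constructor
      · intro h2; omega
      · rintro (h2 | ⟨h2, -⟩) <;> omega
  let al : V2 → ℕ := fun b => if B2.key b < B2.key X.r then B1.key P.q else B1.key P.r
  let be : V2 → ℕ := fun b => if B2.key b = B2.key X.q ∨ B2.key b = B2.key X.r then 0 else B2.key b + 1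
  have hbe : ∀ b, be b < M := by
    intro b; have := hM b; simp only [be]; split_ifs <;> omega
  let F1 : V1 → ℕ := fun a => M * B1.key a + 0
  let F2 : V2 → ℕ := fun b => M * al b + be b
  have e1 : ∀ a, gdesc i1 i2 F1 F2 0 (i1 a) = F1 a := G.desc1 _ _ _
  have e2 : ∀ b, gdesc i1 i2 F1 F2 0 (i2 b) = F2 b :=
    G.desc2 _ _ _ (by simp [F1, F2, al, be, hX]) (by simp [F1, F2, al, be])
  refine ⟨gdesc i1 i2 F1 F2 0, ?_, ?_, ?_, ?_⟩
  · intro a b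
    rw [e1, e1, lexlt _ _ _ _ hM0 hM0]; omega
  · intro a b
    have := hlo a
    have := hlo b
    rw [e2, e2, lexlt _ _ _ _ (hbe _) (hbe _)]
    simp only [al, be]
    split_ifs <;> omega
  · intro a b
    have := hlo b
    rw [e2, e1, lexlt _ _ _ _ hM0 (hbe _)]
    simp only [al, be]
    split_ifs <;> omega
  · intro a b
    have := hlo b
    rw [e2, e1, lexlt _ _ _ _ (hbe _) hM0]
    simp only [al, be]
    split_ifs <;> omega

set_option maxHeartbeats 1600000 in
theorem Glue.book [Finite V2] (G : Glue A1 A2 A i1 i2 P X) (B1 : Book A1) (B2 : Book A2)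
    (H : BHost B1 P) (K : BGuest B2 X) (nX : PNe X) :
    ∃ B : Book A,
      (∀ Q : Prt V1, BHost B1 Q → B1.key P.rp ≤ B1.key Q.qm → BHost B (Q.map i1)) ∧
      (∀ Q : Prt V2, BHost B2 Q → B2.key X.q < B2.key Q.qm → B2.key Q.rp < B2.key X.r →
        (B2.key X.rp ≤ B2.key Q.qm ∨ B2.key Q.rp ≤ B2.key X.rp) →
        (B2.key X.rm ≤ B2.key Q.qm ∨ B2.key Q.rp ≤ B2.key X.rm) → BHost B (Q.map i2)) ∧
      (∀ a b, B2.key a ≤ B2.key b → B.key (i2 a) ≤ B.key (i2 b)) := by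
  obtain ⟨o1, o2, o3, o4, o5, gap, chord⟩ := H
  obtain ⟨x1, x2, x3, x4, x5, lo, hi, l1, l2, l3, l4, r1⟩ := K
  have lo' : ∀ v, B2.key X.q ≤ B2.key v := fun v => by have := lo v; omega
  obtain ⟨k, c11, c22, c12, c21⟩ := G.order B1 B2 (by omega) (by omega) lo'
  have n1 : B2.key X.qm ≠ B2.key X.q := fun h => nX.a1 (B2.inj _ _ h)
  have n2 : B2.key X.rm ≠ B2.key X.q := fun h => nX.a5 (B2.inj _ _ h)
  have n3 : B2.key X.rp ≠ B2.key X.q := fun h => nX.a7 (B2.inj _ _ h)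
  have n4 : B2.key X.rm ≠ B2.key X.r := fun h => nX.a6 (B2.inj _ _ h)
  have lom := lo X.rm
  have lop := lo X.rp
  have loq := lo X.qm
  have him := hi X.rm
  have hip := hi X.rp
  have hiq := hi X.qp
  have h21 : ∀ a b, i2 a = i1 b → k (i2 a) = k (i1 b) := fun a b h => by rw [h]
  let L : W → W → Prop := fun u v => (∃ a b, B1.L a b ∧ u = i1 a ∧ v = i1 b) ∨
    (∃ a b, B2.L a b ∧ u = i2 a ∧ v = i2 b) ∨ (u = i1 P.qm ∧ v = i2 X.qp) ∨
    (u = i2 X.qm ∧ v = i1 P.qp) ∨ (u = i2 X.rp ∧ v = i1 P.rm) ∨ (u = i2 X.rm ∧ v = i1 P.rp)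
  let R : W → W → Prop := fun u v => (∃ a b, B1.R a b ∧ u = i1 a ∧ v = i1 b) ∨
    (∃ a b, B2.R a b ∧ u = i2 a ∧ v = i2 b)
  refine ⟨⟨k, L, R, ?_, ?_, ?_, ?_, ?_, ?_⟩, ?_, ?_,
    fun a b h => not_lt.1 (fun h' => absurd ((c22 b a).1 h') (not_lt.2 h))⟩
  · intro a b h
    have h1 : ¬ k a < k b := by omega
    have h2 : ¬ k b < k a := by omega
    rcases G.surj a with ⟨a, rfl⟩ | ⟨a, rfl⟩ <;> rcases G.surj b with ⟨b, rfl⟩ | ⟨b, rfl⟩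
    · rw [c11] at h1 h2
      rw [B1.inj a b (by omega)]
    · rw [c12] at h1
      rw [c21] at h2
      have := lo' b
      by_cases hb : B2.key b < B2.key X.r
      · have e1 : a = P.q := B1.inj _ _ (by omega)
        have e2 : b = X.q := B2.inj _ _ (by omega)
        rw [e1, e2]; exact G.eqq
      · have e1 : a = P.r := B1.inj _ _ (by omega)
        have e2 : b = X.r := B2.inj _ _ (by omega)
        rw [e1, e2]; exact G.eqr
    · rw [c21] at h1
      rw [c12] at h2
      have := lo' a
      by_cases hb : B2.key a < B2.key X.r
      · have e1 : b = P.q := B1.inj _ _ (by omega)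
        have e2 : a = X.q := B2.inj _ _ (by omega)
        rw [e1, e2]; exact G.eqq.symm
      · have e1 : b = P.r := B1.inj _ _ (by omega)
        have e2 : a = X.r := B2.inj _ _ (by omega)
        rw [e1, e2]; exact G.eqr.symm
    · rw [c22] at h1 h2
      rw [B2.inj a b (by omega)]
  · rintro u v (⟨a, b, h, rfl, rfl⟩ | ⟨a, b, h, rfl, rfl⟩ | ⟨rfl, rfl⟩ | ⟨rfl, rfl⟩ | ⟨rfl, rfl⟩ |
      ⟨rfl, rfl⟩)
    · rw [c11]; exact B1.Llt _ _ h
    · rw [c22]; exact B2.Llt _ _ h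
    · rw [c12]; omega
    · rw [c21]; omega
    · rw [c21]; omega
    · rw [c21]; omega
  · rintro u v (⟨a, b, h, rfl, rfl⟩ | ⟨a, b, h, rfl, rfl⟩)
    · rw [c11]; exact B1.Rlt _ _ h
    · rw [c22]; exact B2.Rlt _ _ h
  · intro u v h
    rcases G.arc _ _ h with ⟨a, b, hab, rfl, rfl⟩ | ⟨a, b, hab, rfl, rfl⟩ | h | h | h | h
    · rcases B1.cover _ _ hab with h | h | h | h
      · exact Or.inl (Or.inl ⟨_, _, h, rfl, rfl⟩)
      · exact Or.inr (Or.inl (Or.inl ⟨_, _, h, rfl, rfl⟩))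
      · exact Or.inr (Or.inr (Or.inl (Or.inl ⟨_, _, h, rfl, rfl⟩)))
      · exact Or.inr (Or.inr (Or.inr (Or.inl ⟨_, _, h, rfl, rfl⟩)))
    · rcases B2.cover _ _ hab with h | h | h | h
      · exact Or.inl (Or.inr (Or.inl ⟨_, _, h, rfl, rfl⟩))
      · exact Or.inr (Or.inl (Or.inr (Or.inl ⟨_, _, h, rfl, rfl⟩)))
      · exact Or.inr (Or.inr (Or.inl (Or.inr ⟨_, _, h, rfl, rfl⟩)))
      · exact Or.inr (Or.inr (Or.inr (Or.inr ⟨_, _, h, rfl, rfl⟩)))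
    · exact Or.inl (Or.inr (Or.inr (Or.inl h)))
    · exact Or.inl (Or.inr (Or.inr (Or.inr (Or.inl h))))
    · exact Or.inr (Or.inl (Or.inr (Or.inr (Or.inr (Or.inr (Or.inl ⟨h.2, h.1⟩))))))
    · exact Or.inl (Or.inr (Or.inr (Or.inr (Or.inr (Or.inr h)))))
  · rintro u v u' v' (⟨a, b, h, rfl, rfl⟩ | ⟨a, b, h, rfl, rfl⟩ | ⟨rfl, rfl⟩ | ⟨rfl, rfl⟩ |
      ⟨rfl, rfl⟩ | ⟨rfl, rfl⟩) (⟨c, d, h', rfl, rfl⟩ | ⟨c, d, h', rfl, rfl⟩ | ⟨rfl, rfl⟩ |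
      ⟨rfl, rfl⟩ | ⟨rfl, rfl⟩ | ⟨rfl, rfl⟩)
    · simp only [c11]; exact B1.Lx _ _ _ _ h h'
    · have := chord _ _ h
      have := B2.Llt _ _ h'
      simp only [c11, c12, c21, c22]; omega
    · have := chord _ _ h
      simp only [c11, c12, c21, c22]; omega
    · have := chord _ _ h
      simp only [c11, c12, c21, c22]; omega
    · have := chord _ _ h
      simp only [c11, c12, c21, c22]; omega
    · have := chord _ _ h
      simp only [c11, c12, c21, c22]; omega
    · have := chord _ _ h'
      have := B2.Llt _ _ h
      simp only [c11, c12, c21, c22]; omega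
    · simp only [c22]; exact B2.Lx _ _ _ _ h h'
    · have := lo a
      have := l1 _ _ h
      simp only [c11, c12, c21, c22]; omega
    · have := hi b
      have := l1 _ _ h
      have := l3 _ _ h
      simp only [c11, c12, c21, c22]; omega
    · have := hi b
      have := l2 _ _ h
      have := l3 _ _ h
      simp only [c11, c12, c21, c22]; omega
    · have := l4 _ _ h
      simp only [c11, c12, c21, c22]; omega
    · have := chord _ _ h'
      simp only [c11, c12, c21, c22]; omega
    · have := lo c
      have := l1 _ _ h'
      simp only [c11, c12, c21, c22]; omega
    all_goals try (simp only [c11, c12, c21, c22]; omega)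
    · have := chord _ _ h'
      simp only [c11, c12, c21, c22]; omega
    · have := hi c
      have := l1 _ _ h'
      have := l3 _ _ h'
      simp only [c11, c12, c21, c22]; omega
    · have := chord _ _ h'
      simp only [c11, c12, c21, c22]; omega
    · have := hi d
      have := l2 _ _ h'
      have := l3 _ _ h'
      simp only [c11, c12, c21, c22]; omega
    · have := chord _ _ h'
      simp only [c11, c12, c21, c22]; omega
  · rintro u v u' v' (⟨a, b, h, rfl, rfl⟩ | ⟨a, b, h, rfl, rfl⟩) (⟨c, d, h', rfl, rfl⟩ |
      ⟨c, d, h', rfl, rfl⟩)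
    · simp only [c11]; exact B1.Rx _ _ _ _ h h'
    · have := r1 _ _ h'
      simp only [c11, c12, c21, c22]; omega
    · have := r1 _ _ h
      simp only [c11, c12, c21, c22]; omega
    · simp only [c22]; exact B2.Rx _ _ _ _ h h'
  · intro Q HQ hk
    obtain ⟨q1, q2, q3, q4, q5, qgap, qchord⟩ := HQ
    refine ⟨?_, ?_, ?_, ?_, ?_, ?_, ?_⟩
    · exact (c11 _ _).2 q1
    · exact (c11 _ _).2 q2
    · exact not_lt.1 ((c11 _ _).not.2 (by omega))
    · exact (c11 _ _).2 q4
    · exact (c11 _ _).2 q5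
    · intro w
      simp only [Prt.map, ← not_lt]
      rcases G.surj w with ⟨a, rfl⟩ | ⟨b, rfl⟩
      · simp only [c11]
        rcases qgap a with h | h | h | h | h
        · left; omega
        · right; left; rw [h]
        · right; right; left; omega
        · right; right; right; left; rw [h]
        · right; right; right; right; omega
      · left; rw [c12]; omega
    · rintro u v (⟨a, b, h, rfl, rfl⟩ | ⟨a, b, h, rfl, rfl⟩ | ⟨rfl, rfl⟩ | ⟨rfl, rfl⟩ |
        ⟨rfl, rfl⟩ | ⟨rfl, rfl⟩)
      · have := qchord _ _ h
        simp only [Prt.map, ← not_lt, c11]; omega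
      all_goals
        right; left
        simp only [Prt.map, ← not_lt, c11, c12, c21]; omega
  · intro Q HQ hk1 hk2 hk3 hk4
    obtain ⟨q1, q2, q3, q4, q5, qgap, qchord⟩ := HQ
    refine ⟨?_, ?_, ?_, ?_, ?_, ?_, ?_⟩
    · exact (c22 _ _).2 q1
    · exact (c22 _ _).2 q2
    · exact not_lt.1 ((c22 _ _).not.2 (by omega))
    · exact (c22 _ _).2 q4
    · exact (c22 _ _).2 q5
    · intro w
      simp only [Prt.map, ← not_lt]
      rcases G.surj w with ⟨a, rfl⟩ | ⟨b, rfl⟩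
      · simp only [c12, c21]
        by_cases h : B1.key a ≤ B1.key P.q
        · left; omega
        · right; right; right; right; omega
      · simp only [c22]
        rcases qgap b with h | h | h | h | h
        · left; omega
        · right; left; rw [h]
        · right; right; left; omega
        · right; right; right; left; rw [h]
        · right; right; right; right; omega
    · have := lo Q.qm
      have := hi Q.rp
      rintro u v (⟨a, b, h, rfl, rfl⟩ | ⟨a, b, h, rfl, rfl⟩ | ⟨rfl, rfl⟩ | ⟨rfl, rfl⟩ |
        ⟨rfl, rfl⟩ | ⟨rfl, rfl⟩)
      · have := chord _ _ h
        simp only [Prt.map, ← not_lt, c12, c21]; omega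
      · have := qchord _ _ h
        simp only [Prt.map, ← not_lt, c22]; omega
      · simp only [Prt.map, ← not_lt, c12, c21, c22]; omega
      · simp only [Prt.map, ← not_lt, c12, c21, c22]; omega
      · simp only [Prt.map, ← not_lt, c12, c21, c22]; omega
      · simp only [Prt.map, ← not_lt, c12, c21, c22]; omega

end GluingBook

section Attach

/-- A digraph with all the certificates. -/
structure St (g n k : ℕ) where
  V : Type
  [fin : Finite V]
  A : V → V → Prop
  card : Nat.card V = n
  gir : GirthGE A g
  B : Book A
  E : Type
  [acg : AddCommGroup E]
  [mod : Module ℝ E]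
  [fd : FiniteDimensional ℝ E]
  rnk : Module.finrank ℝ E = k
  w : Wit A E
  F : Fv A k
  v0 : V
  cyc : Wk A g v0 v0

attribute [instance] St.fin St.acg St.mod St.fd

theorem St.digr {g n k : ℕ} (S : St g n k) (hg : 3 ≤ g) :
    ∃ H : Digr, H.IsPlanar ∧ H.HasDigirth g ∧ H.fvs = k ∧ Nat.card H.V = n := by
  classical
  let H : Digr := { V := S.V, fintypeV := Fintype.ofFinite _, decEqV := inferInstance, Adj := S.A }
  exact ⟨H, Book.isPlanar H S.B hg S.gir, hasDigirth_of H g (by omega) S.gir S.v0 S.cyc,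
    fvs_eq H S.F S.w S.rnk, S.card⟩

/-- A port at which a guest can be attached. -/
structure HostOK {g n k : ℕ} (S : St g n k) (P : Prt S.V) : Prop where
  deg : Deg S.A P
  flat : Flat S.w P
  book : BHost S.B P
  fv : HFv S.F P

/-- A port along which the digraph can be attached. -/
structure GuestOK {g n k : ℕ} (S : St g n k) (X : Prt S.V) : Prop where
  deg : Deg S.A X
  flat : Flat S.w X
  book : BGuest S.B X
  fv : GFv S.F X

variable {V1 V2 : Type} (A1 : V1 → V1 → Prop) (A2 : V2 → V2 → Prop) (P : Prt V1) (X : Prt V2)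

/-- The vertex set of the glued digraph. -/
abbrev GV : Type := V1 ⊕ {v : V2 // v ≠ X.q ∧ v ≠ X.r}

open Classical in
/-- The map from the guest. -/
noncomputable def gi2 (v : V2) : GV (V1 := V1) X :=
  if hq : v = X.q then Sum.inl P.q else if hr : v = X.r then Sum.inl P.r else Sum.inr ⟨v, hq, hr⟩

/-- The arcs of the glued digraph. -/
def GA (u v : GV (V1 := V1) X) : Prop :=
  (∃ a b, A1 a b ∧ u = Sum.inl a ∧ v = Sum.inl b) ∨
  (∃ a b, A2 a b ∧ u = gi2 P X a ∧ v = gi2 P X b)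
    ∨ (u = Sum.inl P.qm ∧ v = gi2 P X X.qp) ∨ (u = gi2 P X X.qm ∧ v = Sum.inl P.qp)
    ∨ (u = Sum.inl P.rm ∧ v = gi2 P X X.rp) ∨ (u = gi2 P X X.rm ∧ v = Sum.inl P.rp)

theorem glue_concrete (hP : P.q ≠ P.r) (hX : X.q ≠ X.r) (d1 : Deg A1 P) (d2 : Deg A2 X) :
    Glue A1 A2 (GA A1 A2 P X) Sum.inl (gi2 P X) P X := by
  have eq : gi2 P X X.q = Sum.inl P.q := by simp [gi2]
  have er : gi2 P X X.r = Sum.inl P.r := by simp [gi2, hX.symm]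
  have cases : ∀ v, (v = X.q ∧ gi2 P X v = Sum.inl P.q) ∨ (v = X.r ∧ gi2 P X v = Sum.inl P.r) ∨
      ∃ h, gi2 P X v = Sum.inr ⟨v, h⟩ := by
    intro v
    by_cases h1 : v = X.q
    · left; exact ⟨h1, h1 ▸ eq⟩
    · by_cases h2 : v = X.r
      · right; left; exact ⟨h2, h2 ▸ er⟩
      · right; right; exact ⟨⟨h1, h2⟩, by simp [gi2, h1, h2]⟩
  refine ⟨?_, ?_, eq.symm, er.symm, ?_, ?_, fun u v h => h, ?_, ?_, ?_, ?_, ?_, ?_, d1, d2⟩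
  · intro a b h; exact Sum.inl_injective h
  · intro a b h
    rcases cases a with ⟨ea, ha⟩ | ⟨ea, ha⟩ | ⟨_, ha⟩ <;>
      rcases cases b with ⟨eb, hb⟩ | ⟨eb, hb⟩ | ⟨_, hb⟩ <;> rw [ha, hb] at h
    · rw [ea, eb]
    · exact absurd (Sum.inl_injective h) hP
    · cases h
    · exact absurd (Sum.inl_injective h).symm hP
    · rw [ea, eb]
    · cases h
    · cases h
    · cases h
    · have := Sum.inr_injective h
      simpa using this
  · intro a b h
    rcases cases b with ⟨eb, hb⟩ | ⟨eb, hb⟩ | ⟨_, hb⟩ <;> rw [hb] at h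
    · left; exact ⟨Sum.inl_injective h, eb⟩
    · right; exact ⟨Sum.inl_injective h, eb⟩
    · cases h
  · rintro (a | ⟨b, hb⟩)
    · left; exact ⟨a, rfl⟩
    · right; exact ⟨b, by simp [gi2, hb.1, hb.2]⟩
  · intro a b h; exact Or.inl ⟨a, b, h, rfl, rfl⟩
  · intro a b h; exact Or.inr (Or.inl ⟨a, b, h, rfl, rfl⟩)
  · exact Or.inr (Or.inr (Or.inl ⟨rfl, rfl⟩))
  · exact Or.inr (Or.inr (Or.inr (Or.inl ⟨rfl, rfl⟩)))
  · exact Or.inr (Or.inr (Or.inr (Or.inr (Or.inl ⟨rfl, rfl⟩))))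
  · exact Or.inr (Or.inr (Or.inr (Or.inr (Or.inr ⟨rfl, rfl⟩))))

theorem card_concrete [Finite V1] [Finite V2] (hX : X.q ≠ X.r) :
    Nat.card (GV (V1 := V1) X) + 2 = Nat.card V1 + Nat.card V2 := by
  classical
  have := Fintype.ofFinite V1
  have := Fintype.ofFinite V2
  have h : Fintype.card {v : V2 // v ≠ X.q ∧ v ≠ X.r} + 2 = Fintype.card V2 := by
    rw [Fintype.card_subtype]
    have h1 : (Finset.univ.filter fun v => v ≠ X.q ∧ v ≠ X.r) = ({X.q, X.r} : Finset V2)ᶜ := by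
      ext v; simp
    rw [h1, ← Finset.card_pair hX, Finset.card_compl_add_card]
  rw [Nat.card_sum, Nat.card_eq_fintype_card, Nat.card_eq_fintype_card, Nat.card_eq_fintype_card]
  omega

theorem attach {g n k n' k' h1 h2 x1 x2 : ℕ} (S : St g n k) (G : St g n' k') (P : Prt S.V)
    (X : Prt G.V) (HP : HostOK S P) (HX : GuestOK G X) (D1 : Dst S.A P h1 h2) (D2 : Dst G.A X x1 x2)
    (g2 : 2 ≤ g) (c1 : 2 ≤ h1) (c2 : 2 ≤ h2) (c3 : 2 ≤ x1) (c4 : 2 ≤ x2) (e1 : g + 2 ≤ h1 + x2)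
    (e2 : g + 2 ≤ h2 + x1) (m : ℕ) (hm : m + 2 = n + n') :
    ∃ (S' : St g m (k + k')) (i1 : S.V → S'.V) (i2 : G.V → S'.V),
      GlueN S.A G.A S'.A i1 i2 P X g h1 h2 x1 x2 ∧
      (∀ Q, HostOK S Q → S.B.key P.rp ≤ S.B.key Q.qm → HostOK S' (Q.map i1)) ∧
      (∀ Q, HostOK G Q → G.B.key X.q < G.B.key Q.qm → G.B.key Q.rp < G.B.key X.r →
        (G.B.key X.rp ≤ G.B.key Q.qm ∨ G.B.key Q.rp ≤ G.B.key X.rp) →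
        (G.B.key X.rm ≤ G.B.key Q.qm ∨ G.B.key Q.rp ≤ G.B.key X.rm) → HostOK S' (Q.map i2)) ∧
      (∀ a b, G.B.key a ≤ G.B.key b → S'.B.key (i2 a) ≤ S'.B.key (i2 b)) := by
  have nP := PNe.of_dst g2 S.gir HP.deg D1 c1 c2
  have nX := PNe.of_dst g2 G.gir HX.deg D2 c3 c4
  have gl := glue_concrete S.A G.A P X nP.qr nX.qr HP.deg HX.deg
  have N : GlueN S.A G.A (GA S.A G.A P X) Sum.inl (gi2 P X) P X g h1 h2 x1 x2 :=
    ⟨gl, g2, S.gir, G.gir, D1, D2, c1, c2, c3, c4, e1, e2⟩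
  obtain ⟨B, hB1, hB2, hB3⟩ := gl.book S.B G.B HP.book HX.book nX
  obtain ⟨F, hF1, hF2⟩ := gl.fv nX.qr S.F G.F HP.fv HX.fv
  refine ⟨{
    V := GV X, A := GA S.A G.A P X, card := ?_, gir := N.girth, B := B, E := (S.E × G.E),
    rnk := ?_, w := gl.wit S.w G.w nP nX HP.flat HX.flat, F := F, v0 := Sum.inl S.v0,
    cyc := S.cyc.map _ gl.arc1 }, Sum.inl, gi2 P X, N, ?_, ?_, hB3⟩
  · have := card_concrete (V1 := S.V) X nX.qr
    rw [S.card, G.card] at this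
    omega
  · rw [Module.finrank_prod, S.rnk, G.rnk]
  · intro Q HQ hk
    have kne : ∀ a b, S.B.key a ≠ S.B.key b → a ≠ b := fun a b h e => h (by rw [e])
    obtain ⟨o1, o2, o3, o4, o5, -, -⟩ := HP.book
    obtain ⟨u1, u2, u3, u4, u5, -, -⟩ := HQ.book
    refine ⟨gl.deg_map1 Q HQ.deg ?_ ?_, gl.wit_flat1 S.w G.w nP nX HP.flat HX.flat Q HQ.flat ?_, hB1 Q HQ.book hk,
      hF1 Q HQ.fv⟩
    · refine ⟨?_, ?_, ?_, ?_, ?_, ?_⟩ <;> apply kne <;> omega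
    · refine ⟨?_, ?_, ?_, ?_, ?_, ?_⟩ <;> apply kne <;> omega
    · simp only [List.mem_cons, List.not_mem_nil, or_false, forall_eq_or_imp, forall_eq]
      refine ⟨⟨?_, ?_⟩, ⟨?_, ?_⟩, ⟨?_, ?_⟩, ⟨?_, ?_⟩⟩ <;> apply kne <;> omega
  · intro Q HQ hk1 hk2 hk3 hk4
    have kne : ∀ a b, G.B.key a ≠ G.B.key b → a ≠ b := fun a b h e => h (by rw [e])
    obtain ⟨u1, u2, u3, u4, u5, -, -⟩ := HQ.book
    obtain ⟨o1, o2, o3, o4, o5, lo, hi, -, -, -, -, -⟩ := HX.book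
    have := lo Q.qm
    have := hi Q.rp
    refine ⟨gl.flip.deg_map1 Q HQ.deg ?_ ?_, gl.wit_flat2 S.w G.w nP nX HP.flat HX.flat Q HQ.flat ?_,
      hB2 Q HQ.book hk1 hk2 hk3 hk4, hF2 Q HQ.fv ?_⟩
    · refine ⟨?_, ?_, ?_, ?_, ?_, ?_⟩ <;> apply kne <;> omega
    · refine ⟨?_, ?_, ?_, ?_, ?_, ?_⟩ <;> apply kne <;> omega
    · simp only [List.mem_cons, List.not_mem_nil, or_false, forall_eq_or_imp, forall_eq]
      refine ⟨⟨?_, ?_⟩, ⟨?_, ?_⟩, ⟨?_, ?_⟩, ⟨?_, ?_⟩⟩ <;> apply kne <;> omega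
    · refine ⟨?_, ?_, ?_, ?_⟩ <;> apply kne <;> omega

end Attach

set_option linter.unusedSimpArgs false

section RingDefs

/-- Parameters of the ring digraph. -/
structure RP where
  g : ℕ
  j : ℕ
  p0 : ℕ
  p1 : ℕ
  e : ℕ
  hg : g = 2 * j + 2 + e
  he : e ≤ 1
  hj : 2 ≤ j
  hp : 1 ≤ p0
  hs : p1 = p0 ∨ p1 = p0 + 2
  hb : p1 + 3 ≤ g

/-- Length of the private path in column `c`. -/
def RP.p (R : RP) (c : ℕ) : ℕ := if c = 1 then R.p0 else R.p1

/-- Number of transit vertices in column `c`. -/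
def RP.y (R : RP) (c : ℕ) : ℕ := if c = 1 then 1 + R.e else 1

/-- Vertices of the ring digraph. -/
inductive RV
  | xx | aa | bb | yy
  | U (c : ℕ)
  | P (c t : ℕ)
  | V (c : ℕ)
  | B (c s : ℕ)
  | D (c d : ℕ)
  | A (c s : ℕ)

/-- Range conditions for the vertices. -/
def RP.ok (R : RP) : RV → Prop
  | RV.xx => True
  | RV.aa => True
  | RV.bb => True
  | RV.yy => True
  | RV.U c => 1 ≤ c ∧ c ≤ R.j
  | RV.P c t => 1 ≤ c ∧ c ≤ R.j ∧ 1 ≤ t ∧ t ≤ R.p c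
  | RV.V c => 1 ≤ c ∧ c ≤ R.j
  | RV.B c s => 1 ≤ c ∧ c ≤ R.j ∧ s < R.y c
  | RV.D c d => 1 ≤ c ∧ c ≤ R.j ∧ R.p c + 2 ≤ d ∧ d + 1 ≤ R.g
  | RV.A c s => 1 ≤ c ∧ c ≤ R.j ∧ s < R.y c

open RV in
/-- Arcs of the ring digraph. -/
inductive RA (R : RP) : RV → RV → Prop
  | up (c : ℕ) : 1 ≤ c → c ≤ R.j → RA R (U c) (P c 1)
  | ps (c t : ℕ) : 1 ≤ c → c ≤ R.j → 1 ≤ t → t + 1 ≤ R.p c → RA R (P c t) (P c (t + 1))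
  | pv (c : ℕ) : 1 ≤ c → c ≤ R.j → RA R (P c (R.p c)) (V c)
  | vd (c : ℕ) : 1 ≤ c → c ≤ R.j → RA R (V c) (D c (R.p c + 2))
  | bs (c s : ℕ) : 1 ≤ c → c ≤ R.j → s + 1 < R.y c → RA R (B c (s + 1)) (B c s)
  | bv (c : ℕ) : 1 ≤ c → c ≤ R.j → RA R (B c 0) (V c)
  | bd (c : ℕ) : 1 ≤ c → c ≤ R.j → RA R (B c 0) (D c (R.p c + 2))
  | ds (c d : ℕ) : 1 ≤ c → c ≤ R.j → R.p c + 2 ≤ d → d + 2 ≤ R.g → RA R (D c d) (D c (d + 1))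
  | da (c : ℕ) : 1 ≤ c → c ≤ R.j → RA R (D c (R.g - 1)) (A c 0)
  | as (c s : ℕ) : 1 ≤ c → c ≤ R.j → s + 1 < R.y c → RA R (A c s) (A c (s + 1))
  | du (c : ℕ) : 1 ≤ c → c ≤ R.j → RA R (D c (R.g - 1)) (U c)
  | ua (c : ℕ) : 1 ≤ c → c ≤ R.j → RA R (U c) (A c 0)
  | au1 : RA R aa (U 1)
  | au (c : ℕ) : 1 ≤ c → c + 1 ≤ R.j → RA R (A c (R.y c - 1)) (U (c + 1))
  | xa : RA R xx aa
  | ax : RA R (A R.j 0) xx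
  | byy : RA R bb yy
  | ap1 : RA R aa (P 1 1)
  | ap (c : ℕ) : 1 ≤ c → c + 1 ≤ R.j → RA R (A c (R.y c - 1)) (P (c + 1) 1)
  | vb1 : RA R (V 1) bb
  | vb (c : ℕ) : 1 ≤ c → c + 1 ≤ R.j → RA R (V (c + 1)) (B c (R.y c - 1))
  | pb1 : RA R (P 1 R.p0) bb
  | pb (c : ℕ) : 1 ≤ c → c + 1 ≤ R.j → RA R (P (c + 1) R.p1) (B c (R.y c - 1))
  | yb : RA R yy (B R.j 0)

/-- The vertex type. -/
abbrev RP.T (R : RP) : Type := {v : RV // R.ok v}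

/-- The arcs on the vertex type. -/
def RP.Adj (R : RP) (u v : R.T) : Prop := RA R u.1 v.1

/-- Column of a vertex. -/
def RP.col (R : RP) : RV → ℕ
  | RV.xx => 0
  | RV.aa => 0
  | RV.bb => R.j + 1
  | RV.yy => R.j + 1
  | RV.U c => c
  | RV.P c _ => c
  | RV.V c => c
  | RV.B c _ => c
  | RV.D c _ => c
  | RV.A c _ => c

/-- Position in the column. -/
def RP.pos (R : RP) : RV → ℕ
  | RV.xx => 0
  | RV.aa => 1
  | RV.bb => 1
  | RV.yy => 0
  | RV.U _ => 0
  | RV.P _ t => t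
  | RV.V c => R.p c + 1
  | RV.B c s => R.p c + 2 + s
  | RV.D c d => d + R.y c
  | RV.A c s => R.g + R.y c + s

/-- Length of a column. -/
def RP.len (R : RP) (c : ℕ) : ℕ := if c = 0 ∨ c = R.j + 1 then 2 else R.g + 2 * R.y c

theorem RP.pc (R : RP) (c : ℕ) : (c = 1 ∧ R.p c = R.p0 ∧ R.y c = 1 + R.e) ∨
    (c ≠ 1 ∧ R.p c = R.p1 ∧ R.y c = 1) := by
  simp only [RP.p, RP.y]
  by_cases h : c = 1 <;> simp [h]

theorem RP.lenc (R : RP) (c : ℕ) : ((c = 0 ∨ c = R.j + 1) ∧ R.len c = 2) ∨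
    (c ≠ 0 ∧ c ≠ R.j + 1 ∧ R.len c = R.g + 2 * R.y c) := by
  simp only [RP.len]
  by_cases h : c = 0 ∨ c = R.j + 1
  · left; simp [h]
  · right; rw [if_neg h]; omega

theorem RP.num (R : RP) : R.g = 2 * R.j + 2 + R.e ∧ R.e ≤ 1 ∧ 2 ≤ R.j ∧ 1 ≤ R.p0 ∧
    (R.p1 = R.p0 ∨ R.p1 = R.p0 + 2) ∧ R.p1 + 3 ≤ R.g :=
  ⟨R.hg, R.he, R.hj, R.hp, R.hs, R.hb⟩

theorem RP.col_le (R : RP) (v : R.T) : R.col v.1 ≤ R.j + 1 := by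
  obtain ⟨v, hv⟩ := v
  cases v <;> simp only [RP.ok] at hv <;> simp only [RP.col] <;> omega

theorem RP.pos_lt (R : RP) (v : R.T) : R.pos v.1 < R.len (R.col v.1) := by
  obtain ⟨v, hv⟩ := v
  have := R.num
  have h1 := R.lenc (R.col v)
  have h2 := R.pc (R.col v)
  cases v <;> simp only [RP.ok] at hv <;> simp only [RP.col, RP.pos] at * <;> omega

theorem RP.colpos_inj (R : RP) (u v : R.T) (h1 : R.col u.1 = R.col v.1)
    (h2 : R.pos u.1 = R.pos v.1) : u = v := by
  obtain ⟨u, hu⟩ := u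
  obtain ⟨v, hv⟩ := v
  have := R.num
  have h3 := R.pc (R.col u)
  apply Subtype.ext
  show u = v
  cases u <;> cases v <;> simp only [RP.ok] at hu hv <;> simp only [RP.col] at h1 h3 <;>
    first | (exfalso; omega) | skip
  all_goals
    try subst h1
    simp only [RP.pos] at h2
    first | rfl | (exfalso; omega) | skip
  all_goals
    congr 1
    try omega

theorem RP.surj (R : RP) (c t : ℕ) (hc : c ≤ R.j + 1) (ht : t < R.len c) :
    ∃ v : R.T, R.col v.1 = c ∧ R.pos v.1 = t := by
  have := R.hj
  have := R.hb
  have := R.hs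
  have hy : 1 ≤ R.y c := by simp only [RP.y]; split_ifs <;> omega
  have hpc : R.p c + 3 ≤ R.g := by simp only [RP.p]; split_ifs <;> omega
  unfold RP.len at ht
  split_ifs at ht with h
  · rcases h with rfl | rfl
    · rcases Nat.lt_or_ge t 1 with h1 | h1
      · exact ⟨⟨RV.xx, trivial⟩, rfl, by show 0 = t; omega⟩
      · exact ⟨⟨RV.aa, trivial⟩, rfl, by show 1 = t; omega⟩
    · rcases Nat.lt_or_ge t 1 with h1 | h1
      · exact ⟨⟨RV.yy, trivial⟩, rfl, by show 0 = t; omega⟩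
      · exact ⟨⟨RV.bb, trivial⟩, rfl, by show 1 = t; omega⟩
  · have h1 : 1 ≤ c ∧ c ≤ R.j := by omega
    rcases Nat.lt_or_ge t 1 with h2 | h2
    · exact ⟨⟨RV.U c, h1⟩, rfl, by show 0 = t; omega⟩
    rcases Nat.lt_or_ge t (R.p c + 1) with h3 | h3
    · exact ⟨⟨RV.P c t, h1.1, h1.2, h2, by omega⟩, rfl, rfl⟩
    rcases Nat.lt_or_ge t (R.p c + 2) with h4 | h4
    · exact ⟨⟨RV.V c, h1⟩, rfl, by show R.p c + 1 = t; omega⟩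
    rcases Nat.lt_or_ge t (R.p c + 2 + R.y c) with h5 | h5
    · exact ⟨⟨RV.B c (t - (R.p c + 2)), h1.1, h1.2, by omega⟩, rfl, by
        show R.p c + 2 + (t - (R.p c + 2)) = t; omega⟩
    rcases Nat.lt_or_ge t (R.g + R.y c) with h6 | h6
    · exact ⟨⟨RV.D c (t - R.y c), h1.1, h1.2, by omega, by omega⟩, rfl, by
        show t - R.y c + R.y c = t; omega⟩
    · exact ⟨⟨RV.A c (t - (R.g + R.y c)), h1.1, h1.2, by omega⟩, rfl, by
        show R.g + R.y c + (t - (R.g + R.y c)) = t; omega⟩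

/-- Vertices as pairs. -/
noncomputable def RP.equiv (R : RP) : R.T ≃ (Σ c : Fin (R.j + 2), Fin (R.len c)) :=
  Equiv.ofBijective (fun v => ⟨⟨R.col v.1, by have := R.col_le v; omega⟩, ⟨R.pos v.1, R.pos_lt v⟩⟩)
    (by
      constructor
      · intro u v h
        simp only [Sigma.mk.injEq, Fin.mk.injEq] at h
        obtain ⟨h1, h2⟩ := h
        apply R.colpos_inj u v h1
        have h3 := (Fin.heq_ext_iff (by rw [h1])).1 h2
        exact h3
      · rintro ⟨⟨c, hc⟩, ⟨t, ht⟩⟩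
        obtain ⟨v, rfl, rfl⟩ := R.surj c t (by omega) ht
        exact ⟨v, rfl⟩)

instance RP.finite (R : RP) : Finite R.T := Finite.of_equiv _ R.equiv.symm

theorem RP.card (R : RP) : Nat.card R.T = R.g * R.j + 2 * R.j + 2 * R.e + 4 := by
  rw [Nat.card_congr R.equiv, Nat.card_sigma]
  simp only [Nat.card_eq_fintype_card, Fintype.card_fin]
  rw [Fin.sum_univ_eq_sum_range (fun c => R.len c), Finset.sum_range_succ]
  have h1 : R.len (R.j + 1) = 2 := by simp [RP.len]
  have h2 : ∀ m, 1 ≤ m → m ≤ R.j →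
      ∑ c ∈ Finset.range (m + 1), R.len c = R.g * m + 2 * m + 2 * R.e + 2 := by
    intro m hm
    induction m, hm using Nat.le_induction with
    | base =>
      intro h
      have e0 : R.len 0 = 2 := by simp [RP.len]
      have e1 : R.len 1 = R.g + 2 * (1 + R.e) := by
        have := R.hj
        simp only [RP.len, RP.y]
        rw [if_neg (by omega)]; simp
      rw [Finset.sum_range_succ, Finset.sum_range_one, e0, e1]
      ring
    | succ m hm ih =>
      intro h
      rw [Finset.sum_range_succ, ih (by omega)]
      have e1 : R.len (m + 1) = R.g + 2 * 1 := by
        simp only [RP.len, RP.y]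
        rw [if_neg (by omega), if_neg (by omega)]
      rw [e1]
      ring
  rw [h1, h2 R.j (by have := R.hj; omega) le_rfl]

end RingDefs

set_option linter.unusedSimpArgs false

section RingBook

/-- Left chords. -/
def RP.LL (R : RP) (a s b t : ℕ) : Prop :=
  (b = a + 1 ∧ b ≤ R.j ∧ t = 1 ∧ s + 1 = R.len a) ∨
  (a = 1 ∧ (s = R.p0 ∨ s = R.p0 + 1) ∧ b = R.j + 1 ∧ t = 1) ∨
  (b = a + 1 ∧ 1 ≤ a ∧ b ≤ R.j ∧ s = R.p a + 1 + R.y a ∧ (t = R.p1 ∨ t = R.p1 + 1)) ∨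
  (a = R.j ∧ s = R.p1 + 2 ∧ b = R.j + 1 ∧ t = 0)

/-- Right chords. -/
def RP.RR (R : RP) (a s b t : ℕ) : Prop :=
  (a = b ∧ t = s + 1) ∨
  (b = a + 1 ∧ b ≤ R.j ∧ t = 0 ∧ s + 1 = R.len a) ∨
  (1 ≤ a ∧ a ≤ R.j ∧ b = a ∧ ((s = R.p a + 1 ∧ t = R.p a + 2 + R.y a) ∨
    (s = R.p a + 2 ∧ t = R.p a + 2 + R.y a) ∨ (s = 0 ∧ t + 1 = R.g + R.y a) ∨
    (s = 0 ∧ t = R.g + R.y a))) ∨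
  (a = 0 ∧ s = 0 ∧ b = R.j ∧ t + 1 = R.len R.j)

/-- The key. -/
def RP.key (R : RP) (v : R.T) : ℕ := (2 * R.g + 10) * R.col v.1 + R.pos v.1

theorem RP.pos_big (R : RP) (v : R.T) : R.pos v.1 < 2 * R.g + 10 := by
  have := R.pos_lt v
  have := R.lenc (R.col v.1)
  have := R.pc (R.col v.1)
  have := R.num
  omega

theorem lex_lt (M x y b c : ℕ) (hb : b < M) (hc : c < M) :
    M * x + b < M * y + c ↔ x < y ∨ (x = y ∧ b < c) := by
  rcases lt_trichotomy x y with h | h | h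
  · have h1 : M * x + M ≤ M * y := by
      calc M * x + M = M * (x + 1) := by ring
        _ ≤ M * y := Nat.mul_le_mul_left _ h
    simp only [h, true_or, iff_true]; omega
  · subst h; simp
  · have h1 : M * y + M ≤ M * x := by
      calc M * y + M = M * (y + 1) := by ring
        _ ≤ M * x := Nat.mul_le_mul_left _ h
    constructor
    · intro h2; omega
    · rintro (h2 | ⟨h2, -⟩) <;> omega

theorem RP.key_lt (R : RP) (u v : R.T) : R.key u < R.key v ↔
    R.col u.1 < R.col v.1 ∨ (R.col u.1 = R.col v.1 ∧ R.pos u.1 < R.pos v.1) :=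
  lex_lt _ _ _ _ _ (R.pos_big u) (R.pos_big v)

theorem RP.Llex (R : RP) (a s b t : ℕ) (h : R.LL a s b t) : a < b ∨ (a = b ∧ s < t) := by
  have := R.num
  rcases h with h | h | h | h <;> omega

theorem RP.Rlex (R : RP) (a s b t : ℕ) (h : R.RR a s b t) : a < b ∨ (a = b ∧ s < t) := by
  have := R.num
  have := R.pc a
  rcases h with h | h | h | h <;> omega

set_option maxHeartbeats 1600000 in
theorem RP.Lcross (R : RP) (a s b t a' s' b' t' : ℕ) (h : R.LL a s b t) (h' : R.LL a' s' b' t')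
    (l3 : s' < R.len a') (l4 : t' < R.len b') :
    ¬ ((a < a' ∨ (a = a' ∧ s < s')) ∧ (a' < b ∨ (a' = b ∧ s' < t)) ∧
      (b < b' ∨ (b = b' ∧ t < t'))) := by
  have := R.num
  have := R.pc a
  have := R.lenc a
  have := R.lenc b
  have := R.pc a'
  have := R.lenc a'
  have := R.lenc b'
  rintro ⟨c1, c2, c3⟩
  rcases h with h | h | h | h <;> rcases h' with h' | h' | h' | h' <;>
    rcases c1 with c1 | c1 <;> rcases c2 with c2 | c2 <;> rcases c3 with c3 | c3 <;> omega

set_option maxHeartbeats 1600000 in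
theorem RP.Rcross (R : RP) (a s b t a' s' b' t' : ℕ) (h : R.RR a s b t) (h' : R.RR a' s' b' t')
    (l1 : s < R.len a) (l2 : t < R.len b) (l3 : s' < R.len a') (l4 : t' < R.len b') :
    ¬ ((a < a' ∨ (a = a' ∧ s < s')) ∧ (a' < b ∨ (a' = b ∧ s' < t)) ∧
      (b < b' ∨ (b = b' ∧ t < t'))) := by
  have := R.num
  have := R.pc a
  have := R.lenc a
  have := R.lenc b
  have := R.pc a'
  have := R.lenc a'
  have := R.lenc b'
  have := R.lenc R.j
  have := R.pc R.j
  rintro ⟨c1, c2, c3⟩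
  rcases h with h | h | h | h <;> rcases h' with h' | h' | h' | h' <;>
    rcases c1 with c1 | c1 <;> rcases c2 with c2 | c2 <;> rcases c3 with c3 | c3 <;>
    first | omega | skip
  all_goals
    try obtain rfl := c1.1
    try obtain rfl := c2.1
    try obtain rfl := c3.1
    omega

/-- The book embedding of the ring. -/
def RP.book (R : RP) : Book R.Adj where
  key := R.key
  L u v := R.LL (R.col u.1) (R.pos u.1) (R.col v.1) (R.pos v.1)
  R u v := R.RR (R.col u.1) (R.pos u.1) (R.col v.1) (R.pos v.1)
  inj a b h := by
    have h1 := (R.key_lt a b).not.1 (by omega)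
    have h2 := (R.key_lt b a).not.1 (by omega)
    apply R.colpos_inj <;> omega
  Llt a b h := (R.key_lt a b).2 (R.Llex _ _ _ _ h)
  Rlt a b h := (R.key_lt a b).2 (R.Rlex _ _ _ _ h)
  Lx a b c d h h' := by
    rw [R.key_lt, R.key_lt, R.key_lt]
    exact R.Lcross _ _ _ _ _ _ _ _ h h' (R.pos_lt _) (R.pos_lt _)
  Rx a b c d h h' := by
    rw [R.key_lt, R.key_lt, R.key_lt]
    exact R.Rcross _ _ _ _ _ _ _ _ h h' (R.pos_lt _) (R.pos_lt _) (R.pos_lt _) (R.pos_lt _)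
  cover := by
    rintro ⟨u, hu⟩ ⟨v, hv⟩ h
    have := R.num
    have c0 := R.pc (R.col u)
    have c1 := R.lenc (R.col u)
    have c2 := R.pc (R.col v)
    have c3 := R.lenc (R.col v)
    have c4 := R.pc R.j
    have c5 := R.pc 1
    change RA R u v at h
    show R.LL (R.col u) (R.pos u) (R.col v) (R.pos v) ∨ R.LL (R.col v) (R.pos v) (R.col u) (R.pos u) ∨
      R.RR (R.col u) (R.pos u) (R.col v) (R.pos v) ∨ R.RR (R.col v) (R.pos v) (R.col u) (R.pos u)
    cases h <;> simp only [RP.col, RP.pos] at * <;> clear hu hv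
    case up => right; right; left; left; omega
    case ps => right; right; left; left; omega
    case pv => right; right; left; left; omega
    case vd => right; right; left; right; right; left; omega
    case bs => right; right; right; left; omega
    case bv => right; right; right; left; omega
    case bd => right; right; left; right; right; left; omega
    case ds => right; right; left; left; omega
    case da => right; right; left; left; omega
    case as => right; right; left; left; omega
    case du => right; right; right; right; right; left; omega
    case ua => right; right; left; right; right; left; omega
    case au1 => right; right; left; right; left; omega
    case au => right; right; left; right; left; omega
    case xa => right; right; left; left; omega
    case ax => right; right; right; right; right; right; omega
    case byy => right; right; right; left; omega
    case ap1 => left; left; omega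
    case ap => left; left; omega
    case vb1 => left; right; left; omega
    case vb => right; left; right; right; left; omega
    case pb1 => left; right; left; omega
    case pb => right; left; right; right; left; omega
    case yb => right; left; right; right; right; omega

end RingBook

set_option linter.unusedSimpArgs false

section RingPot

/-- Position on the first track. -/
def RP.f1 (R : RP) : RV → ℕ
  | RV.xx => 0
  | RV.aa => 0
  | RV.bb => R.p0 + 1
  | RV.yy => R.p0 + 2
  | RV.U _ => 0
  | RV.P _ t => t
  | RV.V c => R.p c + 1
  | RV.B _ _ => R.p1 + 1
  | RV.D _ d => d
  | RV.A _ _ => 0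

/-- Position on the second track. -/
def RP.ap (R : RP) : RV → ℕ
  | RV.xx => 0
  | RV.aa => 1
  | RV.bb => 2 * R.j + R.e
  | RV.yy => 2 * R.j + R.e + 1
  | RV.U c => if c = 1 then 2 else 2 * c + R.e
  | RV.P _ t => t
  | RV.V c => if c = 1 then 2 * (R.j - 1) + R.e + 1 else 2 * (R.j - c) + 1
  | RV.B c s => if c = 1 then 2 * (R.j - 1) + R.e - s else 2 * (R.j - c)
  | RV.D _ d => d
  | RV.A c s => if c = 1 then 3 + s else 2 * c + 1 + R.e

/-- Second potential. -/
def RP.f2 (R : RP) (v : RV) : ℕ := R.ap v + match v with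
  | RV.xx => 30 * R.g
  | RV.aa => 30 * R.g
  | RV.bb => 10 * R.g
  | RV.yy => 10 * R.g
  | RV.U _ => 30 * R.g
  | RV.P _ _ => 20 * R.g
  | RV.V _ => 10 * R.g
  | RV.B _ _ => 10 * R.g
  | RV.D _ _ => 0
  | RV.A _ _ => 30 * R.g

/-- Third potential. -/
def RP.f3 (R : RP) (v : RV) : ℕ := R.ap v + match v with
  | RV.xx => 0
  | RV.aa => 0
  | RV.bb => 6 * R.g
  | RV.yy => 6 * R.g
  | RV.U _ => 0
  | RV.P _ _ => 3 * R.g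
  | RV.V _ => 6 * R.g
  | RV.B _ _ => 6 * R.g
  | RV.D _ _ => 9 * R.g
  | RV.A _ _ => 0

set_option maxHeartbeats 1000000 in
theorem RP.girth (R : RP) : GirthGE R.Adj R.g := by
  apply GirthGE.of_pot (fun v => R.f1 v.1) (fun v => R.f2 v.1) (fun v => R.f3 v.1)
  rintro ⟨u, hu⟩ ⟨v, hv⟩ h
  change RA R u v at h
  show (R.f1 v ≤ R.f1 u + 1 ∧ R.f2 v ≤ R.f2 u + 1 ∧ R.f3 u + 1 ≤ R.f3 v) ∨
    (R.f1 v ≤ R.f1 u + 1 ∧ R.f2 v + R.g ≤ R.f2 u + 1) ∨ (R.f1 v + R.g ≤ R.f1 u + 1)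
  clear hu hv
  have := R.num
  have c0 := R.pc (R.col u)
  have c2 := R.pc (R.col v)
  have c5 := R.pc 1
  have c6 := R.pc R.j
  cases h <;> simp only [RP.col, RP.f1, RP.f2, RP.f3, RP.ap] at * <;> (try split_ifs at *) <;> omega

/-- Distance from the first guest vertex. -/
def RP.dx (R : RP) : RV → ℕ
  | RV.xx => 0
  | RV.aa => 1
  | RV.bb => R.p0 + 2
  | RV.yy => R.p0 + 3
  | RV.U _ => 1
  | RV.P _ t => 1 + t
  | RV.V _ => R.p0 + 2
  | RV.B _ _ => R.p0 + 2
  | RV.D _ _ => R.p0 + 3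
  | RV.A _ _ => 1

/-- Distance from the second guest vertex. -/
def RP.dy (R : RP) : RV → ℕ
  | RV.xx => R.g - R.p1 + 1
  | RV.aa => R.g - R.p1
  | RV.bb => 1
  | RV.yy => 0
  | RV.U _ => R.g - R.p1
  | RV.P _ _ => 1
  | RV.V _ => 1
  | RV.B _ _ => 1
  | RV.D c d => d - R.p c
  | RV.A _ _ => R.g - R.p1

/-- Distance from the vertex `q` of the first host port. -/
def RP.dq (R : RP) : RV → ℕ
  | RV.bb => min (3 + R.p0) (4 + R.e)
  | RV.U c => if c = 1 then 2 else if c = 2 then 3 + R.e else 4 + R.e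
  | RV.P c t => if c = 1 then min (2 + t) (4 + R.e) else if c = 2 ∧ t = 1 then 3 + R.e else 4 + R.e
  | RV.V c => if c = 1 then min (3 + R.p0) (4 + R.e) else 4 + R.e
  | RV.D c d => if c = 1 then (if d + 2 = R.g then 0 else if d + 1 = R.g then 1 else 4 + R.e)
      else 4 + R.e
  | RV.A c s => if c = 1 then 2 + s else 4 + R.e
  | _ => 4 + R.e

/-- The distance back. -/
def RP.nr (R : RP) : ℕ := R.g + R.p1 + R.e - R.p0 - 4

/-- Distance from the vertex `r` of the first host port. -/
def RP.dr (R : RP) : RV → ℕ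
  | RV.xx => R.nr
  | RV.aa => R.nr
  | RV.bb => min (R.p1 + R.e + 1) R.nr
  | RV.yy => min (R.p1 + R.e + 2) R.nr
  | RV.U c => if c = 2 then min (R.g - 2) R.nr else R.nr
  | RV.P c t => if c = 2 then (if t = 1 then min (R.g - 2) R.nr else t - 2) else R.nr
  | RV.V c => if c = 1 then R.p1 + R.e else if c = 2 then R.p1 - 1 else min (R.p1 + R.e + 3) R.nr
  | RV.B c s => if c = 1 then R.p1 - 1 + R.e - s else min (R.p1 + R.e + 3) R.nr
  | RV.D c d => if c = 1 then R.p1 + R.e + d - (R.p0 + 2) else if c = 2 then d - 2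
      else min (d + R.e + 2) R.nr
  | RV.A c _ => if c = 2 then min (R.g - 2) R.nr else R.nr

theorem RP.dx_le (R : RP) (u v : RV) (h : RA R u v) : R.dx v ≤ R.dx u + 1 := by
  have := R.num
  have c0 := R.pc (R.col u)
  have c2 := R.pc (R.col v)
  cases h <;> simp only [RP.col, RP.dx] at * <;> omega

theorem RP.dy_le (R : RP) (u v : RV) (h : RA R u v) : R.dy v ≤ R.dy u + 1 := by
  have := R.num
  have c0 := R.pc (R.col u)
  have c2 := R.pc (R.col v)
  cases h <;> simp only [RP.col, RP.dy] at * <;> omega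

set_option maxHeartbeats 1000000 in
theorem RP.dq_le (R : RP) (h3 : 3 ≤ R.p1) (h5 : R.p0 + 5 ≤ R.g) (u v : RV) (h : RA R u v) :
    R.dq v ≤ R.dq u + 1 := by
  have := R.num
  have c0 := R.pc (R.col u)
  have c2 := R.pc (R.col v)
  cases h <;> simp only [RP.col, RP.dq, and_true] at * <;> (try split_ifs at *) <;> omega

set_option maxHeartbeats 1000000 in
theorem RP.dr_le (R : RP) (h3 : 3 ≤ R.p1) (h5 : R.p0 + 5 ≤ R.g) (u v : RV) (h : RA R u v) :
    R.dr v ≤ R.dr u + 1 := by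
  have := R.num
  have c0 := R.pc (R.col u)
  have c2 := R.pc (R.col v)
  have c3 : R.nr + R.p0 + 4 = R.g + R.p1 + R.e := by unfold RP.nr; omega
  cases h <;> simp only [RP.col, RP.dr] at * <;> (try split_ifs at *) <;> omega

theorem RP.pot {R : RP} {f : RV → ℕ} (hf : ∀ u v, RA R u v → f v ≤ f u + 1) {l : ℕ} {a b : R.T}
    (w : Wk R.Adj l a b) : f b.1 ≤ f a.1 + l :=
  Wk.pot (fun v => f v.1) (fun a b h => hf a.1 b.1 h) w

end RingPot

set_option linter.unusedSimpArgs false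

section RingState

/-- The feedback vertex set. -/
def RP.inS (R : RP) : RV → Prop
  | RV.aa => True
  | RV.B c s => c = R.j ∧ s = 0
  | RV.P _ t => t = 1
  | _ => False

/-- Parametrization of the feedback vertex set. -/
def RP.phi (R : RP) : Option (Option (Fin R.j)) → R.T
  | none => ⟨RV.aa, trivial⟩
  | some none => ⟨RV.B R.j 0, by
      have := R.num; have := R.pc R.j; simp only [RP.ok]; omega⟩
  | some (some i) => ⟨RV.P (i.1 + 1) 1, by
      have := R.num; have := R.pc (i.1 + 1); have := i.2; simp only [RP.ok]; omega⟩

theorem RP.phi_inj (R : RP) : Function.Injective R.phi := by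
  rintro (_ | _ | i) (_ | _ | k) h <;> have h := congrArg Subtype.val h <;> simp [RP.phi] at h ⊢
  exact Fin.ext h

theorem RP.phi_mem (R : RP) (v : R.T) : (∃ i, R.phi i = v) ↔ R.inS v.1 := by
  constructor
  · rintro ⟨_ | _ | i, rfl⟩ <;> simp [RP.phi, RP.inS]
  · obtain ⟨v, hv⟩ := v
    intro h
    cases v <;> simp only [RP.inS, RP.ok] at h hv
    · exact ⟨none, rfl⟩
    · rename_i c t
      subst h
      exact ⟨some (some ⟨c - 1, by omega⟩), Subtype.ext (by
        show RV.P _ 1 = _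
        congr 1
        exact Nat.sub_add_cancel hv.1)⟩
    · obtain ⟨rfl, rfl⟩ := h
      exact ⟨some none, rfl⟩

/-- The ranking. -/
def RP.rk (R : RP) : RV → ℕ
  | RV.xx => 0
  | RV.aa => 0
  | RV.bb => 2 * (10 * R.g) + 1
  | RV.yy => 2 * (10 * R.g)
  | RV.U c => 4 * (R.j - c) + 4
  | RV.P _ t => 3 * (10 * R.g) + (R.g - t)
  | RV.V c => 2 * (10 * R.g) + 4 * c + 2
  | RV.B c s => 2 * (10 * R.g) + 4 * c + 3 + s
  | RV.D _ d => 10 * R.g + (R.g - d)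
  | RV.A c s => 4 * (R.j - c) + 3 - s

open Classical in
/-- The feedback vertex set with its certificate. -/
noncomputable def RP.fv (R : RP) : Fv R.Adj (R.j + 2) where
  S := Finset.univ.image R.phi
  card := by
    rw [Finset.card_image_of_injective _ R.phi_inj]
    simp
  rk v := R.rk v.1
  dec := by
    rintro ⟨u, hu⟩ ⟨v, hv⟩ h
    simp only [Finset.mem_image, Finset.mem_univ, true_and, R.phi_mem]
    intro h1 h2
    change RA R u v at h
    have := R.num
    have c0 := R.pc (R.col u)
    have c2 := R.pc (R.col v)
    cases h <;> simp only [RP.col, RP.ok, RP.rk, RP.inS, and_self, not_true_eq_false] at * <;> omega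

theorem RP.mem_fv (R : RP) (v : R.T) : v ∈ R.fv.S ↔ R.inS v.1 := by
  classical
  rw [← R.phi_mem]
  simp [RP.fv]

/-- The coordinate of a column. -/
def RP.cc (R : RP) (c : ℕ) (e : Option (Option (Fin R.j)) → ℝ) : ℝ :=
  if h : 1 ≤ c ∧ c ≤ R.j then e (some (some ⟨c - 1, by omega⟩)) else 0

/-- The witness function. -/
def RP.wt (R : RP) (e : Option (Option (Fin R.j)) → ℝ) : RV → ℝ
  | RV.xx => e none
  | RV.aa => e none
  | RV.bb => e (some none)
  | RV.yy => e (some none)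
  | RV.U c => e none + R.cc c e
  | RV.P c _ => R.cc c e
  | RV.V c => e (some none) + R.cc c e
  | RV.B _ _ => e (some none)
  | RV.D c _ => R.cc c e
  | RV.A _ _ => e none

theorem RP.cc_add (R : RP) (c : ℕ) (e e' : Option (Option (Fin R.j)) → ℝ) :
    R.cc c (e + e') = R.cc c e + R.cc c e' := by
  simp only [RP.cc]
  split_ifs <;> simp

theorem RP.cc_smul (R : RP) (c : ℕ) (a : ℝ) (e : Option (Option (Fin R.j)) → ℝ) :
    R.cc c (a • e) = a * R.cc c e := by
  simp only [RP.cc]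
  split_ifs <;> simp

theorem RP.wt_step (R : RP) (e : Option (Option (Fin R.j)) → ℝ) (v : RV) (hv : R.ok v)
    (h : R.wt e v ≠ 0) : ∃ w, R.ok w ∧ RA R v w ∧ R.wt e w ≠ 0 := by
  have := R.num
  have c1 := R.pc 1
  have cj := R.pc R.j
  have two : ∀ (w1 w2 : RV), R.ok w1 → R.ok w2 → RA R v w1 → RA R v w2 →
      (R.wt e w1 = 0 → R.wt e w2 = 0 → R.wt e v = 0) →
      ∃ w, R.ok w ∧ RA R v w ∧ R.wt e w ≠ 0 := by
    intro w1 w2 k1 k2 a1 a2 hh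
    by_contra hc
    push Not at hc
    exact h (hh (hc w1 k1 a1) (hc w2 k2 a2))
  cases v with
  | xx => exact ⟨RV.aa, trivial, RA.xa, h⟩
  | aa =>
    refine two (RV.U 1) (RV.P 1 1) ?_ ?_ RA.au1 RA.ap1 ?_
    · simp only [RP.ok]; omega
    · simp only [RP.ok]; omega
    · simp only [RP.wt]; intros; linarith
  | bb => exact ⟨RV.yy, trivial, RA.byy, h⟩
  | yy => exact ⟨RV.B R.j 0, by simp only [RP.ok]; omega, RA.yb, h⟩
  | U c =>
    have cc := R.pc c
    simp only [RP.ok] at hv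
    refine two (RV.P c 1) (RV.A c 0) ?_ ?_ (RA.up c hv.1 hv.2) (RA.ua c hv.1 hv.2) ?_
    · simp only [RP.ok]; omega
    · simp only [RP.ok]; omega
    · simp only [RP.wt]; intros; linarith
  | P c t =>
    have cc := R.pc c
    simp only [RP.ok] at hv
    by_cases ht : t + 1 ≤ R.p c
    · exact ⟨RV.P c (t + 1), by simp only [RP.ok]; omega, RA.ps c t hv.1 hv.2.1 hv.2.2.1 ht, h⟩
    · have e1 : t = R.p c := by omega
      subst e1
      rcases Nat.eq_or_lt_of_le hv.1 with hc | hc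
      · subst hc
        refine two (RV.V 1) RV.bb ?_ trivial (RA.pv 1 hv.1 hv.2.1) RA.pb1 ?_
        · simp only [RP.ok]; omega
        · simp only [RP.wt]; intros; linarith
      · obtain ⟨c', rfl⟩ : ∃ c', c = c' + 1 := ⟨c - 1, by omega⟩
        have cc' := R.pc c'
        refine two (RV.V (c' + 1)) (RV.B c' (R.y c' - 1)) ?_ ?_ (RA.pv _ hv.1 hv.2.1) ?_ ?_
        · simp only [RP.ok]; omega
        · simp only [RP.ok]; omega
        · have := RA.pb c' (by omega) hv.2.1
          rwa [show R.p1 = R.p (c' + 1) by omega] at this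
        · simp only [RP.wt]; intros; linarith
  | V c =>
    have cc := R.pc c
    simp only [RP.ok] at hv
    rcases Nat.eq_or_lt_of_le hv.1 with hc | hc
    · subst hc
      refine two (RV.D 1 (R.p 1 + 2)) RV.bb ?_ trivial (RA.vd 1 hv.1 hv.2) RA.vb1 ?_
      · simp only [RP.ok]; omega
      · simp only [RP.wt]; intros; linarith
    · obtain ⟨c', rfl⟩ : ∃ c', c = c' + 1 := ⟨c - 1, by omega⟩
      have cc' := R.pc c'
      refine two (RV.D (c' + 1) (R.p (c' + 1) + 2)) (RV.B c' (R.y c' - 1)) ?_ ?_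
        (RA.vd _ hv.1 hv.2) (RA.vb c' (by omega) hv.2) ?_
      · simp only [RP.ok]; omega
      · simp only [RP.ok]; omega
      · simp only [RP.wt]; intros; linarith
  | B c s =>
    have cc := R.pc c
    simp only [RP.ok] at hv
    cases s with
    | zero =>
      refine two (RV.V c) (RV.D c (R.p c + 2)) ?_ ?_ (RA.bv c hv.1 hv.2.1) (RA.bd c hv.1 hv.2.1) ?_
      · simp only [RP.ok]; omega
      · simp only [RP.ok]; omega
      · simp only [RP.wt]; intros; linarith
    | succ s =>
      exact ⟨RV.B c s, by simp only [RP.ok]; omega, RA.bs c s hv.1 hv.2.1 hv.2.2, h⟩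
  | D c d =>
    have cc := R.pc c
    simp only [RP.ok] at hv
    by_cases hd : d + 2 ≤ R.g
    · exact ⟨RV.D c (d + 1), by simp only [RP.ok]; omega, RA.ds c d hv.1 hv.2.1 hv.2.2.1 hd, h⟩
    · have e1 : d = R.g - 1 := by omega
      subst e1
      refine two (RV.A c 0) (RV.U c) ?_ ?_ (RA.da c hv.1 hv.2.1) (RA.du c hv.1 hv.2.1) ?_
      · simp only [RP.ok]; omega
      · simp only [RP.ok]; omega
      · simp only [RP.wt]; intros; linarith
  | A c s =>
    have cc := R.pc c
    simp only [RP.ok] at hv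
    by_cases hs : s + 1 < R.y c
    · exact ⟨RV.A c (s + 1), by simp only [RP.ok]; omega, RA.as c s hv.1 hv.2.1 hs, h⟩
    · have e1 : s = R.y c - 1 := by omega
      subst e1
      by_cases hc : c + 1 ≤ R.j
      · have cc' := R.pc (c + 1)
        refine two (RV.U (c + 1)) (RV.P (c + 1) 1) ?_ ?_ (RA.au c hv.1 hc) (RA.ap c hv.1 hc) ?_
        · simp only [RP.ok]; omega
        · simp only [RP.ok]; omega
        · simp only [RP.wt]; intros; linarith
      · have e2 : c = R.j := by omega
        subst e2
        refine ⟨RV.xx, trivial, ?_, h⟩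
        rw [show R.y R.j - 1 = 0 by omega]
        exact RA.ax

/-- The witness. -/
def RP.wit (R : RP) : Wit R.Adj (Option (Option (Fin R.j)) → ℝ) where
  T :=
    { toFun := fun e v => R.wt e v.1
      map_add' := by
        intro e e'
        funext v
        obtain ⟨v, hv⟩ := v
        cases v <;> simp only [RP.wt, Pi.add_apply, R.cc_add] <;> ring
      map_smul' := by
        intro a e
        funext v
        obtain ⟨v, hv⟩ := v
        cases v <;> simp only [RP.wt, Pi.smul_apply, smul_eq_mul, R.cc_smul, RingHom.id_apply] <;>
          ring }
  inj := by
    intro e he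
    have hh : ∀ v, R.ok v → R.wt e v = 0 := fun v hv => congrFun he ⟨v, hv⟩
    have := R.num
    funext o
    rcases o with _ | _ | i
    · exact hh RV.aa trivial
    · exact hh RV.bb trivial
    · have := R.pc (i.1 + 1)
      have h2 := i.2
      have := hh (RV.P (i.1 + 1) 1) (by simp only [RP.ok]; omega)
      simp only [RP.wt, RP.cc] at this
      rw [dif_pos (by omega)] at this
      exact this
  step := by
    rintro e ⟨v, hv⟩ h
    obtain ⟨w, h1, h2, h3⟩ := R.wt_step e v hv h
    exact ⟨⟨w, h1⟩, h2, h3⟩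

theorem RP.wkD (R : RP) (c d m : ℕ) (h : R.ok (RV.D c d)) (h' : R.ok (RV.D c (d + m))) :
    Wk R.Adj m ⟨RV.D c d, h⟩ ⟨RV.D c (d + m), h'⟩ := by
  induction m with
  | zero => exact Wk.nil _
  | succ m ih =>
    have h0 := h
    have h1 := h'
    simp only [RP.ok] at h0 h1
    refine Wk.snoc (ih (by simp only [RP.ok]; omega)) ?_
    exact RA.ds c (d + m) h1.1 h1.2.1 (by omega) (by omega)

theorem RP.wkP (R : RP) (c d m : ℕ) (h : R.ok (RV.P c d)) (h' : R.ok (RV.P c (d + m))) :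
    Wk R.Adj m ⟨RV.P c d, h⟩ ⟨RV.P c (d + m), h'⟩ := by
  induction m with
  | zero => exact Wk.nil _
  | succ m ih =>
    have h0 := h
    have h1 := h'
    simp only [RP.ok] at h0 h1
    refine Wk.snoc (ih (by simp only [RP.ok]; omega)) ?_
    exact RA.ps c (d + m) h1.1 h1.2.1 (by omega) (by omega)

theorem RP.wkD' (R : RP) (c d d' m : ℕ) (h : R.ok (RV.D c d)) (h' : R.ok (RV.D c d'))
    (e : d' = d + m) : Wk R.Adj m ⟨RV.D c d, h⟩ ⟨RV.D c d', h'⟩ := by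
  subst e; exact R.wkD c d m h h'

theorem RP.wkP' (R : RP) (c d d' m : ℕ) (h : R.ok (RV.P c d)) (h' : R.ok (RV.P c d'))
    (e : d' = d + m) : Wk R.Adj m ⟨RV.P c d, h⟩ ⟨RV.P c d', h'⟩ := by
  subst e; exact R.wkP c d m h h'

theorem RP.ok_U1 (R : RP) : R.ok (RV.U 1) := by
  have := R.num; simp only [RP.ok]; omega

theorem RP.cyc (R : RP) : Wk R.Adj R.g ⟨RV.U 1, R.ok_U1⟩ ⟨RV.U 1, R.ok_U1⟩ := by
  have := R.num
  have cc := R.pc 1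
  have o1 : R.ok (RV.P 1 1) := by simp only [RP.ok]; omega
  have o2 : R.ok (RV.P 1 (R.p 1)) := by simp only [RP.ok]; omega
  have o3 : R.ok (RV.V 1) := by simp only [RP.ok]; omega
  have o4 : R.ok (RV.D 1 (R.p 1 + 2)) := by simp only [RP.ok]; omega
  have o5 : R.ok (RV.D 1 (R.g - 1)) := by simp only [RP.ok]; omega
  have a1 : R.Adj ⟨RV.U 1, R.ok_U1⟩ ⟨_, o1⟩ := RA.up 1 le_rfl (by omega)
  have w2 := R.wkP' 1 1 (R.p 1) (R.p 1 - 1) o1 o2 (by omega)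
  have a3 : R.Adj ⟨_, o2⟩ ⟨_, o3⟩ := RA.pv 1 le_rfl (by omega)
  have a4 : R.Adj ⟨_, o3⟩ ⟨_, o4⟩ := RA.vd 1 le_rfl (by omega)
  have w5 := R.wkD' 1 (R.p 1 + 2) (R.g - 1) (R.g - 1 - (R.p 1 + 2)) o4 o5 (by omega)
  have a6 : R.Adj ⟨_, o5⟩ ⟨_, R.ok_U1⟩ := RA.du 1 le_rfl (by omega)
  have := ((((Wk.single a1).trans w2).snoc a3).snoc a4).trans w5 |>.snoc a6
  rwa [show 1 + (R.p 1 - 1) + 1 + 1 + (R.g - 1 - (R.p 1 + 2)) + 1 = R.g by omega] at this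

/-- The ring as a certified digraph. -/
noncomputable def RP.st (R : RP) : St R.g (R.g * R.j + 2 * R.j + 2 * R.e + 4) (R.j + 2) where
  V := R.T
  fin := R.finite
  A := R.Adj
  card := R.card
  gir := R.girth
  B := R.book
  E := Option (Option (Fin R.j)) → ℝ
  rnk := by simp
  w := R.wit
  F := R.fv
  v0 := ⟨RV.U 1, R.ok_U1⟩
  cyc := R.cyc

end RingState

set_option linter.unusedSimpArgs false

section RingPorts

theorem RP.ok_A (R : RP) : R.ok (RV.A R.j 0) := by
  have := R.num; have := R.pc R.j; simp only [RP.ok]; omega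

theorem RP.ok_B (R : RP) : R.ok (RV.B R.j 0) := by
  have := R.num; have := R.pc R.j; simp only [RP.ok]; omega

/-- The guest port. -/
def RP.gport (R : RP) : Prt R.T :=
  ⟨⟨RV.A R.j 0, R.ok_A⟩, ⟨RV.xx, trivial⟩, ⟨RV.aa, trivial⟩, ⟨RV.bb, trivial⟩, ⟨RV.yy, trivial⟩,
    ⟨RV.B R.j 0, R.ok_B⟩⟩

theorem RP.gdeg (R : RP) : Deg R.Adj R.gport where
  aq := RA.ax
  bq := RA.xa
  inq := by
    rintro ⟨u, hu⟩ h
    change RA R u RV.xx at h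
    apply Subtype.ext
    show u = RV.A R.j 0
    cases h
    rfl
  outq := by
    rintro ⟨u, hu⟩ h
    change RA R RV.xx u at h
    apply Subtype.ext
    show u = RV.aa
    cases h
    rfl
  ar := RA.byy
  br := RA.yb
  inr := by
    rintro ⟨u, hu⟩ h
    change RA R u RV.yy at h
    apply Subtype.ext
    show u = RV.bb
    cases h
    rfl
  outr := by
    rintro ⟨u, hu⟩ h
    change RA R RV.yy u at h
    apply Subtype.ext
    show u = RV.B R.j 0
    cases h
    rfl

theorem RP.col_xx (R : RP) : R.col RV.xx = 0 := rfl

theorem RP.pos_xx (R : RP) : R.pos RV.xx = 0 := rfl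

theorem RP.col_aa (R : RP) : R.col RV.aa = 0 := rfl

theorem RP.pos_aa (R : RP) : R.pos RV.aa = 1 := rfl

theorem RP.col_bb (R : RP) : R.col RV.bb = R.j + 1 := rfl

theorem RP.pos_bb (R : RP) : R.pos RV.bb = 1 := rfl

theorem RP.col_yy (R : RP) : R.col RV.yy = R.j + 1 := rfl

theorem RP.pos_yy (R : RP) : R.pos RV.yy = 0 := rfl

theorem RP.col_U (R : RP) (c : ℕ) : R.col (RV.U c) = c := rfl

theorem RP.pos_U (R : RP) (c : ℕ) : R.pos (RV.U c) = 0 := rfl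

theorem RP.col_P (R : RP) (c t : ℕ) : R.col (RV.P c t) = c := rfl

theorem RP.pos_P (R : RP) (c t : ℕ) : R.pos (RV.P c t) = t := rfl

theorem RP.col_V (R : RP) (c : ℕ) : R.col (RV.V c) = c := rfl

theorem RP.pos_V (R : RP) (c : ℕ) : R.pos (RV.V c) = R.p c + 1 := rfl

theorem RP.col_B (R : RP) (c s : ℕ) : R.col (RV.B c s) = c := rfl

theorem RP.pos_B (R : RP) (c s : ℕ) : R.pos (RV.B c s) = R.p c + 2 + s := rfl

theorem RP.col_D (R : RP) (c d : ℕ) : R.col (RV.D c d) = c := rfl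

theorem RP.pos_D (R : RP) (c d : ℕ) : R.pos (RV.D c d) = d + R.y c := rfl

theorem RP.col_A (R : RP) (c s : ℕ) : R.col (RV.A c s) = c := rfl

theorem RP.pos_A (R : RP) (c s : ℕ) : R.pos (RV.A c s) = R.g + R.y c + s := rfl

theorem RP.key_le (R : RP) (u v : R.T) : R.key u ≤ R.key v ↔
    ¬ (R.col v.1 < R.col u.1 ∨ (R.col v.1 = R.col u.1 ∧ R.pos v.1 < R.pos u.1)) := by
  rw [← R.key_lt, not_lt]

theorem RP.key_eq (R : RP) (u v : R.T) : R.key u = R.key v ↔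
    (R.col v.1 = R.col u.1 ∧ R.pos v.1 = R.pos u.1) := by
  have h1 := R.key_lt u v
  have h2 := R.key_lt v u
  constructor
  · intro h; omega
  · intro h
    by_contra hc
    rcases Nat.lt_or_gt_of_ne hc with h3 | h3
    · have := h1.1 h3; omega
    · have := h2.1 h3; omega

theorem RP.book_key (R : RP) (v : R.T) : R.book.key v = R.key v := rfl

theorem RP.gbook (R : RP) : BGuest R.book R.gport := by
  have := R.num
  have cj := R.pc R.j
  have lj := R.lenc R.j
  have l0 := R.lenc 0
  refine ⟨?_, ?_, ?_, ?_, ?_, ?_, ?_, ?_, ?_, ?_, ?_, ?_⟩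
  · simp only [R.book_key, R.key_lt, RP.gport, RP.col_xx, RP.pos_xx, RP.col_aa, RP.pos_aa, RP.col_bb, RP.pos_bb,
      RP.col_yy, RP.pos_yy, RP.col_A, RP.pos_A, RP.col_B, RP.pos_B, true_and, and_true, true_or, or_true, false_or, or_false,
      not_true_eq_false, not_false_eq_true, false_and, and_false]; try omega
  · simp only [R.book_key, R.key_lt, RP.gport, RP.col_xx, RP.pos_xx, RP.col_aa, RP.pos_aa, RP.col_bb, RP.pos_bb,
      RP.col_yy, RP.pos_yy, RP.col_A, RP.pos_A, RP.col_B, RP.pos_B, true_and, and_true, true_or, or_true, false_or, or_false,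
      not_true_eq_false, not_false_eq_true, false_and, and_false]; try omega
  · simp only [R.book_key, R.key_lt, RP.gport, RP.col_xx, RP.pos_xx, RP.col_aa, RP.pos_aa, RP.col_bb, RP.pos_bb,
      RP.col_yy, RP.pos_yy, RP.col_A, RP.pos_A, RP.col_B, RP.pos_B, true_and, and_true, true_or, or_true, false_or, or_false,
      not_true_eq_false, not_false_eq_true, false_and, and_false]; try omega
  · simp only [R.book_key, R.key_lt, RP.gport, RP.col_xx, RP.pos_xx, RP.col_aa, RP.pos_aa, RP.col_bb, RP.pos_bb,
      RP.col_yy, RP.pos_yy, RP.col_A, RP.pos_A, RP.col_B, RP.pos_B, true_and, and_true, true_or, or_true, false_or, or_false,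
      not_true_eq_false, not_false_eq_true, false_and, and_false]; try omega
  · simp only [R.book_key, R.key_le, RP.gport, RP.col_xx, RP.pos_xx, RP.col_aa, RP.pos_aa, RP.col_bb, RP.pos_bb,
      RP.col_yy, RP.pos_yy, RP.col_A, RP.pos_A, RP.col_B, RP.pos_B, true_and, and_true, true_or, or_true, false_or, or_false,
      not_true_eq_false, not_false_eq_true, false_and, and_false]; try omega
  · intro v
    simp only [R.book_key, R.key_le, R.key_eq, RP.gport, RP.col_xx, RP.pos_xx, RP.col_aa, RP.pos_aa, RP.col_bb, RP.pos_bb,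
      RP.col_yy, RP.pos_yy, RP.col_A, RP.pos_A, RP.col_B, RP.pos_B, true_and, and_true, true_or, or_true, false_or, or_false,
      not_true_eq_false, not_false_eq_true, false_and, and_false]; try omega
  · intro v
    have h1 := R.pos_lt v
    have h2 := R.col_le v
    have h3 := R.lenc (R.col v.1)
    simp only [R.book_key, R.key_le, RP.gport, RP.col_xx, RP.pos_xx, RP.col_aa, RP.pos_aa, RP.col_bb, RP.pos_bb,
      RP.col_yy, RP.pos_yy, RP.col_A, RP.pos_A, RP.col_B, RP.pos_B, true_and, and_true, true_or, or_true, false_or, or_false,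
      not_true_eq_false, not_false_eq_true, false_and, and_false]
    by_cases hc : R.col v.1 = R.j
    · rw [hc] at h1 h2 h3; omega
    · omega
  · intro c d h
    have h1 := R.pos_lt c
    have h3 := R.lenc (R.col c.1)
    have h4 := R.pc (R.col c.1)
    change R.LL _ _ _ _ at h
    simp only [ne_eq, R.book_key, R.key_eq, RP.gport, RP.col_xx, RP.pos_xx, RP.col_aa, RP.pos_aa, RP.col_bb, RP.pos_bb,
      RP.col_yy, RP.pos_yy, RP.col_A, RP.pos_A, RP.col_B, RP.pos_B, true_and, and_true, true_or, or_true, false_or, or_false,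
      not_true_eq_false, not_false_eq_true, false_and, and_false]
    rcases h with h | h | h | h <;> omega
  · intro c d h
    have h4 := R.pc (R.col c.1)
    change R.LL _ _ _ _ at h
    simp only [R.book_key, R.key_lt, RP.gport, RP.col_xx, RP.pos_xx, RP.col_aa, RP.pos_aa, RP.col_bb, RP.pos_bb,
      RP.col_yy, RP.pos_yy, RP.col_A, RP.pos_A, RP.col_B, RP.pos_B, true_and, and_true, true_or, or_true, false_or, or_false,
      not_true_eq_false, not_false_eq_true, false_and, and_false]
    rcases h with h | h | h | h <;> omega
  · intro c d h
    have h4 := R.pc (R.col c.1)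
    change R.LL _ _ _ _ at h
    simp only [R.book_key, R.key_lt, R.key_le, RP.gport, RP.col_xx, RP.pos_xx, RP.col_aa, RP.pos_aa, RP.col_bb, RP.pos_bb,
      RP.col_yy, RP.pos_yy, RP.col_A, RP.pos_A, RP.col_B, RP.pos_B, true_and, and_true, true_or, or_true, false_or, or_false,
      not_true_eq_false, not_false_eq_true, false_and, and_false]
    rcases h with h | h | h | h <;> omega
  · intro c d h
    have h1 := R.pos_lt d
    have h3 := R.lenc (R.col d.1)
    have h4 := R.pc (R.col c.1)
    change R.LL _ _ _ _ at h
    simp only [R.book_key, R.key_lt, R.key_le, RP.gport, RP.col_xx, RP.pos_xx, RP.col_aa, RP.pos_aa, RP.col_bb, RP.pos_bb,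
      RP.col_yy, RP.pos_yy, RP.col_A, RP.pos_A, RP.col_B, RP.pos_B, true_and, and_true, true_or, or_true, false_or, or_false,
      not_true_eq_false, not_false_eq_true, false_and, and_false]
    rcases h with h | h | h | h <;> omega
  · intro c d h
    have h4 := R.pc (R.col c.1)
    change R.RR _ _ _ _ at h
    simp only [R.book_key, R.key_lt, R.key_le, RP.gport, RP.col_xx, RP.pos_xx, RP.col_aa, RP.pos_aa, RP.col_bb, RP.pos_bb,
      RP.col_yy, RP.pos_yy, RP.col_A, RP.pos_A, RP.col_B, RP.pos_B, true_and, and_true, true_or, or_true, false_or, or_false,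
      not_true_eq_false, not_false_eq_true, false_and, and_false]
    rcases h with h | h | h | h <;> omega

theorem RP.guestOK (R : RP) : GuestOK R.st R.gport where
  deg := R.gdeg
  flat := fun e => ⟨rfl, rfl⟩
  book := R.gbook
  fv := by
    refine ⟨?_, ?_, ?_⟩
    · exact (R.mem_fv _).not.2 (by simp [RP.gport, RP.inS])
    · exact (R.mem_fv _).not.2 (by simp [RP.gport, RP.inS])
    · exact (R.mem_fv _).2 (by simp [RP.gport, RP.inS])

theorem RP.gdst (R : RP) (x1 x2 : ℕ) (h1 : x1 ≤ R.p0 + 3) (h2 : x2 + R.p1 ≤ R.g + 1) :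
    Dst R.Adj R.gport x1 x2 := by
  have := R.num
  constructor
  · intro l w
    have := RP.pot R.dx_le w
    simp only [RP.gport, RP.dx] at this
    omega
  · intro l w
    have := RP.pot R.dy_le w
    simp only [RP.gport, RP.dy] at this
    omega

/-- Admissible host port. -/
def RP.HP (R : RP) (k : ℕ) : Prop := 1 ≤ k ∧ k + 1 ≤ R.j ∧ 3 ≤ R.p1 ∧ R.p k + 5 ≤ R.g

theorem RP.HP.okD {R : RP} {k : ℕ} (h : R.HP k) (d : ℕ) (hd : d + 1 ≤ R.g) (hd' : R.g ≤ d + 3) :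
    R.ok (RV.D k d) := by
  obtain ⟨h1, h2, h3, h4⟩ := h
  simp only [RP.ok]; omega

theorem RP.HP.okP {R : RP} {k : ℕ} (h : R.HP k) (t : ℕ) (ht : 1 ≤ t) (ht' : t ≤ 3) :
    R.ok (RV.P (k + 1) t) := by
  obtain ⟨h1, h2, h3, h4⟩ := h
  have := R.pc (k + 1)
  simp only [RP.ok]; omega

/-- The host port between columns `k` and `k + 1`. -/
def RP.hport (R : RP) (k : ℕ) (h : R.HP k) : Prt R.T :=
  ⟨⟨RV.D k (R.g - 3), h.okD _ (by have := R.num; omega) (by omega)⟩,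
    ⟨RV.D k (R.g - 2), h.okD _ (by have := R.num; omega) (by omega)⟩,
    ⟨RV.D k (R.g - 1), h.okD _ (by have := R.num; omega) (by omega)⟩,
    ⟨RV.P (k + 1) 1, h.okP _ (by omega) (by omega)⟩,
    ⟨RV.P (k + 1) 2, h.okP _ (by omega) (by omega)⟩,
    ⟨RV.P (k + 1) 3, h.okP _ (by omega) (by omega)⟩⟩

theorem RP.hdeg (R : RP) (k : ℕ) (hk : R.HP k) : Deg R.Adj (R.hport k hk) := by
  have := R.num
  have ck := R.pc k
  have ck' := R.pc (k + 1)
  obtain ⟨h1, h2, h3, h4⟩ := id hk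
  refine ⟨?_, ?_, ?_, ?_, ?_, ?_, ?_, ?_⟩
  · have := RA.ds (R := R) k (R.g - 3) h1 (by omega) (by omega) (by omega)
    rw [show R.g - 3 + 1 = R.g - 2 by omega] at this
    exact this
  · have := RA.ds (R := R) k (R.g - 2) h1 (by omega) (by omega) (by omega)
    rw [show R.g - 2 + 1 = R.g - 1 by omega] at this
    exact this
  · rintro ⟨u, hu⟩ h
    change RA R u (RV.D k (R.g - 2)) at h
    apply Subtype.ext
    show u = RV.D k (R.g - 3)
    clear hu
    generalize hv : RV.D k (R.g - 2) = v at h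
    cases h <;> simp only [reduceCtorEq, RV.D.injEq] at hv
    · obtain ⟨rfl, hv⟩ := hv; omega
    · obtain ⟨rfl, hv⟩ := hv; omega
    · congr 1 <;> omega
  · rintro ⟨u, hu⟩ h
    change RA R (RV.D k (R.g - 2)) u at h
    apply Subtype.ext
    show u = RV.D k (R.g - 1)
    clear hu
    generalize hv : RV.D k (R.g - 2) = v at h
    cases h <;> simp only [reduceCtorEq, RV.D.injEq] at hv
    · congr 1 <;> omega
    · omega
    · omega
  · exact RA.ps (R := R) (k + 1) 1 (by omega) h2 (by omega) (by omega)
  · exact RA.ps (R := R) (k + 1) 2 (by omega) h2 (by omega) (by omega)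
  · rintro ⟨u, hu⟩ h
    change RA R u (RV.P (k + 1) 2) at h
    apply Subtype.ext
    show u = RV.P (k + 1) 1
    clear hu
    generalize hv : RV.P (k + 1) 2 = v at h
    cases h <;> simp only [reduceCtorEq, RV.P.injEq] at hv
    · omega
    · congr 1 <;> omega
    · omega
    · omega
  · rintro ⟨u, hu⟩ h
    change RA R (RV.P (k + 1) 2) u at h
    apply Subtype.ext
    show u = RV.P (k + 1) 3
    clear hu
    generalize hv : RV.P (k + 1) 2 = v at h
    cases h <;> simp only [reduceCtorEq, RV.P.injEq] at hv
    · congr 1 <;> omega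
    · rw [← hv.1] at hv; omega
    · omega
    · omega

theorem RP.hbook (R : RP) (k : ℕ) (hk : R.HP k) : BHost R.book (R.hport k hk) := by
  have := R.num
  have ck := R.pc k
  have ck' := R.pc (k + 1)
  have lk := R.lenc k
  obtain ⟨h1, h2, h3, h4⟩ := id hk
  refine ⟨?_, ?_, ?_, ?_, ?_, ?_, ?_⟩
  · simp only [R.book_key, R.key_lt, RP.hport, RP.col_D, RP.pos_D, RP.col_P, RP.pos_P, true_and, and_true, true_or, or_true, false_or, or_false,
      not_true_eq_false, not_false_eq_true, false_and, and_false]; try omega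
  · simp only [R.book_key, R.key_lt, RP.hport, RP.col_D, RP.pos_D, RP.col_P, RP.pos_P, true_and, and_true, true_or, or_true, false_or, or_false,
      not_true_eq_false, not_false_eq_true, false_and, and_false]; try omega
  · simp only [R.book_key, R.key_le, RP.hport, RP.col_D, RP.pos_D, RP.col_P, RP.pos_P, true_and, and_true, true_or, or_true, false_or, or_false,
      not_true_eq_false, not_false_eq_true, false_and, and_false]; try omega
  · simp only [R.book_key, R.key_lt, RP.hport, RP.col_D, RP.pos_D, RP.col_P, RP.pos_P, true_and, and_true, true_or, or_true, false_or, or_false,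
      not_true_eq_false, not_false_eq_true, false_and, and_false]; try omega
  · simp only [R.book_key, R.key_lt, RP.hport, RP.col_D, RP.pos_D, RP.col_P, RP.pos_P, true_and, and_true, true_or, or_true, false_or, or_false,
      not_true_eq_false, not_false_eq_true, false_and, and_false]; try omega
  · intro v
    have e1 : v = (R.hport k hk).q ↔ R.col v.1 = k ∧ R.pos v.1 = R.g - 2 + R.y k :=
      ⟨fun h => by rw [h]; exact ⟨rfl, rfl⟩, fun h => R.colpos_inj _ _ h.1 h.2⟩
    have e2 : v = (R.hport k hk).r ↔ R.col v.1 = k + 1 ∧ R.pos v.1 = 2 :=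
      ⟨fun h => by rw [h]; exact ⟨rfl, rfl⟩, fun h => R.colpos_inj _ _ h.1 h.2⟩
    rw [e1, e2]
    simp only [R.book_key, R.key_le, RP.hport, RP.col_D, RP.pos_D, RP.col_P, RP.pos_P, true_and, and_true, true_or, or_true, false_or, or_false,
      not_true_eq_false, not_false_eq_true, false_and, and_false]; try omega
  · intro a b h
    have ca := R.pc (R.col a.1)
    have la := R.lenc (R.col a.1)
    change R.LL _ _ _ _ at h
    simp only [R.book_key, R.key_lt, R.key_le, RP.hport, RP.col_D, RP.pos_D, RP.col_P, RP.pos_P, true_and, and_true, true_or, or_true, false_or, or_false,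
      not_true_eq_false, not_false_eq_true, false_and, and_false]
    by_cases e : R.col a.1 = k
    · have e1 : R.p (R.col a.1) = R.p k := by rw [e]
      have e2 : R.y (R.col a.1) = R.y k := by rw [e]
      have e3 : R.len (R.col a.1) = R.len k := by rw [e]
      rcases h with h | h | h | h <;> omega
    · rcases h with h | h | h | h <;> omega

theorem RP.hostOK (R : RP) (k : ℕ) (hk : R.HP k) : HostOK R.st (R.hport k hk) where
  deg := R.hdeg k hk
  flat := fun e => ⟨rfl, rfl⟩
  book := R.hbook k hk
  fv := by
    have := R.num
    refine ⟨?_, ?_, ?_⟩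
    · exact (R.mem_fv _).not.2 (by simp [RP.hport, RP.inS])
    · exact (R.mem_fv _).not.2 (by simp [RP.hport, RP.inS])
    · show R.rk (R.hport k hk).q.1 < R.rk (R.hport k hk).r.1
      simp only [RP.hport, RP.rk]; omega

/-- Ring distances between the first host port vertices. -/
theorem RP.hdst (R : RP) (hk : R.HP 1) (x1 x2 : ℕ) (h1 : x1 ≤ 4 + R.e) (h2 : x2 ≤ R.nr) :
    Dst R.Adj (R.hport 1 hk) x1 x2 := by
  have := R.num
  have ck := R.pc 1
  obtain ⟨k1, k2, k3, k4⟩ := id hk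
  have c3 : R.nr + R.p0 + 4 = R.g + R.p1 + R.e := by unfold RP.nr; omega
  constructor
  · intro l w
    have := RP.pot (R.dq_le k3 (by omega)) w
    simp only [RP.hport, RP.dq] at this
    simp at this
    split_ifs at this <;> omega
  · intro l w
    have := RP.pot (R.dr_le k3 (by omega)) w
    simp only [RP.hport, RP.dr] at this
    simp at this
    omega

/-- The walk from `q` to `r` at a clean port. -/
theorem RP.walk_qr (R : RP) (k : ℕ) (hk : R.HP k) (hy : R.y k = 1) :
    Wk R.Adj 4 (R.hport k hk).q (R.hport k hk).r := by
  obtain ⟨k1, k2, k3, k4⟩ := id hk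
  have D := R.hdeg k hk
  have o : R.ok (RV.A k 0) := by simp only [RP.ok]; omega
  have a2 : R.Adj (R.hport k hk).qp ⟨RV.A k 0, o⟩ := RA.da k k1 (by omega)
  have a3 : R.Adj ⟨RV.A k 0, o⟩ (R.hport k hk).rm := by
    have := RA.ap (R := R) k k1 k2
    rw [hy] at this
    exact this
  exact (((Wk.single D.bq).snoc a2).snoc a3).snoc D.ar

/-- The walk from `r` to `q` at a clean port. -/
theorem RP.walk_rq (R : RP) (k : ℕ) (hk : R.HP k) (hy : R.y k = 1) (hp : R.p k = R.p1) :
    Wk R.Adj (R.g - 4) (R.hport k hk).r (R.hport k hk).q := by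
  obtain ⟨k1, k2, k3, k4⟩ := id hk
  have c1 := R.pc (k + 1)
  have o : R.ok (RV.B k 0) := by simp only [RP.ok]; omega
  have o1 : R.ok (RV.P (k + 1) R.p1) := by simp only [RP.ok]; omega
  have o2 : R.ok (RV.D k (R.p k + 2)) := by simp only [RP.ok]; omega
  have w1 := R.wkP' (k + 1) 2 R.p1 (R.p1 - 2) (hk.okP 2 (by omega) (by omega)) o1 (by omega)
  have a2 : R.Adj ⟨_, o1⟩ ⟨_, o⟩ := by
    have := RA.pb (R := R) k k1 k2
    rw [hy] at this
    exact this
  have a3 : R.Adj ⟨_, o⟩ ⟨_, o2⟩ := RA.bd (R := R) k k1 (by omega)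
  have w4 := R.wkD' k (R.p k + 2) (R.g - 2) (R.g - 4 - R.p k) o2 (hk.okD _ (by omega) (by omega))
    (by omega)
  have := ((w1.snoc a2).snoc a3).trans w4
  rw [show R.p1 - 2 + 1 + 1 + (R.g - 4 - R.p k) = R.g - 4 by omega] at this
  exact this

end RingPorts

/-- A pair of walks in a digraph of girth `g` of total length `g`. -/
theorem dst_of_walks {V : Type} {A : V → V → Prop} {g a b : ℕ} (hG : GirthGE A g) (P : Prt V)
    (w1 : Wk A a P.q P.r) (w2 : Wk A b P.r P.q) (h : a + b = g) (ha : 1 ≤ a) (hb : 1 ≤ b) :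
    Dst A P a b := by
  constructor
  · intro l w
    have := hG _ _ (by omega) (w.trans w2)
    omega
  · intro l w
    have := hG _ _ (by omega) (w1.trans w)
    omega

set_option linter.unusedSimpArgs false

section Cycles

/-- Arcs of the directed cycle. -/
def CA (g : ℕ) (u v : Fin g) : Prop := v.1 = u.1 + 1 ∨ (u.1 + 1 = g ∧ v.1 = 0)

theorem CA.girth (g : ℕ) : GirthGE (CA g) g := by
  apply GirthGE.of_pot (fun v => v.1) (fun _ => 0) (fun v => v.1)
  rintro u v h
  simp only [CA] at h
  have := u.2
  omega

/-- The sequence around the cycle. -/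
def cseq (g t : ℕ) : ℕ := if t < g then t else t - g

theorem CA.wk (g i l : ℕ) (hi : i < g) (hl : l ≤ g) (h : cseq g (i + l) < g) :
    Wk (CA g) l ⟨i, hi⟩ ⟨cseq g (i + l), h⟩ := by
  induction l with
  | zero =>
    have : cseq g (i + 0) = i := by simp [cseq, hi]
    simp only [this]
    exact Wk.nil _
  | succ l ih =>
    have hh : cseq g (i + l) < g := by simp only [cseq]; split_ifs <;> omega
    refine Wk.snoc (ih (by omega) hh) ?_
    simp only [CA, cseq]
    split_ifs <;> omega

theorem CA.wk' (g i l k : ℕ) (hi : i < g) (hk : k < g) (hl : l ≤ g) (h : i + l = k ∨ i + l = k + g) :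
    Wk (CA g) l ⟨i, hi⟩ ⟨k, hk⟩ := by
  have e : cseq g (i + l) = k := by simp only [cseq]; split_ifs <;> omega
  have := CA.wk g i l hi hl (by omega)
  simp only [e] at this
  exact this

/-- The constant witness. -/
def CA.wit (g : ℕ) (hg : 1 ≤ g) : Wit (CA g) ℝ where
  T :=
    { toFun := fun e _ => e
      map_add' := by intros; rfl
      map_smul' := by intros; rfl }
  inj e h := congrFun h ⟨0, hg⟩
  step e v h := by
    have := v.2
    by_cases hv : v.1 + 1 = g
    · exact ⟨⟨0, hg⟩, Or.inr ⟨hv, rfl⟩, h⟩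
    · exact ⟨⟨v.1 + 1, by omega⟩, Or.inl rfl, h⟩

/-- The feedback vertex set of the cycle. -/
def CA.fv (g : ℕ) (s : Fin g) : Fv (CA g) 1 where
  S := {s}
  card := by simp
  rk v := if v.1 ≤ s.1 then s.1 - v.1 else s.1 + g - v.1
  dec u v h h1 h2 := by
    have := u.2
    have := v.2
    have := s.2
    simp only [Finset.mem_singleton, Fin.ext_iff, CA] at *
    split_ifs <;> omega

/-- The cycle as a certified digraph. -/
def cst (g : ℕ) (hg : 1 ≤ g) (s : Fin g) (B : Book (CA g)) : St g g 1 where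
  V := Fin g
  A := CA g
  card := by simp
  gir := CA.girth g
  B := B
  E := ℝ
  rnk := by simp
  w := CA.wit g hg
  F := CA.fv g s
  v0 := ⟨0, hg⟩
  cyc := CA.wk' g 0 g 0 _ _ le_rfl (by omega)

/-- Book embedding of the base cycle. -/
def bbook (g : ℕ) (hg : 8 ≤ g) : Book (CA g) where
  key v := v.1
  L _ _ := False
  R a b := b.1 = a.1 + 1 ∨ (a.1 = 0 ∧ b.1 + 1 = g ∧ 0 < b.1)
  inj a b h := Fin.ext h
  Llt a b h := h.elim
  Rlt a b h := by omega
  cover u v h := by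
    have := u.2
    have := v.2
    simp only [CA, false_or] at *
    omega
  Lx a b c d h := h.elim
  Rx a b c d h h' := by
    have := a.2
    have := b.2
    have := c.2
    have := d.2
    omega

/-- Key of the guest cycle. -/
def zk (g t : ℕ) : ℕ := if t = 3 then g else t

theorem zk_cases (g t : ℕ) : (t = 3 ∧ zk g t = g) ∨ (t ≠ 3 ∧ zk g t = t) := by
  simp only [zk]
  split_ifs <;> omega

/-- Left chords of the guest cycle. -/
def zL (a b : ℕ) : Prop := (a = 2 ∨ a = 4) ∧ b = 3

/-- Right chords of the guest cycle. -/
def zR (g a b : ℕ) : Prop := (a = 0 ∧ b = 1) ∨ (a = 1 ∧ b = 2) ∨ (a = 0 ∧ b + 1 = g) ∨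
    (4 ≤ a ∧ b = a + 1)

/-- Book embedding of the guest cycle. -/
def zbook (g : ℕ) (hg : 8 ≤ g) : Book (CA g) where
  key v := zk g v.1
  L a b := zL a.1 b.1
  R a b := zR g a.1 b.1
  inj a b h := by
    have := a.2
    have := b.2
    apply Fin.ext
    have := zk_cases g a.1
    have := zk_cases g b.1
    omega
  Llt a b h := by
    have := a.2
    have := b.2
    have := zk_cases g a.1
    have := zk_cases g b.1
    simp only [zL] at h
    omega
  Rlt a b h := by
    have := a.2
    have := b.2
    have := zk_cases g a.1
    have := zk_cases g b.1
    simp only [zR] at h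
    omega
  cover u v h := by
    have := u.2
    have := v.2
    rcases h with h | h
    · by_cases h2 : u.1 = 2
      · left; simp only [zL]; omega
      · by_cases h3 : u.1 = 3
        · right; left; simp only [zL]; omega
        · right; right; left; simp only [zR]; omega
    · right; right; right; simp only [zR]; omega
  Lx a b c d h h' := by
    have := zk_cases g b.1
    have := zk_cases g d.1
    simp only [zL] at h h'
    omega
  Rx a b c d h h' := by
    have := a.2
    have := b.2
    have := c.2
    have := d.2
    have := zk_cases g a.1
    have := zk_cases g b.1
    have := zk_cases g c.1
    have := zk_cases g d.1
    simp only [zR] at h h'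
    rcases h with h | h | h | h <;> rcases h' with h' | h' | h' | h' <;> omega

/-- The base cycle. -/
def bst (g : ℕ) (hg : 8 ≤ g) : St g g 1 := cst g (by omega) ⟨4, by omega⟩ (bbook g hg)

/-- The host port of the base cycle. -/
def bport (g : ℕ) (hg : 8 ≤ g) : Prt (Fin g) :=
  ⟨⟨1, by omega⟩, ⟨2, by omega⟩, ⟨3, by omega⟩, ⟨5, by omega⟩, ⟨6, by omega⟩, ⟨7, by omega⟩⟩

theorem bhost (g : ℕ) (hg : 8 ≤ g) : HostOK (bst g hg) (bport g hg) where
  deg := by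
    refine ⟨?_, ?_, ?_, ?_, ?_, ?_, ?_, ?_⟩
    · exact Or.inl rfl
    · exact Or.inl rfl
    · intro u h
      change CA g _ _ at h
      apply Fin.ext
      simp only [CA, bport] at *
      omega
    · intro u h
      change CA g _ _ at h
      apply Fin.ext
      simp only [CA, bport] at *
      omega
    · exact Or.inl rfl
    · exact Or.inl rfl
    · intro u h
      change CA g _ _ at h
      apply Fin.ext
      simp only [CA, bport] at *
      omega
    · intro u h
      change CA g _ _ at h
      apply Fin.ext
      simp only [CA, bport] at *
      omega
  flat := fun e => ⟨rfl, rfl⟩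
  book := by
    show BHost (bbook g hg) (bport g hg)
    refine ⟨?_, ?_, ?_, ?_, ?_, ?_, ?_⟩ <;> simp only [bbook, bport, Fin.ext_iff] <;> try omega
    intro a b h
    exact h.elim
  fv := by
    show HFv (CA.fv g _) (bport g hg)
    refine ⟨?_, ?_, ?_⟩
    · simp [CA.fv, bport]
    · simp [CA.fv, bport]
    · simp [CA.fv, bport]
      omega

theorem bdst (g : ℕ) (hg : 8 ≤ g) : Dst (bst g hg).A (bport g hg) 4 (g - 4) :=
  dst_of_walks (g := g) (CA.girth g) (bport g hg) (CA.wk' g 2 4 6 _ _ (by omega) (by omega))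
    (CA.wk' g 6 (g - 4) 2 _ _ (by omega) (by omega)) (by omega) (by omega) (by omega)

/-- The guest cycle. -/
def zst (g : ℕ) (hg : 8 ≤ g) : St g g 1 := cst g (by omega) ⟨1, by omega⟩ (zbook g hg)

/-- The guest port of the guest cycle. -/
def zport (g : ℕ) (hg : 8 ≤ g) : Prt (Fin g) :=
  ⟨⟨g - 1, by omega⟩, ⟨0, by omega⟩, ⟨1, by omega⟩, ⟨2, by omega⟩, ⟨3, by omega⟩, ⟨4, by omega⟩⟩

theorem zguest (g : ℕ) (hg : 8 ≤ g) : GuestOK (zst g hg) (zport g hg) where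
  deg := by
    refine ⟨?_, ?_, ?_, ?_, ?_, ?_, ?_, ?_⟩
    · show CA g _ _
      simp only [CA, zport, and_true]
      omega
    · exact Or.inl rfl
    · intro u h
      change CA g _ _ at h
      apply Fin.ext
      simp only [CA, zport] at *
      omega
    · intro u h
      change CA g _ _ at h
      apply Fin.ext
      simp only [CA, zport] at *
      omega
    · exact Or.inl rfl
    · exact Or.inl rfl
    · intro u h
      change CA g _ _ at h
      apply Fin.ext
      simp only [CA, zport] at *
      omega
    · intro u h
      change CA g _ _ at h
      apply Fin.ext
      simp only [CA, zport] at *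
      omega
  flat := fun e => ⟨rfl, rfl⟩
  book := by
    show BGuest (zbook g hg) (zport g hg)
    refine ⟨?_, ?_, ?_, ?_, ?_, ?_, ?_, ?_, ?_, ?_, ?_, ?_⟩ <;>
      simp only [zbook, zport, zL, zR] <;> have z0 := zk_cases g 0 <;> have z1 := zk_cases g 1 <;>
      have z2 := zk_cases g 2 <;> have z3 := zk_cases g 3 <;> have z4 := zk_cases g 4 <;>
      have zz := zk_cases g (g - 1) <;> try omega
    all_goals
      intro c
      have := c.2
      have := zk_cases g c.1
      first
        | omega
        | intro d h
          have := d.2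
          have := zk_cases g d.1
          omega
  fv := by
    show GFv (CA.fv g _) (zport g hg)
    refine ⟨?_, ?_, ?_⟩
    · simp [CA.fv, zport]
    · simp [CA.fv, zport]
    · simp [CA.fv, zport]

theorem zdst (g : ℕ) (hg : 8 ≤ g) : Dst (zst g hg).A (zport g hg) 3 (g - 3) :=
  dst_of_walks (g := g) (CA.girth g) (zport g hg) (CA.wk' g 0 3 3 _ _ (by omega) (by omega))
    (CA.wk' g 3 (g - 3) 0 _ _ (by omega) (by omega)) (by omega) (by omega) (by omega)

end Cycles

set_option linter.unusedSimpArgs false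

section Assembly

theorem RP.hkey (R : RP) (k : ℕ) (hk : R.HP k) :
    R.book.key R.gport.q < R.book.key (R.hport k hk).qm ∧
    R.book.key (R.hport k hk).rp < R.book.key R.gport.r ∧
    R.book.key (R.hport k hk).rp ≤ R.book.key R.gport.rp ∧
    R.book.key (R.hport k hk).rp ≤ R.book.key R.gport.rm := by
  have := R.num
  have ck := R.pc k
  have ck' := R.pc (k + 1)
  have cj := R.pc R.j
  obtain ⟨h1, h2, h3, h4⟩ := id hk
  refine ⟨?_, ?_, ?_, ?_⟩ <;>
  · simp only [R.book_key, R.key_lt, R.key_le, RP.hport, RP.gport, RP.col_D, RP.pos_D, RP.col_P, RP.pos_P,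
      RP.col_xx, RP.pos_xx, RP.col_aa, RP.pos_aa, RP.col_bb, RP.pos_bb,
      RP.col_yy, RP.pos_yy, RP.col_A, RP.pos_A, RP.col_B, RP.pos_B,
      true_and, and_true, true_or, or_true, false_or, or_false,
      not_true_eq_false, not_false_eq_true, false_and, and_false]
    try omega

theorem RP.hkey12 (R : RP) (h1 : R.HP 1) (h2 : R.HP 2) :
    R.book.key (R.hport 1 h1).rp ≤ R.book.key (R.hport 2 h2).qm := by
  have := R.num
  obtain ⟨_, _, _, _⟩ := id h2
  simp only [R.book_key, R.key_lt, R.key_le, RP.hport, RP.col_D, RP.pos_D, RP.col_P, RP.pos_P,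
      true_and, and_true, true_or, or_true, false_or, or_false,
      not_true_eq_false, not_false_eq_true, false_and, and_false]
  omega

/-- Distances at the first host port after attaching the ring. -/
theorem RP.hdst_map (R : RP) (hk : R.HP 1) {V W : Type} {A1 : V → V → Prop} {A : W → W → Prop}
    {i1 : V → W} {i2 : R.T → W} {P : Prt V} {h1 h2 x1 x2 : ℕ}
    (N : GlueN A1 R.Adj A i1 i2 P R.gport R.g h1 h2 x1 x2) (K M : ℕ) (hK : K ≤ 4 + R.e)
    (hKg : K ≤ R.g) (hM : M ≤ R.nr) (hMg : M ≤ R.g) (hM2 : M ≤ h2 + R.p0 + R.p1 + R.e + 3) :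
    Dst A ((R.hport 1 hk).map i2) K M := by
  have hn := R.num
  obtain ⟨k1, k2, k3, k4⟩ := id hk
  have k5 : R.p0 + 5 ≤ R.g := by have := R.pc 1; omega
  have D := R.hdst hk K M hK hM
  have a1 := N.h12
  have a2 := N.h22
  have d1 := N.dst1
  constructor
  · intro l w
    rcases N.flip.dist w with h | h | ⟨l1, l2, l3, w1, w2, w3, h⟩ | ⟨l1, l2, l3, w1, w2, w3, h⟩
    · omega
    · exact D.qr _ h
    · have b1 := RP.pot (R.dq_le k3 k5) w1
      have b2 := d1.qr _ w2
      simp only [RP.hport, RP.gport, RP.dq] at b1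
      rw [if_pos trivial, if_pos (by omega)] at b1
      omega
    · have b1 := RP.pot (R.dq_le k3 k5) w1
      have b2 := d1.rq _ w2
      simp only [RP.hport, RP.gport, RP.dq] at b1
      rw [if_pos trivial, if_pos (by omega)] at b1
      omega
  · intro l w
    rcases N.flip.dist w with h | h | ⟨l1, l2, l3, w1, w2, w3, h⟩ | ⟨l1, l2, l3, w1, w2, w3, h⟩
    · omega
    · exact D.rq _ h
    · have b1 := RP.pot (R.dr_le k3 k5) w1
      have b2 := d1.qr _ w2
      simp only [RP.hport, RP.gport, RP.dr] at b1
      simp at b1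
      omega
    · have b1 := RP.pot (R.dr_le k3 k5) w1
      have b2 := d1.rq _ w2
      have b3 := RP.pot R.dx_le w3
      simp only [RP.hport, RP.gport, RP.dr] at b1
      simp only [RP.hport, RP.gport, RP.dx] at b3
      simp at b1
      omega

/-- Attaching a ring. -/
theorem RP.ring_step (R : RP) (hk : R.HP 1) {n k h1 h2 : ℕ} (S : St R.g n k) (P : Prt S.V)
    (HP : HostOK S P) (D : Dst S.A P h1 h2) (c1 : 2 ≤ h1) (c2 : 2 ≤ h2)
    (e1 : R.p1 + 1 ≤ h1) (e2 : R.g ≤ h2 + R.p0 + 1) (K M : ℕ) (hK : K ≤ 4 + R.e)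
    (hM : M ≤ R.nr) (hMg : M ≤ R.g) (m : ℕ) (hm : m + 2 = n + (R.g*R.j+2*R.j+2*R.e+4)) :
    ∃ (S' : St R.g m (k + (R.j + 2))) (P1 : Prt S'.V), HostOK S' P1 ∧ Dst S'.A P1 K M ∧
      (∀ h : R.HP 2, ∃ P2 : Prt S'.V, HostOK S' P2 ∧ Wk S'.A 4 P2.q P2.r ∧
        Wk S'.A (R.g - 4) P2.r P2.q ∧ S'.B.key P1.rp ≤ S'.B.key P2.qm) := by
  have hn := R.num
  obtain ⟨k1, k2, k3, k4⟩ := id hk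
  obtain ⟨S', i1, i2, N, -, H2, H3⟩ := attach S R.st P R.gport HP R.guestOK D
    (R.gdst (R.p0 + 3) (R.g + 1 - R.p1) le_rfl (by omega)) (by omega) c1 c2 (by omega) (by omega)
    (by omega) (by omega) m hm
  have host : ∀ k (h : R.HP k), HostOK S' ((R.hport k h).map i2) := fun k h => by
    obtain ⟨q1, q2, q3, q4⟩ := R.hkey k h
    exact H2 _ (R.hostOK k h) q1 q2 (Or.inr q3) (Or.inr q4)
  refine ⟨S', (R.hport 1 hk).map i2, host 1 hk,
    R.hdst_map hk N K M hK (by omega) hM hMg (by omega), fun h => ⟨(R.hport 2 h).map i2, host 2 h, ?_, ?_, ?_⟩⟩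
  · exact (R.walk_qr 2 h rfl).map i2 N.G.arc2
  · exact (R.walk_rq 2 h rfl rfl).map i2 N.G.arc2
  · exact H3 _ _ (R.hkey12 hk h)

/-- Even digirth. -/
theorem fam_even (g j : ℕ) (hg : g = 2 * j + 2) (hj : 3 ≤ j) (s : ℕ) :
    ∃ (S : St g (g + (g * (j + 1)) * s) (1 + (j + 2) * s)) (P : Prt S.V), HostOK S P ∧ Dst S.A P 4 (g - 4) := by
  induction s with
  | zero => exact ⟨bst g (by omega), _, bhost g (by omega), bdst g (by omega)⟩
  | succ s ih =>
    obtain ⟨S, P, HP, D⟩ := ih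
    let R : RP := ⟨g, j, 3, 3, 0, by omega, by omega, by omega, by omega, by omega, by omega⟩
    have hk : R.HP 1 := ⟨le_rfl, by show 1 + 1 ≤ j; omega, le_rfl, by show 3 + 5 ≤ g; omega⟩
    have := R.ring_step hk S P HP D (by omega) (by omega) (by show 3 + 1 ≤ 4; omega)
      (by show g ≤ g - 4 + 3 + 1; omega) 4 (g - 4) (by omega) (by show g - 4 ≤ g + 3 + 0 - 3 - 4; omega)
      (by show g - 4 ≤ g; omega) (g + (g * (j + 1)) * (s + 1)) (by
        show _ = _ + (g * j + 2 * j + 2 * 0 + 4)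
        have : g * (j + 1) * (s + 1) = g * (j + 1) * s + g * j + g := by ring
        omega)
    obtain ⟨S', P', H, D', -⟩ := this
    have fin : ∃ S : St g (g + (g * (j + 1)) * (s + 1)) (1 + (j + 2) * s + (j + 2)), ∃ P : Prt S.V,
        HostOK S P ∧ Dst S.A P 4 (g - 4) := ⟨S', P', H, D'⟩
    rw [show 1 + (j + 2) * s + (j + 2) = 1 + (j + 2) * (s + 1) by rw [Nat.mul_succ]; omega] at fin
    exact fin

/-- Digirth six and seven. -/
theorem fam_small (g e : ℕ) (hg : g = 6 + e) (he : e ≤ 1) (s : ℕ) :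
    ∃ (S : St g (20 + 4 * e + (18 + 4 * e) * s) (4 + 4 * s)) (P : Prt S.V), HostOK S P ∧ Dst S.A P 4 (g - 2) := by
  let R : RP := ⟨g, 2, 1, 3, e, by omega, by omega, by omega, by omega, by omega, by omega⟩
  have hk : R.HP 1 := ⟨le_rfl, le_rfl, le_rfl, by show 1 + 5 ≤ g; omega⟩
  induction s with
  | zero =>
    have h : ∃ S : St R.g (R.g*R.j+2*R.j+2*R.e+4) (R.j+2), ∃ P : Prt S.V, HostOK S P ∧ Dst S.A P 4 (g - 2) :=
      ⟨R.st, _, R.hostOK 1 hk, R.hdst hk 4 (g - 2) (by omega) (by show g - 2 ≤ g + 3 + e - 1 - 4; omega)⟩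
    have e1 : R.g*R.j+2*R.j+2*R.e+4 = 20 + 4 * e + (18 + 4 * e) * 0 := by
      show g * 2 + 2 * 2 + 2 * e + 4 = _
      omega
    rw [e1] at h
    exact h
  | succ s ih =>
    obtain ⟨S, P, HP, D⟩ := ih
    have := R.ring_step hk S P HP D (by omega) (by omega) (by show 3 + 1 ≤ 4; omega)
      (by show g ≤ g - 2 + 1 + 1; omega) 4 (g - 2) (by omega) (by show g - 2 ≤ g + 3 + e - 1 - 4; omega)
      (by show g - 2 ≤ g; omega) (20 + 4 * e + (18 + 4 * e) * (s + 1)) (by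
        show _ = _ + (g * 2 + 2 * 2 + 2 * e + 4)
        rw [Nat.mul_succ]
        omega)
    obtain ⟨S', P', H, D', -⟩ := this
    exact ⟨S', P', H, D'⟩

/-- Odd digirth. -/
theorem fam_odd (g j : ℕ) (hg : g = 2 * j + 3) (hj : 3 ≤ j) (s : ℕ) :
    ∃ (S : St g (g + g ^ 2 * s) (1 + (g + 2) * s)) (P : Prt S.V), HostOK S P ∧ Dst S.A P 4 (g - 4) := by
  induction s with
  | zero => exact ⟨bst g (by omega), _, bhost g (by omega), bdst g (by omega)⟩
  | succ s ih =>
    obtain ⟨S, P, HP, D⟩ := ih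
    let R : RP := ⟨g, j, 3, 3, 1, by omega, by omega, by omega, by omega, by omega, by omega⟩
    have hk : R.HP 1 := ⟨le_rfl, by show 1 + 1 ≤ j; omega, le_rfl, by show 3 + 5 ≤ g; omega⟩
    obtain ⟨S1, P1, H1, D1, -⟩ := R.ring_step hk S P HP D (by omega) (by omega) (by show 3 + 1 ≤ 4; omega)
      (by show g ≤ g - 4 + 3 + 1; omega) 5 (g - 3) (by show 5 ≤ 4 + 1; omega) (by show g - 3 ≤ g + 3 + 1 - 3 - 4; omega)
      (by show g - 3 ≤ g; omega) (g + g ^ 2 * s + (g * j + 2 * j + 4)) (by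
        show _ = _ + (g * j + 2 * j + 2 * 1 + 4)
        omega)
    let R' : RP := ⟨g, j, 2, 4, 1, by omega, by omega, by omega, by omega, by omega, by omega⟩
    have hk1 : R'.HP 1 := ⟨le_rfl, by show 1 + 1 ≤ j; omega, by show 3 ≤ 4; omega, by show 2 + 5 ≤ g; omega⟩
    have hk2 : R'.HP 2 := ⟨by omega, by show 2 + 1 ≤ j; omega, by show 3 ≤ 4; omega, by show 4 + 5 ≤ g; omega⟩
    obtain ⟨S2, P2, H2, D2, X2⟩ := R'.ring_step hk1 S1 P1 H1 D1 (by omega) (by omega) (by show 4 + 1 ≤ 5; omega)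
      (by show g ≤ g - 3 + 2 + 1; omega) 5 (g - 1) (by show 5 ≤ 4 + 1; omega) (by show g - 1 ≤ g + 4 + 1 - 2 - 4; omega)
      (by show g - 1 ≤ g; omega) (g + g ^ 2 * s + (g * j + 2 * j + 4) + (g * j + 2 * j + 4)) (by
        show _ = _ + (g * j + 2 * j + 2 * 1 + 4)
        omega)
    obtain ⟨Q, HQ, w1, w2, kq⟩ := X2 hk2
    have g9 : 8 ≤ g := by omega
    obtain ⟨S3, i1, i2, N, T, -, -⟩ := attach (g := g) S2 (zst g g9) P2 (zport g g9) H2 (zguest g g9) D2 (zdst g g9)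
      (by omega) (by omega) (by omega) (by omega) (by omega) (by omega) (by omega) (g + g ^ 2 * (s + 1)) (by
        have : g ^ 2 * (s + 1) = g ^ 2 * s + g * g := by ring
        have h2 : g * g = 2 * (g * j) + 3 * g := by
          have : g * g = g * (2 * j + 3) := congrArg (g * ·) hg
          rw [this]; ring
        omega)
    have fin : ∃ S : St g (g + g ^ 2 * (s + 1)) (1 + (g + 2) * s + (j + 2) + (j + 2) + 1), ∃ P : Prt S.V,
        HostOK S P ∧ Dst S.A P 4 (g - 4) :=
      ⟨S3, Q.map i1, T Q HQ kq, dst_of_walks S3.gir _ (w1.map i1 N.G.arc1) (w2.map i1 N.G.arc1)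
        (by show 4 + (g - 4) = g; omega) (by omega) (by show 1 ≤ g - 4; omega)⟩
    have e1 : 1 + (g + 2) * s + (j + 2) + (j + 2) + 1 = 1 + (g + 2) * (s + 1) := by
      rw [Nat.mul_succ]; omega
    rw [e1] at fin
    exact fin

/-- The family of digraphs. -/
theorem fam_even' (g j : ℕ) (hg : g = 2 * j + 2) (hj : 3 ≤ j) (s : ℕ) :
    ∃ H : Digr, H.IsPlanar ∧ H.HasDigirth g ∧ H.fvs = 1 + (j + 2) * s ∧
      Nat.card H.V = g + (g * (j + 1)) * s := by
  obtain ⟨S, -⟩ := fam_even g j hg hj s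
  exact S.digr (by omega)

theorem fam_odd' (g j : ℕ) (hg : g = 2 * j + 3) (hj : 3 ≤ j) (s : ℕ) :
    ∃ H : Digr, H.IsPlanar ∧ H.HasDigirth g ∧ H.fvs = 1 + (g + 2) * s ∧
      Nat.card H.V = g + g ^ 2 * s := by
  obtain ⟨S, -⟩ := fam_odd g j hg hj s
  exact S.digr (by omega)

theorem fam_small' (g e : ℕ) (hg : g = 6 + e) (he : e ≤ 1) (s : ℕ) :
    ∃ H : Digr, H.IsPlanar ∧ H.HasDigirth g ∧ H.fvs = 4 + 4 * s ∧
      Nat.card H.V = 20 + 4 * e + (18 + 4 * e) * s := by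
  obtain ⟨S, -⟩ := fam_small g e hg he s
  exact S.digr (by omega)

theorem formula_aux (g n k : ℝ) (hg : 12 ≤ g) (t : ℝ) (hn : n = g + g ^ 2 * t)
    (hk : k = 1 + (g + 2) * t) : k = (n - 2 * g / (g + 2)) / (g - 2 * g / (g + 2)) := by
  have h1 : g + 2 ≠ 0 := by positivity
  have h2 : g - 2 * g / (g + 2) = g ^ 2 / (g + 2) := by field_simp; ring
  have h3 : g ^ 2 / (g + 2) ≠ 0 := by positivity
  rw [h2, eq_div_iff h3, hn, hk]
  field_simp
  ring

end Assembly

/-- For every `g ≥ 12` there is an infinite family of planar digraphs of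
digirth `g` whose members with `n` vertices satisfy
`fvs(H) = (n − 2g/(g+2))/(g − 2g/(g+2))`; consequently
`τ_g ≥ (g+2)/g²` for all `g ≥ 6` with `g ≠ 7`, and `τ_7 ≥ 2/11`. -/
theorem general_lower_bound_high_digirth_and_tau :
    (∀ g : ℕ, 12 ≤ g → ∀ N : ℕ, ∃ H : Digr, H.IsPlanar ∧ H.HasDigirth g ∧
      N ≤ Nat.card H.V ∧
      (H.fvs : ℝ) = ((Nat.card H.V : ℝ) - 2 * (g : ℝ) / ((g : ℝ) + 2)) /
        ((g : ℝ) - 2 * (g : ℝ) / ((g : ℝ) + 2))) ∧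
    (∀ g : ℕ, 6 ≤ g → g ≠ 7 → ((g : ℝ) + 2) / (g : ℝ) ^ 2 ≤ tauPlanar g) ∧
    (2 / 11 : ℝ) ≤ tauPlanar 7 := by
  refine ⟨?_, ?_, ?_⟩
  · intro g hg N
    have hgr : (12 : ℝ) ≤ g := by exact_mod_cast hg
    rcases Nat.even_or_odd' g with ⟨c, hc | hc⟩
    · obtain ⟨H, h1, h2, h3, h4⟩ := fam_even' g (c - 1) (by omega) (by omega) N
      refine ⟨H, h1, h2, ?_, formula_aux _ _ _ hgr (N / 2) ?_ ?_⟩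
      · rw [h4]
        have : 1 * N ≤ g * (c - 1 + 1) * N := Nat.mul_le_mul_right _ (Nat.mul_pos (by omega) (by omega))
        omega
      · rw [h4, show c - 1 + 1 = c by omega]
        have : (g : ℝ) = 2 * c := by exact_mod_cast hc
        push_cast
        rw [this]; ring
      · rw [h3, show c - 1 + 2 = c + 1 by omega]
        have : (g : ℝ) = 2 * c := by exact_mod_cast hc
        push_cast
        rw [this]; ring
    · obtain ⟨H, h1, h2, h3, h4⟩ := fam_odd' g (c - 1) (by omega) (by omega) N
      refine ⟨H, h1, h2, ?_, formula_aux _ _ _ hgr N ?_ ?_⟩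
      · rw [h4]
        have : 1 * N ≤ g ^ 2 * N := Nat.mul_le_mul_right _ (Nat.pow_pos (by omega))
        omega
      · rw [h4]; push_cast; ring
      · rw [h3]; push_cast; ring
  · intro g hg h7
    by_cases h6 : g = 6
    · subst h6
      have := tau_lower 6 4 4 20 18 (by omega) (fun s => by simpa using fam_small' 6 0 (by omega) (by omega) s)
      norm_num at this ⊢
      exact this
    rcases Nat.even_or_odd' g with ⟨c, hc | hc⟩
    · have := tau_lower g 1 (c - 1 + 2) g (g * (c - 1 + 1)) (Nat.mul_pos (by omega) (by omega))
        (fun s => fam_even' g (c - 1) (by omega) (by omega) s)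
      convert this using 1
      rw [show c - 1 + 1 = c by omega, show c - 1 + 2 = c + 1 by omega]
      have h : (g : ℝ) = 2 * c := by exact_mod_cast hc
      have hc0 : (c : ℝ) ≠ 0 := by
        have : c ≠ 0 := by omega
        exact_mod_cast this
      push_cast
      rw [h]
      field_simp
      try ring
    · have := tau_lower g 1 (g + 2) g (g ^ 2) (Nat.pow_pos (by omega))
        (fun s => fam_odd' g (c - 1) (by omega) (by omega) s)
      push_cast at this
      exact this
  · have := tau_lower 7 4 4 24 22 (by omega) (fun s => by simpa using fam_small' 7 1 (by omega) (by omega) s)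
    norm_num at this ⊢
    exact this
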